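/- There exist constants α ∈ (0,1) and C > 0, depending only on n, λ, Λ and p, such that the following holds. Let u be a bounded continuous function on B₁ and let f be continuous on B₁ with ‖f‖_{Lⁿ(B₁)} < ∞. Suppose u satisfies both M⁻_{λ,Λ}(D_p(Du) D²u D_p(Du)) − Λ|Du|^{p+1} ≤ f and M⁺_{λ,Λ}(D_p(Du) D²u D_p(Du)) + Λ|Du|^{p+1} ≥ f in B₁ in the viscosity sense. Then for all x, y ∈ B_{1/2}, |u(x) − u(y)| ≤ C·(sup_{B₁}|u| + ‖f‖_{Lⁿ(B₁)}^{1/(1+p)})·|x − y|^α. -/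

import Mathlib

open MeasureTheory Metric Set

noncomputable section

/-- Euclidean space ℝⁿ. -/
abbrev En (n : ℕ) := EuclideanSpace ℝ (Fin n)

/-- The Pucci extremal operator `M⁻_{λ,Λ}(M) = λ·Σ_{e>0} e + Λ·Σ_{e<0} e`. -/
noncomputable def pucciInf {ι : Type*} [Fintype ι] [DecidableEq ι] (lam Lam : ℝ)
    (M : Matrix ι ι ℝ) : ℝ :=
  if h : M.IsHermitian then
    ∑ i, (lam * max (h.eigenvalues i) 0 + Lam * min (h.eigenvalues i) 0)
  else 0

/-- The Pucci extremal operator `M⁺_{λ,Λ}(M) = Λ·Σ_{e>0} e + λ·Σ_{e<0} e`. -/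
noncomputable def pucciSup {ι : Type*} [Fintype ι] [DecidableEq ι] (lam Lam : ℝ)
    (M : Matrix ι ι ℝ) : ℝ :=
  if h : M.IsHermitian then
    ∑ i, (Lam * max (h.eigenvalues i) 0 + lam * min (h.eigenvalues i) 0)
  else 0

/-- The gradient vector `Dψ(x)` of coordinatewise partial derivatives. -/
noncomputable def gradVec {n : ℕ} (ψ : En n → ℝ) (x : En n) : Fin n → ℝ :=
  fun i => fderiv ℝ ψ x (EuclideanSpace.single i 1)

/-- The Hessian matrix `D²ψ(x)` of second partial derivatives. -/
noncomputable def hessMat {n : ℕ} (ψ : En n → ℝ) (x : En n) : Matrix (Fin n) (Fin n) ℝ :=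
  Matrix.of fun i j =>
    fderiv ℝ (fun y => fderiv ℝ ψ y (EuclideanSpace.single j 1)) x (EuclideanSpace.single i 1)

/-- `D_p(z) = diag(|z₁|^{p/2},…,|zₙ|^{p/2})`. -/
noncomputable def Dp {n : ℕ} (p : ℝ) (z : Fin n → ℝ) : Matrix (Fin n) (Fin n) ℝ :=
  Matrix.diagonal fun i => |z i| ^ (p / 2)

/-- Euclidean norm of a vector of `Fin n → ℝ`. -/
noncomputable def vnorm {n : ℕ} (v : Fin n → ℝ) : ℝ := Real.sqrt (∑ i, v i ^ 2)

/-- `u` satisfies `M⁻_{λ,Λ}(D_p(Du) D²u D_p(Du)) − Λ|Du|^{p+1} ≤ f` in `Ω`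
in the viscosity sense. -/
def IsViscSuper {n : ℕ} (lam Lam p : ℝ) (Ω : Set (En n)) (u f : En n → ℝ) : Prop :=
  ∀ x₀ ∈ Ω, ∀ ψ : En n → ℝ, ContDiffOn ℝ 2 ψ Ω →
    IsLocalMinOn (fun x => u x - ψ x) Ω x₀ →
    pucciInf lam Lam (Dp p (gradVec ψ x₀) * hessMat ψ x₀ * Dp p (gradVec ψ x₀))
      - Lam * vnorm (gradVec ψ x₀) ^ (p + 1) ≤ f x₀

/-- `u` satisfies `M⁺_{λ,Λ}(D_p(Du) D²u D_p(Du)) + Λ|Du|^{p+1} ≥ f` in `Ω`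
in the viscosity sense. -/
def IsViscSub {n : ℕ} (lam Lam p : ℝ) (Ω : Set (En n)) (u f : En n → ℝ) : Prop :=
  ∀ x₀ ∈ Ω, ∀ ψ : En n → ℝ, ContDiffOn ℝ 2 ψ Ω →
    IsLocalMaxOn (fun x => u x - ψ x) Ω x₀ →
    f x₀ ≤ pucciSup lam Lam (Dp p (gradVec ψ x₀) * hessMat ψ x₀ * Dp p (gradVec ψ x₀))
      + Lam * vnorm (gradVec ψ x₀) ^ (p + 1)

/-- `‖f‖_{Lⁿ(Ω)} = (∫_Ω |f|ⁿ)^{1/n}`. -/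
noncomputable def LnNorm {n : ℕ} (f : En n → ℝ) (Ω : Set (En n)) : ℝ :=
  (∫ x in Ω, |f x| ^ (n : ℝ)) ^ ((n : ℝ)⁻¹)

/-- The open cube `Q_r = {x : |x_i| < r for all i}`. -/
def Qcube (n : ℕ) (r : ℝ) : Set (En n) := {x | ∀ i, |x i| < r}

/-- The trace of a product of two positive semidefinite matrices is nonnegative. -/
theorem trace_mul_nonneg_of_posSemidef {ι : Type*} [Fintype ι] [DecidableEq ι]
    {A P : Matrix ι ι ℝ} (hA : A.PosSemidef) (hP : P.PosSemidef) : 0 ≤ (A * P).trace := by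
  have h := hP.1
  set U : Matrix ι ι ℝ := (h.eigenvectorUnitary : Matrix ι ι ℝ) with hU
  have hM : P = U * Matrix.diagonal h.eigenvalues * star U := by
    have := h.spectral_theorem
    rw [Unitary.conjStarAlgAut_apply] at this
    exact this
  have h1 : (A * P).trace = (star U * A * U * Matrix.diagonal h.eigenvalues).trace := by
    conv_lhs => rw [hM]
    rw [← Matrix.mul_assoc, Matrix.trace_mul_comm]
    simp only [Matrix.mul_assoc]
  rw [h1]
  simp only [Matrix.trace, Matrix.diag, Matrix.mul_diagonal]
  exact Finset.sum_nonneg fun i _ => mul_nonneg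
    (hA.conjTranspose_mul_mul_same U).diag_nonneg (hP.eigenvalues_nonneg i)

/-- Symmetric matrices with spectrum in `[lam, Lam]`. -/
def EllMat {n : ℕ} (lam Lam : ℝ) (A : Matrix (Fin n) (Fin n) ℝ) : Prop :=
  (A - lam • (1 : Matrix (Fin n) (Fin n) ℝ)).PosSemidef ∧
    (Lam • (1 : Matrix (Fin n) (Fin n) ℝ) - A).PosSemidef

theorem EllMat.le_trace {n : ℕ} {lam Lam : ℝ} {A P : Matrix (Fin n) (Fin n) ℝ}
    (hA : EllMat lam Lam A) (hP : P.PosSemidef) : lam * P.trace ≤ (A * P).trace := by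
  have := trace_mul_nonneg_of_posSemidef hA.1 hP
  rw [Matrix.sub_mul, Matrix.trace_sub, Matrix.smul_mul, Matrix.one_mul, Matrix.trace_smul,
    smul_eq_mul] at this
  linarith

theorem EllMat.trace_le {n : ℕ} {lam Lam : ℝ} {A P : Matrix (Fin n) (Fin n) ℝ}
    (hA : EllMat lam Lam A) (hP : P.PosSemidef) : (A * P).trace ≤ Lam * P.trace := by
  have := trace_mul_nonneg_of_posSemidef hA.2 hP
  rw [Matrix.sub_mul, Matrix.trace_sub, Matrix.smul_mul, Matrix.one_mul, Matrix.trace_smul,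
    smul_eq_mul] at this
  linarith

/-- A weight applied to the eigenvalues of a symmetric matrix is realized as the trace against
an elliptic coefficient matrix. -/
theorem exists_ellMat_trace_eq {n : ℕ} {lam Lam : ℝ} {M : Matrix (Fin n) (Fin n) ℝ}
    (h : M.IsHermitian) (c : Fin n → ℝ) (hc : ∀ i, c i ∈ Icc lam Lam) :
    ∃ A, EllMat lam Lam A ∧ (A * M).trace = ∑ i, c i * h.eigenvalues i := by
  set U : Matrix (Fin n) (Fin n) ℝ := (h.eigenvectorUnitary : Matrix (Fin n) (Fin n) ℝ) with hU
  have hUU : U * star U = 1 := Unitary.coe_mul_star_self _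
  have hUU' : star U * U = 1 := Unitary.coe_star_mul_self _
  have hM : M = U * Matrix.diagonal h.eigenvalues * star U := by
    have := h.spectral_theorem
    rw [Unitary.conjStarAlgAut_apply] at this
    exact this
  have key : ∀ d : Fin n → ℝ, (∀ i, 0 ≤ d i) →
      (U * Matrix.diagonal d * star U).PosSemidef := fun d hd =>
    (Matrix.PosSemidef.diagonal (fun i => hd i)).mul_mul_conjTranspose_same U
  have hs : ∀ r : ℝ, r • (1 : Matrix (Fin n) (Fin n) ℝ)
      = U * Matrix.diagonal (fun _ => r) * star U := by
    intro r
    rw [← Matrix.smul_one_eq_diagonal, Matrix.mul_smul, Matrix.mul_one, Matrix.smul_mul, hUU]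
  refine ⟨U * Matrix.diagonal c * star U, ⟨?_, ?_⟩, ?_⟩
  · rw [hs, ← Matrix.sub_mul, ← Matrix.mul_sub, Matrix.diagonal_sub]
    exact key _ fun i => sub_nonneg.2 (hc i).1
  · rw [hs, ← Matrix.sub_mul, ← Matrix.mul_sub, Matrix.diagonal_sub]
    exact key _ fun i => sub_nonneg.2 (hc i).2
  · have : U * Matrix.diagonal c * star U * M
        = U * (Matrix.diagonal fun i => c i * h.eigenvalues i) * star U := by
      conv_lhs => rw [hM]
      calc _ = U * Matrix.diagonal c * (star U * U) * Matrix.diagonal h.eigenvalues * star U := by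
            simp only [Matrix.mul_assoc]
        _ = _ := by
            rw [hUU', Matrix.mul_one, Matrix.mul_assoc U, Matrix.diagonal_mul_diagonal]
    rw [this, Matrix.trace_mul_comm, ← Matrix.mul_assoc, hUU', Matrix.one_mul,
      Matrix.trace_diagonal]

theorem exists_ellMat_pucciInf {n : ℕ} {lam Lam : ℝ} (hl : lam ≤ Lam)
    {M : Matrix (Fin n) (Fin n) ℝ} (h : M.IsHermitian) :
    ∃ A, EllMat lam Lam A ∧ (A * M).trace = pucciInf lam Lam M := by
  obtain ⟨A, hA, hA'⟩ := exists_ellMat_trace_eq (lam := lam) (Lam := Lam) h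
    (fun i => if 0 ≤ h.eigenvalues i then lam else Lam) (fun i => by split_ifs <;> simp [hl])
  refine ⟨A, hA, ?_⟩
  rw [hA', pucciInf, dif_pos h]
  refine Finset.sum_congr rfl fun i _ => ?_
  split_ifs with h0
  · simp [h0]
  · simp [(not_le.1 h0).le]

theorem exists_ellMat_pucciSup {n : ℕ} {lam Lam : ℝ} (hl : lam ≤ Lam)
    {M : Matrix (Fin n) (Fin n) ℝ} (h : M.IsHermitian) :
    ∃ A, EllMat lam Lam A ∧ (A * M).trace = pucciSup lam Lam M := by
  obtain ⟨A, hA, hA'⟩ := exists_ellMat_trace_eq (lam := lam) (Lam := Lam) h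
    (fun i => if 0 ≤ h.eigenvalues i then Lam else lam) (fun i => by split_ifs <;> simp [hl])
  refine ⟨A, hA, ?_⟩
  rw [hA', pucciSup, dif_pos h]
  refine Finset.sum_congr rfl fun i _ => ?_
  split_ifs with h0
  · simp [h0]
  · simp [(not_le.1 h0).le]

theorem det_le_trace_pow {n : ℕ} {Y : Matrix (Fin n) (Fin n) ℝ} (hY : Y.PosSemidef) :
    Y.det ≤ Y.trace ^ n := by
  rw [hY.1.det_eq_prod_eigenvalues, hY.1.trace_eq_sum_eigenvalues]
  simp only [RCLike.ofReal_real_eq_id, id]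
  calc ∏ i, hY.1.eigenvalues i ≤ ∏ _i : Fin n, ∑ j, hY.1.eigenvalues j :=
        Finset.prod_le_prod (fun i _ => hY.eigenvalues_nonneg i) fun i _ =>
          Finset.single_le_sum (fun j _ => hY.eigenvalues_nonneg j) (Finset.mem_univ i)
    _ = _ := by simp

/-- Weighted arithmetic-geometric inequality for positive semidefinite matrices. -/
theorem det_mul_prod_le {n : ℕ} {Y : Matrix (Fin n) (Fin n) ℝ} (hY : Y.PosSemidef)
    {w : Fin n → ℝ} (hw : ∀ i, 0 ≤ w i) :
    Y.det * ∏ i, w i ≤ (∑ i, w i * Y i i) ^ n := by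
  set D : Matrix (Fin n) (Fin n) ℝ := Matrix.diagonal fun i => Real.sqrt (w i) with hD
  have hDt : D.conjTranspose = D := by simp [hD]
  have h1 : (D * Y * D).PosSemidef := by
    have := hY.mul_mul_conjTranspose_same D
    rwa [hDt] at this
  have h2 := det_le_trace_pow h1
  rw [Matrix.det_mul, Matrix.det_mul, hD, Matrix.det_diagonal] at h2
  have h3 : ((∏ i, Real.sqrt (w i)) * Y.det) * ∏ i, Real.sqrt (w i) = Y.det * ∏ i, w i := by
    rw [mul_comm (∏ i, Real.sqrt (w i)) Y.det, mul_assoc, ← Finset.prod_mul_distrib]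
    simp [Real.mul_self_sqrt (hw _)]
  rw [h3] at h2
  refine h2.trans_eq ?_
  congr 1
  simp only [Matrix.trace, Matrix.diag, Matrix.mul_diagonal, Matrix.diagonal_mul]
  refine Finset.sum_congr rfl fun i _ => ?_
  rw [mul_right_comm, Real.mul_self_sqrt (hw i)]

/-- The model Hessian `-a diag(1/w) + b s sᵀ`. -/
def modelHess {n : ℕ} (a b : ℝ) (w s : Fin n → ℝ) : Matrix (Fin n) (Fin n) ℝ :=
  Matrix.diagonal (fun i => -(a / w i)) + b • Matrix.vecMulVec s s

theorem det_modelHess {n : ℕ} {a b : ℝ} (ha : 0 < a) {w s : Fin n → ℝ} (hw : ∀ i, 0 < w i) :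
    (modelHess a b w s).det * ∏ i, w i = (-a) ^ n * (1 - b / a * ∑ i, w i * s i ^ 2) := by
  have h1 : modelHess a b w s = Matrix.diagonal (fun i => -(a / w i)) *
      (1 + Matrix.replicateCol Unit (fun i => -(b / a) * w i * s i) *
        Matrix.replicateRow Unit s) := by
    ext i j
    have := (hw i).ne'
    rw [Matrix.mul_add, Matrix.mul_one, Matrix.add_apply, Matrix.diagonal_mul]
    simp only [modelHess, Matrix.add_apply, Matrix.smul_apply, Matrix.vecMulVec_apply,
      smul_eq_mul, Matrix.mul_apply,
      Matrix.replicateCol_apply, Matrix.replicateRow_apply, Finset.univ_unique, Finset.sum_const,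
      Finset.card_singleton, one_smul]
    field_simp
  rw [h1, Matrix.det_mul, Matrix.det_one_add_replicateCol_mul_replicateRow, Matrix.det_diagonal]
  have h2 : (∏ i, -(a / w i)) * ∏ i, w i = (-a) ^ n := by
    rw [← Finset.prod_mul_distrib]
    have : ∀ i, -(a / w i) * w i = -a := fun i => by have := (hw i).ne'; field_simp
    simp [this]
  rw [mul_right_comm, h2]
  congr 1
  simp only [dotProduct]
  rw [Finset.mul_sum, sub_eq_add_neg, ← Finset.sum_neg_distrib]
  congr 1
  exact Finset.sum_congr rfl fun i _ => by ring

/-- Determinant comparison at a contact point. -/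
theorem abs_det_sub_le {n : ℕ} {a b : ℝ} (ha : 0 < a) {w s : Fin n → ℝ} (hw : ∀ i, 0 < w i)
    (hb : b = 0 ∨ 2 * a ≤ b * ∑ i, w i * s i ^ 2) {X : Matrix (Fin n) (Fin n) ℝ}
    (hX : (X - modelHess a b w s).PosSemidef) {τ : ℝ}
    (hτ : ∑ i, w i * (X - modelHess a b w s) i i ≤ τ) :
    |(modelHess a b w s - X).det| ≤ (τ / a) ^ n * |(modelHess a b w s).det| := by
  have hW : 0 < ∏ i, w i := Finset.prod_pos fun i _ => hw i
  have h1 := det_mul_prod_le hX fun i => (hw i).le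
  have h0 : 0 ≤ ∑ i, w i * (X - modelHess a b w s) i i :=
    Finset.sum_nonneg fun i _ => mul_nonneg (hw i).le (hX.diag_nonneg)
  have h2 : (X - modelHess a b w s).det * ∏ i, w i ≤ τ ^ n :=
    h1.trans (pow_le_pow_left₀ h0 hτ n)
  have h3 : |(modelHess a b w s - X).det| = (X - modelHess a b w s).det := by
    rw [← neg_sub, Matrix.det_neg, abs_mul, abs_pow, abs_neg, abs_one, one_pow, one_mul,
      abs_of_nonneg hX.det_nonneg]
  have h4 : a ^ n ≤ |(modelHess a b w s).det| * ∏ i, w i := by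
    rw [← abs_of_pos hW, ← abs_mul, det_modelHess ha hw, abs_mul, abs_pow, abs_neg,
      abs_of_pos ha]
    refine le_mul_of_one_le_right (pow_nonneg ha.le _) ?_
    rcases hb with hb | hb
    · simp [hb]
    · have : 2 ≤ b / a * ∑ i, w i * s i ^ 2 := by
        rw [div_mul_eq_mul_div, le_div_iff₀ ha]; exact hb
      rw [abs_of_nonpos (by linarith)]; linarith
  rw [h3, div_pow, div_mul_eq_mul_div, le_div_iff₀ (pow_pos ha n)]
  have h5 : 0 ≤ τ ^ n := pow_nonneg (h0.trans hτ) n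
  have h6 := hX.det_nonneg
  calc (X - modelHess a b w s).det * a ^ n
      ≤ (X - modelHess a b w s).det * (|(modelHess a b w s).det| * ∏ i, w i) := by gcongr
    _ = ((X - modelHess a b w s).det * ∏ i, w i) * |(modelHess a b w s).det| := by ring
    _ ≤ _ := by gcongr

/-- A locally Lipschitz image of a null set is null. -/
theorem volume_image_eq_zero_of_locally_lipschitz {n : ℕ} {T : En n → En n} {N : Set (En n)}
    (hT : ∀ x ∈ N, ∃ K, ∃ s ∈ nhds x, LipschitzOnWith K T s) (hN : volume N = 0) :
    volume (T '' N) = 0 := by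
  choose! K s hs hL using hT
  obtain ⟨t, htN, htc, hcov⟩ := TopologicalSpace.countable_cover_nhdsWithin
    (f := s) (s := N) fun x hx => mem_nhdsWithin_of_mem_nhds (hs x hx)
  have hsub : T '' N ⊆ ⋃ x ∈ t, T '' (s x ∩ N) := by
    rintro _ ⟨y, hy, rfl⟩
    obtain ⟨x, hx, hyx⟩ := mem_iUnion₂.1 (hcov hy)
    exact mem_iUnion₂.2 ⟨x, hx, mem_image_of_mem T ⟨hyx, hy⟩⟩
  refine measure_mono_null hsub ((measure_biUnion_null_iff htc).2 fun x hx => ?_)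
  have hH := isAddHaarMeasure_hausdorffMeasure (E := En n)
  set d : ℝ := (Module.finrank ℝ (En n) : ℝ) with hd
  have h1 := ((hL x (htN hx)).mono inter_subset_left :
    LipschitzOnWith (K x) T (s x ∩ N)).hausdorffMeasure_image_le (d := d) (by positivity)
  have h2 : μH[d] (s x ∩ N) = 0 :=
    Measure.absolutelyContinuous_isAddHaarMeasure _ (volume : Measure (En n))
      (measure_mono_null inter_subset_right hN)
  rw [h2, mul_zero, nonpos_iff_eq_zero] at h1
  exact Measure.absolutelyContinuous_isAddHaarMeasure (volume : Measure (En n)) _ h1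

/-- Measure estimate for the set of translates `y` of a model potential with gradient `K` that
touch a function with Lipschitz gradient `G`. -/
theorem volume_le_lintegral_of_gradient_contact {n : ℕ} {G K : En n → En n}
    {K' : En n → En n →L[ℝ] En n} {L : NNReal} (hG : LipschitzWith L G) {U : Set (En n)}
    (hU : IsOpen U) (hinj : InjOn K U) (hK : ∀ q ∈ U, HasStrictFDerivAt K (K' q) q)
    (hK0 : ∀ q ∈ U, (K' q).det ≠ 0)
    {A V : Set (En n)} (hA : MeasurableSet A) {g : En n → ℝ} (hg : Measurable g)
    (hV : ∀ y ∈ V, ∃ x ∈ A, x - y ∈ U ∧ G x = K (x - y) ∧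
      (DifferentiableAt ℝ G x → |(K' (x - y) - fderiv ℝ G x).det| ≤ g x * |(K' (x - y)).det|)) :
    volume V ≤ ∫⁻ x in A, ENNReal.ofReal (g x) := by
  set S := Function.invFunOn K U with hS
  have hSK : ∀ q ∈ U, S (K q) = q := fun q hq => hinj.leftInvOn_invFunOn hq
  set e : ∀ q, q ∈ U → (En n ≃L[ℝ] En n) := fun q hq =>
    (K' q).toContinuousLinearEquivOfDetNeZero (hK0 q hq) with he
  have hee : ∀ q hq, ((e q hq : En n ≃L[ℝ] En n) : En n →L[ℝ] En n) = K' q := fun q hq =>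
    ContinuousLinearMap.coe_toContinuousLinearEquivOfDetNeZero _ _
  have hKe : ∀ q hq, HasStrictFDerivAt K ((e q hq : En n ≃L[ℝ] En n) : En n →L[ℝ] En n) q :=
    fun q hq => by rw [hee q hq]; exact hK q hq
  have hSd : ∀ q hq, HasStrictFDerivAt S ((e q hq).symm : En n →L[ℝ] En n) (K q) := fun q hq =>
    (hKe q hq).to_local_left_inverse (Filter.eventually_of_mem (hU.mem_nhds hq) hSK)
  have hKU : IsOpen (K '' U) := by
    rw [isOpen_iff_mem_nhds]
    rintro _ ⟨q, hq, rfl⟩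
    rw [← (hKe q hq).map_nhds_eq_of_equiv]
    exact Filter.image_mem_map (hU.mem_nhds hq)
  set O : Set (En n) := G ⁻¹' (K '' U) with hO
  have hOo : IsOpen O := hKU.preimage hG.continuous
  set T : En n → En n := fun x => x - S (G x) with hT
  have hTlip : ∀ x ∈ O, ∃ C, ∃ s ∈ nhds x, LipschitzOnWith C T s := by
    rintro x ⟨q, hq, hqx⟩
    obtain ⟨C, s, hs, hC⟩ := (hSd q hq).exists_lipschitzOnWith
    rw [hqx] at hs
    refine ⟨1 + C * L, G ⁻¹' s, hG.continuous.continuousAt hs, ?_⟩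
    have h1 : LipschitzOnWith (C * L) (S ∘ G) (G ⁻¹' s) :=
      hC.comp (hG.lipschitzOnWith) (mapsTo_preimage G s)
    exact (LipschitzWith.id.lipschitzOnWith).sub h1
  have hTd : ∀ q (hq : q ∈ U) x, G x = K q → DifferentiableAt ℝ G x →
      HasFDerivAt T (ContinuousLinearMap.id ℝ (En n)
        - ((e q hq).symm : En n →L[ℝ] En n).comp (fderiv ℝ G x)) x := by
    intro q hq x hx hd
    refine (hasFDerivAt_id x).sub ?_
    have := (hSd q hq).hasFDerivAt
    rw [← hx] at this
    exact this.comp x hd.hasFDerivAt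
  set s : Set (En n) := A ∩ O ∩ {x | DifferentiableAt ℝ G x} ∩
    {x | |(fderiv ℝ T x).det| ≤ g x} with hs
  have hsm : MeasurableSet s := by
    refine ((hA.inter hOo.measurableSet).inter (measurableSet_of_differentiableAt ℝ G)).inter ?_
    exact measurableSet_le
      ((ContinuousLinearMap.continuous_det.measurable.comp (measurable_fderiv ℝ T)).norm) hg
  set N : Set (En n) := O ∩ {x | ¬ DifferentiableAt ℝ G x} with hN
  have hN0 : volume (T '' N) = 0 := by
    refine volume_image_eq_zero_of_locally_lipschitz (fun x hx => hTlip x hx.1) ?_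
    exact measure_mono_null inter_subset_right hG.ae_differentiableAt
  have hVsub : V ⊆ T '' s ∪ T '' N := by
    intro y hy
    obtain ⟨x, hxA, hxU, hGx, hdet⟩ := hV y hy
    have hTx : T x = y := by simp [hT, hGx, hSK _ hxU]
    have hxO : x ∈ O := ⟨x - y, hxU, hGx.symm⟩
    by_cases hd : DifferentiableAt ℝ G x
    · refine Or.inl ⟨x, ⟨⟨⟨hxA, hxO⟩, hd⟩, ?_⟩, hTx⟩
      have h1 := (hTd _ hxU x hGx hd).fderiv
      have h2 : (K' (x - y)).comp (fderiv ℝ T x) = K' (x - y) - fderiv ℝ G x := by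
        rw [h1, ← hee _ hxU]
        ext v
        simp
      have h3 := hdet hd
      have h4 : 0 < |(K' (x - y)).det| := abs_pos.2 (hK0 _ hxU)
      have h5 : ((K' (x - y)).comp (fderiv ℝ T x)).det
          = (K' (x - y)).det * (fderiv ℝ T x).det := by
        exact LinearMap.det_comp _ _
      rw [← h2, h5, abs_mul, mul_comm] at h3
      exact le_of_mul_le_mul_right h3 h4
    · exact Or.inr ⟨x, ⟨hxO, hd⟩, hTx⟩
  calc volume V ≤ volume (T '' s ∪ T '' N) := measure_mono hVsub
    _ ≤ volume (T '' s) + volume (T '' N) := measure_union_le _ _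
    _ = volume (T '' s) := by rw [hN0, add_zero]
    _ ≤ ∫⁻ x in s, ENNReal.ofReal |(fderiv ℝ T x).det| := by
        refine addHaar_image_le_lintegral_abs_det_fderiv volume hsm fun x hx => ?_
        obtain ⟨q, hq, hqx⟩ := hx.1.1.2
        exact (hTd q hq x hqx.symm hx.1.2).differentiableAt.hasFDerivAt.hasFDerivWithinAt
    _ ≤ ∫⁻ x in s, ENNReal.ofReal (g x) :=
        setLIntegral_mono' hsm fun x hx => ENNReal.ofReal_le_ofReal hx.2
    _ ≤ _ := lintegral_mono_set fun x hx => hx.1.1.1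

/-- If a linear form is dominated by `r + C‖k‖²` with `r ≤ C d²` then its size is at most
`2 C d`. -/
theorem norm_le_of_inner_le_sq {E : Type*} [NormedAddCommGroup E] [InnerProductSpace ℝ E]
    {ξ : E} {C d : ℝ} (hd : 0 ≤ d) (h : ∀ k, inner ℝ ξ k ≤ C * d ^ 2 + C * ‖k‖ ^ 2) :
    ‖ξ‖ ≤ 2 * C * d := by
  rcases eq_or_ne ξ 0 with rfl | hξ
  · rcases hd.eq_or_lt with rfl | hd'
    · simp
    · have h1 := h 0
      simp only [inner_zero_right, norm_zero] at h1
      have : 0 ≤ C := by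
        by_contra hC
        nlinarith [pow_pos hd' 2]
      simp only [norm_zero]
      positivity
  have hp : 0 < ‖ξ‖ := norm_pos_iff.2 hξ
  rcases hd.eq_or_lt with rfl | hd'
  · exfalso
    have h2 : ∀ t : ℝ, 0 < t → 1 ≤ C * t := fun t ht => by
      have := h (t • ξ)
      rw [inner_smul_right, real_inner_self_eq_norm_sq, norm_smul, Real.norm_of_nonneg ht.le] at this
      have h3 : 0 < t * ‖ξ‖ ^ 2 := by positivity
      have h4 : 1 * (t * ‖ξ‖ ^ 2) ≤ (C * t) * (t * ‖ξ‖ ^ 2) := by nlinarith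
      exact le_of_mul_le_mul_right h4 h3
    have h3 := h2 (1 / (2 * (|C| + 1))) (by positivity)
    have h5 : C * (1 / (2 * (|C| + 1))) ≤ 1 / 2 := by
      rw [mul_one_div, div_le_div_iff₀ (by positivity) (by norm_num)]
      nlinarith [le_abs_self C, abs_nonneg C]
    linarith
  · have h1 := h ((d / ‖ξ‖) • ξ)
    rw [inner_smul_right, real_inner_self_eq_norm_sq, norm_smul,
      Real.norm_of_nonneg (by positivity)] at h1
    have h2 : d / ‖ξ‖ * ‖ξ‖ = d := by field_simp
    rw [h2] at h1
    have h3 : d / ‖ξ‖ * ‖ξ‖ ^ 2 = d * ‖ξ‖ := by field_simp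
    rw [h3] at h1
    have h4 : d * ‖ξ‖ ≤ d * (2 * C * d) := by nlinarith
    exact le_of_mul_le_mul_left h4 hd'

/-- Convex envelope of a function with second differences bounded above is `C^{1,1}`. -/
theorem exists_convex_envelope_c11 {n : ℕ} {W : En n → ℝ} {C : ℝ}
    (hW : ∀ x h, W (x + h) + W (x - h) - 2 * W x ≤ C * ‖h‖ ^ 2)
    (hne : ∃ (b : ℝ) (ξ : En n), ∀ x, b + inner ℝ ξ x ≤ W x) :
    ∃ (g : En n → ℝ) (G : En n → En n), (∀ x, g x ≤ W x) ∧
      (∀ x h, g x + inner ℝ (G x) h ≤ g (x + h)) ∧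
      (∀ x h, g (x + h) ≤ g x + inner ℝ (G x) h + C * ‖h‖ ^ 2) ∧
      (∀ x h, g (x + h) + g (x - h) - 2 * g x ≤ C * ‖h‖ ^ 2) ∧
      (∀ x x', ‖G x - G x'‖ ≤ 2 * C * ‖x - x'‖) ∧
      (∀ (b : ℝ) (ξ : En n), (∀ x, b + inner ℝ ξ x ≤ W x) → ∀ x, b + inner ℝ ξ x ≤ g x) := by
  set 𝒮 : Set (ℝ × En n) := {q | ∀ x, q.1 + inner ℝ q.2 x ≤ W x} with h𝒮
  have h𝒮ne : 𝒮.Nonempty := by obtain ⟨b, ξ, h⟩ := hne; exact ⟨(b, ξ), h⟩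
  set I : En n → Set ℝ := fun x => (fun q : ℝ × En n => q.1 + inner ℝ q.2 x) '' 𝒮 with hI
  have hIne : ∀ x, (I x).Nonempty := fun x => h𝒮ne.image _
  have hIb : ∀ x, BddAbove (I x) := fun x => ⟨W x, by rintro _ ⟨q, hq, rfl⟩; exact hq x⟩
  set g : En n → ℝ := fun x => sSup (I x) with hg
  have hgW : ∀ x, g x ≤ W x := fun x => csSup_le (hIne x) (by rintro _ ⟨q, hq, rfl⟩; exact hq x)
  have hgl : ∀ q ∈ 𝒮, ∀ x, q.1 + inner ℝ q.2 x ≤ g x := fun q hq x =>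
    le_csSup (hIb x) ⟨q, hq, rfl⟩
  have hap : ∀ x, ∀ η > 0, ∃ q ∈ 𝒮, g x - η < q.1 + inner ℝ q.2 x := fun x η hη => by
    obtain ⟨_, ⟨q, hq, rfl⟩, h⟩ := exists_lt_of_lt_csSup (hIne x) (sub_lt_self (g x) hη)
    exact ⟨q, hq, h⟩
  have hsc : ∀ x h, g (x + h) + g (x - h) - 2 * g x ≤ C * ‖h‖ ^ 2 := fun x h => by
    refine le_of_forall_pos_le_add fun η hη => ?_
    obtain ⟨q₁, hq₁, h₁⟩ := hap (x + h) (η / 2) (by positivity)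
    obtain ⟨q₂, hq₂, h₂⟩ := hap (x - h) (η / 2) (by positivity)
    have hq : ((q₁.1 + inner ℝ q₁.2 h + (q₂.1 - inner ℝ q₂.2 h)) / 2 - C * ‖h‖ ^ 2 / 2,
        (1 / 2 : ℝ) • (q₁.2 + q₂.2)) ∈ 𝒮 := fun z => by
      have e₁ := hq₁ (z + h)
      have e₂ := hq₂ (z - h)
      have e₃ := hW z h
      simp only [inner_add_right, inner_sub_right, inner_smul_left, inner_add_left] at *
      norm_num
      linarith
    have := hgl _ hq x
    simp only [inner_add_right, inner_sub_right, inner_smul_left, inner_add_left] at *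
    norm_num at this
    linarith
  have hslope : ∀ x, ∃ ξ : En n, ∀ h, g x + inner ℝ ξ h ≤ g (x + h) := fun x => by
    have h1 : ∀ k : ℕ, ∃ q ∈ 𝒮, g x - 1 / ((k : ℝ) + 1) < q.1 + inner ℝ q.2 x := fun k =>
      hap x _ (by positivity)
    choose q hq hqx using h1
    have h2 : ∀ (k : ℕ) h, g x - 1 / ((k : ℝ) + 1) + inner ℝ (q k).2 h ≤ g (x + h) := fun k h => by
      have e₁ := hgl _ (hq k) (x + h)
      have e₂ := hqx k
      rw [inner_add_right] at e₁
      linarith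
    have h3 : ∀ (k : ℕ) h, inner ℝ (q k - q 0).2 h ≤ 2 + C * ‖h‖ ^ 2 := fun k h => by
      have e₁ := h2 k h
      have e₂ := h2 0 (-h)
      have e₃ := hsc x h
      rw [inner_neg_right, ← sub_eq_add_neg x h] at e₂
      have e₄ : 1 / ((k : ℝ) + 1) ≤ 1 := by
        rw [div_le_one (by positivity)]; linarith [k.cast_nonneg (α := ℝ)]
      rw [Prod.snd_sub, inner_sub_left]
      norm_num at e₂
      linarith
    have h4 : ∀ k, ‖(q k - q 0).2‖ ≤ 2 * (|C| + 2) * 1 := fun k => by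
      refine norm_le_of_inner_le_sq zero_le_one fun h => ?_
      have := h3 k h
      nlinarith [abs_nonneg C, le_abs_self C, sq_nonneg ‖h‖]
    obtain ⟨ξ, -, φ, hφ, hlim⟩ := tendsto_subseq_of_bounded
      (Metric.isBounded_closedBall (x := (0 : En n)) (r := 2 * (|C| + 2) * 1))
      (x := fun k => (q k - q 0).2) (fun k => by simpa using h4 k)
    refine ⟨ξ + (q 0).2, fun h => ?_⟩
    have h5 : Filter.Tendsto (fun k => g x - 1 / ((φ k : ℝ) + 1)
        + inner ℝ ((q (φ k) - q 0).2 + (q 0).2) h) Filter.atTop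
        (nhds (g x - 0 + inner ℝ (ξ + (q 0).2) h)) := by
      refine Filter.Tendsto.add (tendsto_const_nhds.sub ?_) ?_
      · exact (tendsto_one_div_add_atTop_nhds_zero_nat (𝕜 := ℝ)).comp hφ.tendsto_atTop
      · exact Filter.Tendsto.inner (hlim.add_const _) tendsto_const_nhds
    rw [sub_zero] at h5
    refine le_of_tendsto h5 (Filter.Eventually.of_forall fun k => ?_)
    have := h2 (φ k) h
    simpa using this
  choose G hG using hslope
  have hup : ∀ x h, g (x + h) ≤ g x + inner ℝ (G x) h + C * ‖h‖ ^ 2 := fun x h => by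
    have e₁ := hG x (-h)
    have e₂ := hsc x h
    rw [inner_neg_right, ← sub_eq_add_neg x h] at e₁
    linarith
  refine ⟨g, G, hgW, hG, hup, hsc, fun x x' => ?_, fun b ξ hb => hgl (b, ξ) hb⟩
  refine norm_le_of_inner_le_sq (norm_nonneg _) fun k => ?_
  have e₁ := hup x' k
  have e₂ := hG x (x' + k - x)
  have e₃ := hup x (x' - x)
  rw [add_sub_cancel] at e₂ e₃
  rw [add_sub_right_comm, inner_add_right] at e₂
  rw [norm_sub_rev, inner_sub_left]
  linarith

/-- The largest minorant of a semiconcave function that is a supremum of paraboloids of opening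
`κ` is `C^{1,1}`. -/
theorem exists_c11_minorant {n : ℕ} {w : En n → ℝ} {C κ : ℝ}
    (hw : ∀ x h, w (x + h) + w (x - h) - 2 * w x ≤ C * ‖h‖ ^ 2)
    (hκ : 0 ≤ κ) (hC : 0 ≤ C) (hw0 : ∀ x, 0 ≤ w x) :
    ∃ (v : En n → ℝ) (G : En n → En n) (L : NNReal), (∀ x, v x ≤ w x) ∧
      LipschitzWith L G ∧
      (∀ x h, |v (x + h) - v x - inner ℝ (G x) h| ≤ (C + κ) * ‖h‖ ^ 2) ∧
      (∀ x h, v (x + h) + v (x - h) - 2 * v x ≤ C * ‖h‖ ^ 2) ∧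
      (∀ φ : En n → ℝ, (∀ x, ∃ ξ : En n, ∀ h, φ x + inner ℝ ξ h - κ / 2 * ‖h‖ ^ 2 ≤ φ (x + h)) →
        (∀ x, φ x ≤ w x) → ∀ x, φ x ≤ v x) := by
  have hpar : ∀ x h : En n, ‖x + h‖ ^ 2 = ‖x‖ ^ 2 + 2 * inner ℝ x h + ‖h‖ ^ 2 :=
    fun x h => norm_add_sq_real x h
  have hpar' : ∀ x h : En n, ‖x - h‖ ^ 2 = ‖x‖ ^ 2 - 2 * inner ℝ x h + ‖h‖ ^ 2 :=
    fun x h => norm_sub_sq_real x h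
  obtain ⟨g, G, h1, h2, h3, h4, h5, h6⟩ := exists_convex_envelope_c11
    (W := fun x => w x + κ / 2 * ‖x‖ ^ 2) (C := C + κ) (fun x h => by
      have := hw x h
      simp only [hpar, hpar']
      linarith) ⟨0, 0, fun x => by
        have := hw0 x
        simp only [inner_zero_left, add_zero]
        positivity⟩
  refine ⟨fun x => g x - κ / 2 * ‖x‖ ^ 2, fun x => G x - κ • x, (2 * (C + κ) + κ).toNNReal,
    fun x => by linarith [h1 x], ?_, fun x h => ?_, fun x h => ?_, fun φ hφ hφw x => ?_⟩
  · refine LipschitzWith.of_dist_le_mul fun x y => ?_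
    rw [Real.coe_toNNReal _ (by positivity), dist_eq_norm, dist_eq_norm]
    have : G x - κ • x - (G y - κ • y) = (G x - G y) - κ • (x - y) := by
      rw [smul_sub]; abel
    rw [this]
    refine (norm_sub_le _ _).trans ?_
    rw [norm_smul, Real.norm_of_nonneg hκ]
    linarith [h5 x y]
  · have e₁ := h2 x h
    have e₂ := h3 x h
    have e₃ : 0 ≤ C * ‖h‖ ^ 2 := by positivity
    have e₄ : 0 ≤ κ * ‖h‖ ^ 2 := by positivity
    simp only [hpar, inner_sub_left, inner_smul_left]
    norm_num
    rw [abs_le]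
    constructor <;> linarith
  · have := h4 x h
    simp only [hpar, hpar']
    linarith
  · obtain ⟨ξ, hξ⟩ := hφ x
    have := h6 (φ x - inner ℝ ξ x - κ / 2 * ‖x‖ ^ 2) (ξ + κ • x) (fun y => by
      have e₁ := hξ (y - x)
      have e₂ := hφw y
      rw [add_sub_cancel, inner_sub_right, hpar'] at e₁
      simp only [inner_add_left, inner_smul_left]
      norm_num
      have e₃ := real_inner_comm x y
      nlinarith) x
    simp only [inner_add_left, inner_smul_left, real_inner_self_eq_norm_sq] at this
    norm_num at this
    linarith

theorem hasFDerivAt_of_abs_sub_inner_le {n : ℕ} {v : En n → ℝ} {x ξ : En n} {C : ℝ}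
    (h : ∀ h, |v (x + h) - v x - inner ℝ ξ h| ≤ C * ‖h‖ ^ 2) :
    HasFDerivAt v (innerSL ℝ ξ) x := by
  rw [hasFDerivAt_iff_isLittleO_nhds_zero]
  refine Asymptotics.IsBigO.trans_isLittleO (g := fun h : En n => ‖h‖ ^ 2) ?_ ?_
  · refine Asymptotics.IsBigO.of_bound C (Filter.Eventually.of_forall fun y => ?_)
    rw [Real.norm_eq_abs, Real.norm_of_nonneg (by positivity : (0 : ℝ) ≤ ‖y‖ ^ 2)]
    exact h y
  · exact (Asymptotics.isLittleO_norm_pow_id one_lt_two)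

theorem symmetric_fderiv_of_gradient {n : ℕ} {v : En n → ℝ} {G : En n → En n} {x : En n}
    (hv : ∀ x, HasFDerivAt v (innerSL ℝ (G x)) x) (hG : DifferentiableAt ℝ G x) (h k : En n) :
    inner ℝ (fderiv ℝ G x h) k = inner ℝ (fderiv ℝ G x k) h := by
  have h1 : HasFDerivAt (fun y => innerSL ℝ (G y))
      ((innerSL ℝ).comp (fderiv ℝ G x)) x :=
    (innerSL ℝ (E := En n)).hasFDerivAt.comp x hG.hasFDerivAt
  exact second_derivative_symmetric_of_eventually (Filter.Eventually.of_forall hv) h1 h k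

theorem taylor_two_of_gradient {n : ℕ} {v : En n → ℝ} {G : En n → En n} {x : En n}
    (hv : ∀ x, HasFDerivAt v (innerSL ℝ (G x)) x) (hG : DifferentiableAt ℝ G x)
    {η : ℝ} (hη : 0 < η) :
    ∀ᶠ h in nhds (0 : En n), |v (x + h) - v x - inner ℝ (G x) h
      - 1 / 2 * inner ℝ (fderiv ℝ G x h) h| ≤ η * ‖h‖ ^ 2 := by
  set X := fderiv ℝ G x with hX
  have hsym := symmetric_fderiv_of_gradient hv hG
  have h1 := (hasFDerivAt_iff_isLittleO_nhds_zero.1 hG.hasFDerivAt).def hη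
  obtain ⟨r, hr, hball⟩ := Metric.eventually_nhds_iff_ball.1 h1
  refine Metric.eventually_nhds_iff_ball.2 ⟨r, hr, fun h hh => ?_⟩
  set φ : En n → ℝ := fun h => v (x + h) - v x - inner ℝ (G x) h - 1 / 2 * inner ℝ (X h) h with hφ
  have hd : ∀ k, HasFDerivAt φ (innerSL ℝ (G (x + k) - G x - X k)) k := fun k => by
    have e₁ : HasFDerivAt (fun h => v (x + h)) (innerSL ℝ (G (x + k))) k := by
      have := (hv (x + k)).comp k ((hasFDerivAt_id k).const_add x)
      rwa [ContinuousLinearMap.comp_id] at this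
    have e₂ : HasFDerivAt (fun h => inner ℝ (G x) h) (innerSL ℝ (G x)) k :=
      (innerSL ℝ (G x)).hasFDerivAt
    have e₃ := (X.hasFDerivAt (x := k)).inner ℝ (hasFDerivAt_id k)
    have := ((e₁.sub_const (v x)).sub e₂).sub (e₃.const_mul (1 / 2))
    refine this.congr_fderiv ?_
    ext w
    have e₄ : inner ℝ (X w) k = inner ℝ (X k) w := hsym w k
    simp only [fderivInnerCLM_apply, map_sub, sub_apply, id_eq,
      smul_apply, ContinuousLinearMap.comp_apply, innerSL_apply_apply,
      ContinuousLinearMap.prod_apply, ContinuousLinearMap.id_apply, smul_eq_mul]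
    linarith
  have h2 := (convex_closedBall (0 : En n) ‖h‖).norm_image_sub_le_of_norm_hasFDerivWithin_le
    (f := φ) (C := η * ‖h‖) (fun k _ => (hd k).hasFDerivWithinAt) (fun k hk => ?_)
    (mem_closedBall_self (norm_nonneg h)) (by simp : h ∈ closedBall (0 : En n) ‖h‖)
  · have e₀ : φ 0 = 0 := by simp [hφ]
    rw [e₀, sub_zero, sub_zero, Real.norm_eq_abs] at h2
    calc _ = |φ h| := rfl
      _ ≤ _ := h2
      _ = _ := by ring
  · have hk' : ‖k‖ ≤ ‖h‖ := by simpa using hk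
    have := hball k (by
      rw [mem_ball_zero_iff] at hh ⊢
      exact hk'.trans_lt hh)
    rw [innerSL_apply_norm]
    exact this.trans (by gcongr)

/-- Inf-convolution of a nonnegative continuous function on a closed ball. -/
theorem exists_inf_convolution {n : ℕ} {u : En n → ℝ} {R ε : ℝ} (hR : 0 ≤ R) (hε : 0 < ε)
    (hu : ContinuousOn u (closedBall 0 R)) (hu0 : ∀ x ∈ closedBall 0 R, 0 ≤ u x) :
    ∃ w : En n → ℝ, (∀ x, 0 ≤ w x) ∧
      (∀ x, ∀ z ∈ closedBall (0 : En n) R, w x ≤ u z + ‖x - z‖ ^ 2 / (2 * ε)) ∧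
      (∀ x, ∃ z ∈ closedBall (0 : En n) R, w x = u z + ‖x - z‖ ^ 2 / (2 * ε)) ∧
      (∀ x h, w (x + h) + w (x - h) - 2 * w x ≤ 1 / ε * ‖h‖ ^ 2) := by
  have h1 : ∀ x : En n, ∃ z ∈ closedBall (0 : En n) R, ∀ z' ∈ closedBall (0 : En n) R,
      u z + ‖x - z‖ ^ 2 / (2 * ε) ≤ u z' + ‖x - z'‖ ^ 2 / (2 * ε) := fun x => by
    obtain ⟨z, hz, hz'⟩ := (isCompact_closedBall (0 : En n) R).exists_isMinOn
      ⟨0, by simpa using hR⟩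
      (f := fun z => u z + ‖x - z‖ ^ 2 / (2 * ε)) (hu.add (by fun_prop))
    exact ⟨z, hz, fun z' h => hz' h⟩
  choose z hz hz' using h1
  refine ⟨fun x => u (z x) + ‖x - z x‖ ^ 2 / (2 * ε), fun x => ?_, fun x => hz' x,
    fun x => ⟨z x, hz x, rfl⟩, fun x h => ?_⟩
  · have := hu0 _ (hz x)
    positivity
  · have e₁ := hz' (x + h) (z x) (hz x)
    have e₂ := hz' (x - h) (z x) (hz x)
    rw [add_sub_right_comm x h (z x), norm_add_sq_real] at e₁
    rw [sub_right_comm x h (z x), norm_sub_sq_real (x - z x) h] at e₂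
    have : 1 / ε * ‖h‖ ^ 2 = (2 * ‖h‖ ^ 2) / (2 * ε) := by field_simp
    rw [this]
    have e₃ : (‖x - z x‖ ^ 2 + 2 * inner ℝ (x - z x) h + ‖h‖ ^ 2) / (2 * ε)
        + (‖x - z x‖ ^ 2 - 2 * inner ℝ (x - z x) h + ‖h‖ ^ 2) / (2 * ε)
        = 2 * (‖x - z x‖ ^ 2 / (2 * ε)) + (2 * ‖h‖ ^ 2) / (2 * ε) := by ring
    beta_reduce
    linarith

/-- Regularization of a nonnegative continuous function whose gradient sees all contact points
with the translates of a semiconvex potential. -/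
theorem exists_contact_regularization {n : ℕ} {u Φ : En n → ℝ} {Z : En n → En n}
    {R ε κ M₀ : ℝ} {V : Set (En n)} (hR : 1 ≤ R) (hε : 0 < ε) (hεM : 2 * ε * M₀ < 1)
    (hκ : 0 ≤ κ) (hu : ContinuousOn u (closedBall 0 R)) (hu0 : ∀ x ∈ closedBall 0 R, 0 ≤ u x)
    (hΦ : Continuous Φ)
    (hΦs : ∀ q h, Φ q + inner ℝ (Z q) h - κ / 2 * ‖h‖ ^ 2 ≤ Φ (q + h))
    (hΦM : ∀ q, Φ q ≤ M₀) (hΦ0 : ∀ y ∈ V, ∀ x : En n, R - 1 ≤ ‖x‖ → Φ (x - y) ≤ 0)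
    {x₀ : En n} (hx₀ : x₀ ∈ closedBall 0 R) (hux₀ : u x₀ ≤ 1) (hΦx₀ : ∀ y ∈ V, 2 ≤ Φ (x₀ - y)) :
    ∃ (G : En n → En n) (L : NNReal), LipschitzWith L G ∧ ∀ y ∈ V, ∃ x z : En n,
      ‖x‖ < R - 1 ∧ ‖z‖ < R ∧ ‖x - z‖ ^ 2 ≤ 2 * ε * M₀ ∧ u z ≤ M₀ ∧ G x = Z (x - y) ∧
      (DifferentiableAt ℝ G x →
        (∀ h k, inner ℝ (fderiv ℝ G x h) k = inner ℝ (fderiv ℝ G x k) h) ∧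
        (∀ h, inner ℝ (fderiv ℝ G x h) h ≤ 1 / ε * ‖h‖ ^ 2) ∧
        ∀ η > 0,
          (∀ᶠ h in nhds (0 : En n), Φ (x - y + h) ≤ Φ (x - y) + inner ℝ (Z (x - y)) h
            + 1 / 2 * inner ℝ (fderiv ℝ G x h) h + η * ‖h‖ ^ 2) ∧
          (∀ᶠ h in nhds (0 : En n), u z + inner ℝ (Z (x - y)) h
            + 1 / 2 * inner ℝ (fderiv ℝ G x h) h - η * ‖h‖ ^ 2 ≤ u (z + h))) := by
  obtain ⟨w, hw0, hwle, hwex, hwsc⟩ := exists_inf_convolution (by linarith) hε hu hu0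
  obtain ⟨v, G, L, hvw, hGL, hvG, hvsc, hvmax⟩ :=
    exists_c11_minorant hwsc hκ (by positivity) hw0
  have hvd : ∀ x, HasFDerivAt v (innerSL ℝ (G x)) x := fun x =>
    hasFDerivAt_of_abs_sub_inner_le (hvG x)
  refine ⟨G, L, hGL, fun y hy => ?_⟩
  obtain ⟨⟨x, z⟩, ⟨hxm, hzm⟩, hmin⟩ := ((isCompact_closedBall (0 : En n) R).prod
    (isCompact_closedBall (0 : En n) R)).exists_isMinOn ⟨(0, 0), by simp; linarith⟩
    (f := fun q : En n × En n => u q.2 + ‖q.1 - q.2‖ ^ 2 / (2 * ε) - Φ (q.1 - y)) (by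
      refine ((hu.comp continuousOn_snd fun q hq => hq.2).add
        (Continuous.continuousOn (by fun_prop))).sub (Continuous.continuousOn (by fun_prop)))
  simp only at hxm hzm
  set c := u z + ‖x - z‖ ^ 2 / (2 * ε) - Φ (x - y) with hc
  have hcmin : ∀ x' ∈ closedBall (0 : En n) R, ∀ z' ∈ closedBall (0 : En n) R,
      c ≤ u z' + ‖x' - z'‖ ^ 2 / (2 * ε) - Φ (x' - y) := fun x' hx' z' hz' =>
    hmin (show (x', z') ∈ _ from ⟨hx', hz'⟩)
  have hcneg : c ≤ -1 := by
    have := hcmin x₀ hx₀ x₀ hx₀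
    have h2 := hΦx₀ y hy
    simp at this
    linarith
  have hq0 : 0 ≤ ‖x - z‖ ^ 2 / (2 * ε) := by positivity
  have huz0 := hu0 z hzm
  have hxR : ‖x‖ < R - 1 := by
    by_contra! h
    have := hΦ0 y hy x h
    linarith
  have hΦle := hΦM (x - y)
  have hxz : ‖x - z‖ ^ 2 ≤ 2 * ε * M₀ := by
    have : ‖x - z‖ ^ 2 / (2 * ε) ≤ M₀ := by linarith
    rw [div_le_iff₀ (by positivity)] at this
    linarith
  have hzR : ‖z‖ < R := by
    have h1 : ‖x - z‖ < 1 := by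
      by_contra! h
      nlinarith
    have h2 : z = x - (x - z) := by abel
    calc ‖z‖ = ‖x - (x - z)‖ := by rw [← h2]
      _ ≤ ‖x‖ + ‖x - z‖ := norm_sub_le _ _
      _ < R := by linarith
  have hwΦ : ∀ x', Φ (x' - y) + c ≤ w x' := fun x' => by
    by_cases hx' : x' ∈ closedBall (0 : En n) R
    · obtain ⟨z', hz', h⟩ := hwex x'
      have := hcmin x' hx' z' hz'
      linarith
    · have h1 : R - 1 ≤ ‖x'‖ := by
        rw [mem_closedBall_zero_iff, not_le] at hx'
        linarith
      have := hΦ0 y hy x' h1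
      have := hw0 x'
      linarith
  have hvΦ : ∀ x', Φ (x' - y) + c ≤ v x' := hvmax (fun x' => Φ (x' - y) + c)
    (fun x' => ⟨Z (x' - y), fun h => by
      have := hΦs (x' - y) h
      rw [add_sub_right_comm x' h y]
      linarith⟩) hwΦ
  have hvx : v x = Φ (x - y) + c := by
    refine le_antisymm ?_ (hvΦ x)
    have := hvw x
    have := hwle x z hzm
    linarith
  have hGx : G x = Z (x - y) := by
    have h1 : ‖Z (x - y) - G x‖ ≤ 2 * ((1 / ε + κ) + κ / 2) * 0 := by
      refine norm_le_of_inner_le_sq le_rfl fun k => ?_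
      have e₁ := hΦs (x - y) k
      have e₂ := hvΦ (x + k)
      have e₃ := (abs_le.1 (hvG x k)).2
      rw [add_sub_right_comm] at e₂
      rw [inner_sub_left]
      linarith
    rw [mul_zero, norm_le_zero_iff, sub_eq_zero] at h1
    exact h1.symm
  refine ⟨x, z, hxR, hzR, hxz, by linarith, hGx, fun hd => ?_⟩
  have htay := fun (η : ℝ) (hη : 0 < η) => taylor_two_of_gradient hvd hd hη
  refine ⟨symmetric_fderiv_of_gradient hvd hd, fun h => ?_, fun η hη => ⟨?_, ?_⟩⟩
  · have key : ∀ η > 0, inner ℝ (fderiv ℝ G x h) h ≤ 1 / ε * ‖h‖ ^ 2 + η * (2 * ‖h‖ ^ 2) := by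
      intro η hη
      obtain ⟨r, hr, hball⟩ := Metric.eventually_nhds_iff_ball.1 (htay η hη)
      obtain ⟨t, ht, hth⟩ : ∃ t : ℝ, 0 < t ∧ ‖t • h‖ < r := by
        refine ⟨r / (2 * (‖h‖ + 1)), by positivity, ?_⟩
        rw [norm_smul, Real.norm_of_nonneg (by positivity), div_mul_eq_mul_div,
          div_lt_iff₀ (by positivity)]
        nlinarith [norm_nonneg h]
      have e₁ := (abs_le.1 (hball (t • h) (by simpa using hth))).1
      have e₂ := (abs_le.1 (hball (-(t • h)) (by simpa using hth))).1
      have e₃ := hvsc x (t • h)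
      rw [← sub_eq_add_neg x] at e₂
      simp only [map_neg, map_smul, inner_neg_left, inner_neg_right, inner_smul_left,
        inner_smul_right, norm_neg, norm_smul, Real.norm_of_nonneg ht.le] at e₁ e₂ e₃
      simp at e₁ e₂ e₃
      have e₄ : t ^ 2 * inner ℝ (fderiv ℝ G x h) h
          ≤ t ^ 2 * (1 / ε * ‖h‖ ^ 2 + η * (2 * ‖h‖ ^ 2)) := by
        rw [one_div]
        nlinarith
      exact le_of_mul_le_mul_left e₄ (by positivity)
    refine le_of_forall_pos_le_add fun δ hδ => ?_
    refine (key (δ / (2 * ‖h‖ ^ 2 + 1)) (by positivity)).trans ?_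
    gcongr
    rw [div_mul_eq_mul_div, div_le_iff₀ (by positivity)]
    nlinarith [sq_nonneg ‖h‖]
  · filter_upwards [htay η hη] with h hh
    have e₁ := hvΦ (x + h)
    have e₂ := (abs_le.1 hh).2
    rw [add_sub_right_comm] at e₁
    rw [hGx] at e₂
    linarith
  · have hnear : ∀ᶠ h in nhds (0 : En n), z + h ∈ closedBall (0 : En n) R := by
      have h1 : Filter.Tendsto (fun h => z + h) (nhds 0) (nhds z) := by
        have : Continuous fun h => z + h := by fun_prop
        simpa using this.tendsto 0
      exact h1 (Filter.mem_of_superset (isOpen_ball.mem_nhds (by simpa using hzR))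
        ball_subset_closedBall)
    filter_upwards [htay η hη, hnear] with h hh hn
    have e₁ := hwle (x + h) (z + h) hn
    have e₂ := hvw (x + h)
    have e₃ := (abs_le.1 hh).1
    rw [add_sub_add_right_eq_sub] at e₁
    rw [hGx] at e₃
    linarith

theorem hasDerivAt_abs_rpow_mul_self {p : ℝ} (hp : 0 ≤ p) (s : ℝ) :
    HasDerivAt (fun s : ℝ => |s| ^ p * s) ((p + 1) * |s| ^ p) s := by
  have hc : Continuous fun s : ℝ => |s| ^ p := continuous_abs.rpow_const fun _ => Or.inr hp
  refine hasDerivAt_of_hasDerivAt_of_ne' (x := 0) (g := fun s => (p + 1) * |s| ^ p) (fun y hy => ?_)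
    (hc.mul continuous_id).continuousAt (hc.const_mul _).continuousAt s
  have h1 := ((hasDerivAt_abs hy).rpow_const (p := p) (Or.inl (abs_ne_zero.2 hy))).mul
    (hasDerivAt_id y)
  refine h1.congr_deriv ?_
  have h2 : |y| ^ (p - 1) * |y| = |y| ^ p := by
    rw [Real.rpow_sub_one (abs_ne_zero.2 hy), div_mul_cancel₀ _ (abs_ne_zero.2 hy)]
  have h3 : (SignType.sign y : ℝ) * y = |y| := sign_mul_self y
  simp only [id, mul_one]
  linear_combination p * |y| ^ (p - 1) * h3 + p * h2

/-- The regularized power `|s|^p s/(p+1) + δ s`. -/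
def regPow (p δ s : ℝ) : ℝ := |s| ^ p * s / (p + 1) + δ * s

section regPow
variable {p δ : ℝ}

theorem hasDerivAt_regPow (hp : 0 ≤ p) (s : ℝ) :
    HasDerivAt (regPow p δ) (|s| ^ p + δ) s := by
  have := ((hasDerivAt_abs_rpow_mul_self hp s).div_const (p + 1)).add
    ((hasDerivAt_id s).const_mul δ)
  refine this.congr_deriv ?_
  field_simp

theorem hasStrictDerivAt_regPow (hp : 0 ≤ p) (s : ℝ) :
    HasStrictDerivAt (regPow p δ) (|s| ^ p + δ) s :=
  hasStrictDerivAt_of_hasDerivAt_of_continuousAt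
    (f' := fun s => |s| ^ p + δ) (Filter.Eventually.of_forall (hasDerivAt_regPow hp))
    ((continuous_abs.rpow_const fun _ => Or.inr hp).add continuous_const).continuousAt

theorem le_regPow_sub (hp : 0 ≤ p) {s t : ℝ} (h : s ≤ t) :
    δ * (t - s) ≤ regPow p δ t - regPow p δ s := by
  have hd : ∀ s, HasDerivAt (fun s => |s| ^ p * s) ((p + 1) * |s| ^ p) s :=
    hasDerivAt_abs_rpow_mul_self hp
  have hm : Monotone fun s : ℝ => |s| ^ p * s := monotone_of_deriv_nonneg
    (fun s => (hd s).differentiableAt) fun s => by rw [(hd s).deriv]; positivity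
  have h1 : |s| ^ p * s / (p + 1) ≤ |t| ^ p * t / (p + 1) :=
    div_le_div_of_nonneg_right (hm h) (by positivity)
  simp only [regPow]
  linarith

theorem strictMono_regPow (hp : 0 ≤ p) (hδ : 0 < δ) : StrictMono (regPow p δ) := fun s t h => by
  have := le_regPow_sub (δ := δ) hp h.le
  nlinarith

theorem surjective_regPow (hp : 0 ≤ p) (hδ : 0 < δ) : Function.Surjective (regPow p δ) := by
  have hc : Continuous (regPow p δ) :=
    continuous_iff_continuousAt.2 fun s => (hasDerivAt_regPow hp s).continuousAt
  have h0 : regPow p δ 0 = 0 := by simp [regPow]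
  refine hc.surjective ?_ ?_
  · refine Filter.tendsto_atTop_mono' _ ?_ (Filter.tendsto_id.const_mul_atTop hδ)
    filter_upwards [Filter.eventually_ge_atTop 0] with s hs
    have := le_regPow_sub (δ := δ) hp hs
    simp only [id]
    linarith
  · refine Filter.tendsto_atBot_mono' _ ?_ (Filter.tendsto_id.const_mul_atBot hδ)
    filter_upwards [Filter.eventually_le_atBot 0] with s hs
    have := le_regPow_sub (δ := δ) hp hs
    simp only [id]
    linarith

/-- The inverse of `regPow`. -/
def regRoot (p δ : ℝ) : ℝ → ℝ := Function.invFun (regPow p δ)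

theorem regPow_regRoot (hp : 0 ≤ p) (hδ : 0 < δ) (t : ℝ) : regPow p δ (regRoot p δ t) = t :=
  Function.rightInverse_invFun (surjective_regPow hp hδ) t

theorem regRoot_regPow (hp : 0 ≤ p) (hδ : 0 < δ) (s : ℝ) : regRoot p δ (regPow p δ s) = s :=
  Function.leftInverse_invFun (strictMono_regPow hp hδ).injective s

theorem regRoot_injective (hp : 0 ≤ p) (hδ : 0 < δ) : Function.Injective (regRoot p δ) :=
  Function.LeftInverse.injective (regPow_regRoot hp hδ)

theorem rpow_abs_add_pos (hδ : 0 < δ) (s : ℝ) : 0 < |s| ^ p + δ := by positivity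

theorem hasStrictDerivAt_regRoot (hp : 0 ≤ p) (hδ : 0 < δ) (t : ℝ) :
    HasStrictDerivAt (regRoot p δ) (1 / (|regRoot p δ t| ^ p + δ)) t := by
  have := (hasStrictDerivAt_regPow (δ := δ) hp (regRoot p δ t)).to_local_left_inverse
    (rpow_abs_add_pos hδ _).ne' (Filter.Eventually.of_forall (regRoot_regPow hp hδ))
  rwa [regPow_regRoot hp hδ, ← one_div] at this

theorem regRoot_sub_le (hp : 0 ≤ p) (hδ : 0 < δ) {s t : ℝ} (h : s ≤ t) :
    regRoot p δ s ≤ regRoot p δ t ∧ regRoot p δ t - regRoot p δ s ≤ (t - s) / δ := by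
  have h1 : regRoot p δ s ≤ regRoot p δ t := by
    rw [← (strictMono_regPow hp hδ).le_iff_le, regPow_regRoot hp hδ, regPow_regRoot hp hδ]
    exact h
  refine ⟨h1, ?_⟩
  have := le_regPow_sub (δ := δ) hp h1
  rw [regPow_regRoot hp hδ, regPow_regRoot hp hδ] at this
  rw [le_div_iff₀ hδ]
  linarith

/-- The convex energy `|s|^{p+2}/(p+2) + δ s²/2`. -/
def regEnergy (p δ s : ℝ) : ℝ := |s| ^ (p + 2) / (p + 2) + δ * s ^ 2 / 2

theorem regEnergy_nonneg (hp : 0 ≤ p) (hδ : 0 < δ) (s : ℝ) : 0 ≤ regEnergy p δ s := by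
  unfold regEnergy
  positivity

theorem rpow_add_two_abs (hp : 0 ≤ p) (s : ℝ) : |s| ^ (p + 2) = |s| ^ p * s ^ 2 := by
  rw [Real.rpow_add_of_nonneg (abs_nonneg s) hp zero_le_two, Real.rpow_two, sq_abs]

theorem hasDerivAt_regEnergy_regRoot (hp : 0 ≤ p) (hδ : 0 < δ) (t : ℝ) :
    HasDerivAt (fun t => regEnergy p δ (regRoot p δ t)) (regRoot p δ t) t := by
  have h1 : HasDerivAt (regEnergy p δ)
      (((p + 2) * |regRoot p δ t| ^ (p + 2 - 2) * regRoot p δ t) / (p + 2)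
        + δ * (2 * regRoot p δ t ^ (2 - 1)) / 2) (regRoot p δ t) := by
    have e₂ := (((hasDerivAt_pow 2 (regRoot p δ t)).const_mul δ).div_const 2)
    exact ((hasDerivAt_abs_rpow (regRoot p δ t) (by linarith : 1 < p + 2)).div_const (p + 2)).add
      (by simpa using e₂)
  refine (h1.comp t (hasStrictDerivAt_regRoot hp hδ t).hasDerivAt).congr_deriv ?_
  have := (rpow_abs_add_pos (p := p) hδ (regRoot p δ t)).ne'
  rw [add_sub_cancel_right]
  have : p + 2 ≠ 0 := by positivity
  field_simp
  ring

theorem mul_regRoot (hp : 0 ≤ p) (hδ : 0 < δ) (t : ℝ) :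
    regRoot p δ t * t = |regRoot p δ t| ^ (p + 2) / (p + 1) + δ * regRoot p δ t ^ 2 := by
  conv_lhs => rw [← regPow_regRoot hp hδ t, regRoot_regPow hp hδ, regPow]
  rw [rpow_add_two_abs hp]
  ring

theorem abs_eq_regRoot (hp : 0 ≤ p) (hδ : 0 < δ) (t : ℝ) :
    |t| = |regRoot p δ t| ^ p * |regRoot p δ t| / (p + 1) + δ * |regRoot p δ t| := by
  conv_lhs => rw [← regPow_regRoot hp hδ t, regPow]
  have : |regRoot p δ t| ^ p * regRoot p δ t / (p + 1) + δ * regRoot p δ t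
    = (|regRoot p δ t| ^ p / (p + 1) + δ) * regRoot p δ t := by ring
  rw [this, abs_mul, abs_of_nonneg (by positivity)]
  ring

theorem abs_regRoot_le (hp : 0 ≤ p) (hδ : 0 < δ) (t : ℝ) :
    |regRoot p δ t| ≤ 1 + (p + 1) * |t| := by
  by_cases h : |regRoot p δ t| ≤ 1
  · have : 0 ≤ (p + 1) * |t| := by positivity
    linarith
  · push Not at h
    have h1 := abs_eq_regRoot hp hδ t
    have h2 : 1 ≤ |regRoot p δ t| ^ p := Real.one_le_rpow h.le hp
    have h3 : |regRoot p δ t| ≤ (p + 1) * |t| := by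
      rw [h1]
      have : (p + 1) * (|regRoot p δ t| ^ p * |regRoot p δ t| / (p + 1) + δ * |regRoot p δ t|)
        = |regRoot p δ t| ^ p * |regRoot p δ t| + (p + 1) * (δ * |regRoot p δ t|) := by
        field_simp
      rw [this]
      have : 0 ≤ (p + 1) * (δ * |regRoot p δ t|) := by positivity
      nlinarith
    linarith

theorem regEnergy_regRoot_le (hp : 0 ≤ p) (hδ : 0 < δ) (t : ℝ) :
    regEnergy p δ (regRoot p δ t) ≤ |t| * (1 + (p + 1) * |t|) := by
  have h1 : regEnergy p δ (regRoot p δ t) ≤ regRoot p δ t * t := by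
    rw [mul_regRoot hp hδ, regEnergy]
    have : |regRoot p δ t| ^ (p + 2) / (p + 2) ≤ |regRoot p δ t| ^ (p + 2) / (p + 1) := by
      gcongr; norm_num
    have : 0 ≤ δ * regRoot p δ t ^ 2 := by positivity
    linarith
  refine h1.trans ((le_abs_self _).trans ?_)
  rw [abs_mul, mul_comm]
  gcongr
  exact abs_regRoot_le hp hδ t

theorem le_regEnergy_regRoot (hp : 0 ≤ p) (hδ : 0 < δ) (hδ1 : δ ≤ 1) (t : ℝ) :
    |t| * min 1 (|t| / 2) ≤ (p + 2) * regEnergy p δ (regRoot p δ t) := by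
  set s := regRoot p δ t with hs
  have h1 : s * t ≤ (p + 2) * regEnergy p δ s := by
    rw [mul_regRoot hp hδ, ← hs, regEnergy]
    have e₁ : |s| ^ (p + 2) / (p + 1) ≤ |s| ^ (p + 2) := by
      refine div_le_self (by positivity) (by linarith)
    have e₂ : (p + 2) * (|s| ^ (p + 2) / (p + 2)) = |s| ^ (p + 2) := by field_simp
    have : 0 ≤ p * (δ * s ^ 2) := by positivity
    nlinarith
  have h2 : s * t = |s| * |t| := by
    rw [← abs_mul, abs_of_nonneg]
    rw [mul_regRoot hp hδ]
    positivity
  have h3 : min 1 (|t| / 2) ≤ |s| := by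
    by_cases h : |s| ≤ 1
    · refine (min_le_right _ _).trans ?_
      have h4 : |s| ^ p ≤ 1 := Real.rpow_le_one (abs_nonneg s) h hp
      have h5 : |s| ^ p * |s| / (p + 1) ≤ |s| := by
        rw [div_le_iff₀ (by positivity)]
        nlinarith [abs_nonneg s]
      have := abs_eq_regRoot hp hδ t
      rw [← hs] at this
      nlinarith [abs_nonneg s]
    · exact (min_le_left _ _).trans (not_le.1 h).le
  rw [h2] at h1
  calc |t| * min 1 (|t| / 2) ≤ |t| * |s| := by gcongr
    _ = |s| * |t| := mul_comm _ _
    _ ≤ _ := h1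

theorem two_mul_regEnergy_le (hp : 0 ≤ p) (s : ℝ) :
    2 * regEnergy p δ s ≤ (|s| ^ p + δ) * s ^ 2 := by
  rw [regEnergy, rpow_add_two_abs hp]
  have : |s| ^ p * s ^ 2 / (p + 2) ≤ |s| ^ p * s ^ 2 / 2 := by gcongr; linarith
  linarith

theorem regEnergy_le_rpow (hp : 0 ≤ p) (s : ℝ) :
    2 * regEnergy p δ s ≤ |s| ^ (p + 2) + δ * s ^ 2 := by
  rw [regEnergy]
  have : |s| ^ (p + 2) / (p + 2) ≤ |s| ^ (p + 2) / 2 := by gcongr; linarith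
  linarith

theorem sq_mul_regEnergy_le (hp : 0 ≤ p) {r : ℝ} (hr : 1 ≤ r) (s : ℝ) :
    r ^ 2 * regEnergy p δ s ≤ regEnergy p δ (r * s) := by
  rw [regEnergy, regEnergy, rpow_add_two_abs hp, rpow_add_two_abs hp, abs_mul, mul_pow,
    Real.mul_rpow (abs_nonneg r) (abs_nonneg s)]
  have h1 : 1 ≤ |r| ^ p := Real.one_le_rpow (by rwa [abs_of_nonneg (by linarith)]) hp
  have h2 : r ^ 2 * (|s| ^ p * s ^ 2 / (p + 2)) * 1
      ≤ r ^ 2 * (|s| ^ p * s ^ 2 / (p + 2)) * |r| ^ p := by gcongr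
  have h3 : |r| ^ p * |s| ^ p * (r ^ 2 * s ^ 2) / (p + 2)
    = r ^ 2 * (|s| ^ p * s ^ 2 / (p + 2)) * |r| ^ p := by ring
  rw [h3]
  linarith

theorem regEnergy_regRoot_upper (hp : 0 ≤ p) (hδ : 0 < δ) (t t' : ℝ) :
    regEnergy p δ (regRoot p δ t') ≤ regEnergy p δ (regRoot p δ t)
      + regRoot p δ t * (t' - t) + (t' - t) ^ 2 / (2 * δ) := by
  set ψ : ℝ → ℝ := fun x => regRoot p δ t * (x - t) + (x - t) ^ 2 / (2 * δ)
    - regEnergy p δ (regRoot p δ x) with hψ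
  have hd : ∀ x, HasDerivAt ψ (regRoot p δ t + (x - t) / δ - regRoot p δ x) x := fun x => by
    have e₁ : HasDerivAt (fun x => x - t) 1 x := (hasDerivAt_id x).sub_const t
    have := ((e₁.const_mul (regRoot p δ t)).add ((e₁.pow 2).div_const (2 * δ))).sub
      (hasDerivAt_regEnergy_regRoot hp hδ x)
    refine this.congr_deriv ?_
    field_simp
    push_cast
    ring
  have hdiff : Differentiable ℝ ψ := fun x => (hd x).differentiableAt
  have hmin : ψ t ≤ ψ t' := by
    rcases le_total t t' with h | h
    · refine monotoneOn_of_deriv_nonneg (convex_Ici t) hdiff.continuous.continuousOn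
        hdiff.differentiableOn (fun x hx => ?_) self_mem_Ici h h
      rw [interior_Ici] at hx
      rw [(hd x).deriv]
      have := (regRoot_sub_le hp hδ (le_of_lt hx)).2
      linarith
    · refine antitoneOn_of_deriv_nonpos (convex_Iic t) hdiff.continuous.continuousOn
        hdiff.differentiableOn (fun x hx => ?_) h self_mem_Iic h
      rw [interior_Iic] at hx
      rw [(hd x).deriv]
      have := (regRoot_sub_le hp hδ (le_of_lt hx)).2
      have e : (x - t) / δ = -((t - x) / δ) := by ring
      linarith
  simp only [hψ, sub_self, mul_zero, zero_pow two_ne_zero, zero_div, zero_add, zero_sub] at hmin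
  linarith

end regPow

/-- The radial-type energy whose gradient is the coordinatewise regularized root. -/
def barEnergy (p δ : ℝ) {n : ℕ} (x : En n) : ℝ := ∑ i, regEnergy p δ (regRoot p δ (x i))

/-- The gradient of `barEnergy`. -/
def barGrad (p δ : ℝ) {n : ℕ} (x : En n) : En n := WithLp.toLp 2 fun i => regRoot p δ (x i)

/-- The inverse diagonal Hessian of `barEnergy`. -/
def barWeight (p δ : ℝ) {n : ℕ} (x : En n) (i : Fin n) : ℝ := |regRoot p δ (x i)| ^ p + δ

section barrier
variable {p δ : ℝ} {n : ℕ}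

@[simp]
theorem barGrad_apply (x : En n) (i : Fin n) : barGrad p δ x i = regRoot p δ (x i) := rfl

theorem barWeight_pos (hδ : 0 < δ) (x : En n) (i : Fin n) : 0 < barWeight p δ x i :=
  rpow_abs_add_pos hδ _

theorem barEnergy_nonneg (hp : 0 ≤ p) (hδ : 0 < δ) (x : En n) : 0 ≤ barEnergy p δ x :=
  Finset.sum_nonneg fun _ _ => regEnergy_nonneg hp hδ _

theorem barGrad_injective (hp : 0 ≤ p) (hδ : 0 < δ) :
    Function.Injective (barGrad p δ : En n → En n) := fun x y h => by
  ext i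
  have := congrFun (congrArg WithLp.ofLp h) i
  exact regRoot_injective hp hδ this

theorem hasStrictFDerivAt_barGrad (hp : 0 ≤ p) (hδ : 0 < δ) (x : En n) :
    HasStrictFDerivAt (barGrad p δ) (Matrix.toEuclideanCLM (𝕜 := ℝ)
      (Matrix.diagonal fun i => 1 / barWeight p δ x i)) x := by
  rw [hasStrictFDerivAt_euclidean]
  intro i
  have h1 := (hasStrictDerivAt_regRoot hp hδ (x i)).comp_hasStrictFDerivAt x
    (EuclideanSpace.proj (𝕜 := ℝ) i).hasStrictFDerivAt
  refine h1.congr_fderiv ?_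
  ext h
  simp [Matrix.mulVec_diagonal, barWeight]

theorem continuous_barGrad (hp : 0 ≤ p) (hδ : 0 < δ) :
    Continuous (barGrad p δ : En n → En n) :=
  continuous_iff_continuousAt.2 fun x => (hasStrictFDerivAt_barGrad hp hδ x).hasFDerivAt.continuousAt

theorem hasFDerivAt_barEnergy (hp : 0 ≤ p) (hδ : 0 < δ) (x : En n) :
    HasFDerivAt (barEnergy p δ) (innerSL ℝ (barGrad p δ x)) x := by
  have h1 : HasFDerivAt (barEnergy p δ)
      (∑ i, regRoot p δ (x i) • (EuclideanSpace.proj (𝕜 := ℝ) i : En n →L[ℝ] ℝ)) x := by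
    unfold barEnergy
    refine HasFDerivAt.fun_sum fun i _ => ?_
    exact (hasDerivAt_regEnergy_regRoot hp hδ (x i)).comp_hasFDerivAt x
      (EuclideanSpace.proj (𝕜 := ℝ) i : En n →L[ℝ] ℝ).hasFDerivAt
  refine h1.congr_fderiv ?_
  ext h
  simp [PiLp.inner_apply, mul_comm]

theorem continuous_barEnergy (hp : 0 ≤ p) (hδ : 0 < δ) : Continuous (barEnergy p δ : En n → ℝ) :=
  continuous_iff_continuousAt.2 fun x => (hasFDerivAt_barEnergy hp hδ x).continuousAt

theorem hasStrictFDerivAt_barEnergy (hp : 0 ≤ p) (hδ : 0 < δ) (x : En n) :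
    HasStrictFDerivAt (barEnergy p δ) (innerSL ℝ (barGrad p δ x)) x :=
  hasStrictFDerivAt_of_hasFDerivAt_of_continuousAt
    (f' := fun x => innerSL ℝ (barGrad p δ x))
    (Filter.Eventually.of_forall (hasFDerivAt_barEnergy hp hδ))
    ((innerSL ℝ (E := En n)).continuous.comp (continuous_barGrad hp hδ)).continuousAt

theorem barEnergy_upper (hp : 0 ≤ p) (hδ : 0 < δ) (x h : En n) :
    barEnergy p δ (x + h) ≤ barEnergy p δ x + inner ℝ (barGrad p δ x) h + ‖h‖ ^ 2 / (2 * δ) := by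
  rw [EuclideanSpace.real_norm_sq_eq, PiLp.inner_apply, barEnergy, barEnergy, Finset.sum_div,
    ← Finset.sum_add_distrib, ← Finset.sum_add_distrib]
  refine Finset.sum_le_sum fun i _ => ?_
  have := regEnergy_regRoot_upper hp hδ (x i) ((x + h) i)
  simpa [mul_comm] using this

theorem two_mul_barEnergy_le (hp : 0 ≤ p) (x : En n) :
    2 * barEnergy p δ x ≤ ∑ i, barWeight p δ x i * barGrad p δ x i ^ 2 := by
  rw [barEnergy, Finset.mul_sum]
  exact Finset.sum_le_sum fun i _ => two_mul_regEnergy_le hp _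

theorem two_mul_barEnergy_le_rpow (hp : 0 ≤ p) (x : En n) :
    2 * barEnergy p δ x ≤ ∑ i, |barGrad p δ x i| ^ (p + 2) + δ * ∑ i, barGrad p δ x i ^ 2 := by
  rw [barEnergy, Finset.mul_sum, Finset.mul_sum, ← Finset.sum_add_distrib]
  exact Finset.sum_le_sum fun i _ => regEnergy_le_rpow hp _

theorem sq_mul_barEnergy_le (hp : 0 ≤ p) {r : ℝ} (hr : 1 ≤ r) {x y : En n}
    (h : barGrad p δ y = r • barGrad p δ x) : r ^ 2 * barEnergy p δ x ≤ barEnergy p δ y := by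
  rw [barEnergy, barEnergy, Finset.mul_sum]
  refine Finset.sum_le_sum fun i _ => ?_
  have h1 : regRoot p δ (y i) = r * regRoot p δ (x i) := congrFun (congrArg WithLp.ofLp h) i
  rw [h1]
  exact sq_mul_regEnergy_le hp hr _

/-- The gradient of `g ∘ barEnergy`, where `φ` is the derivative of `g`. -/
theorem hasStrictFDerivAt_smul_barGrad (hp : 0 ≤ p) (hδ : 0 < δ) {φ : ℝ → ℝ} {b : ℝ} {x : En n}
    (hφ : HasStrictDerivAt φ b (barEnergy p δ x)) :
    HasStrictFDerivAt (fun x => φ (barEnergy p δ x) • barGrad p δ x)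
      (Matrix.toEuclideanCLM (𝕜 := ℝ) (modelHess (-φ (barEnergy p δ x)) b (barWeight p δ x)
        (barGrad p δ x))) x := by
  have h1 := (hφ.comp_hasStrictFDerivAt x (hasStrictFDerivAt_barEnergy hp hδ x)).smul
    (hasStrictFDerivAt_barGrad hp hδ x)
  refine h1.congr_fderiv ?_
  ext h i
  simp [modelHess, Matrix.mulVec_diagonal, Matrix.vecMulVec_mulVec, PiLp.inner_apply, dotProduct,
    mul_comm]
  ring

end barrier

/-- Exponential decay in `t`, continued linearly below `s`. -/
def expCap (β s t : ℝ) : ℝ := Real.exp (-β * max t s) * (1 + β * (max t s - t))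

section expCap
variable {β s : ℝ}

theorem continuous_expCap : Continuous (expCap β s) := by unfold expCap; fun_prop

theorem expCap_of_le {t : ℝ} (h : s ≤ t) : expCap β s t = Real.exp (-β * t) := by
  simp [expCap, max_eq_left h]

theorem expCap_of_ge {t : ℝ} (h : t ≤ s) : expCap β s t = Real.exp (-β * s) * (1 + β * (s - t)) := by
  simp [expCap, max_eq_right h]

theorem tangent_le_expCap (hβ : 0 ≤ β) {M : ℝ} (hM : s ≤ M) (t : ℝ) :
    Real.exp (-β * M) * (1 + β * (M - t)) ≤ expCap β s t := by
  rcases le_total s t with h | h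
  · rw [expCap_of_le h]
    have h1 := Real.add_one_le_exp (β * (M - t))
    calc _ ≤ Real.exp (-β * M) * Real.exp (β * (M - t)) := by gcongr; linarith
      _ = _ := by rw [← Real.exp_add]; ring_nf
  · rw [expCap_of_ge h]
    have h1 := Real.add_one_le_exp (β * (M - s))
    have h2 : 0 ≤ β * (M - s) := mul_nonneg hβ (by linarith)
    have h3 : 0 ≤ β * (s - t) := mul_nonneg hβ (by linarith)
    have h4 : Real.exp (-β * s) = Real.exp (-β * M) * Real.exp (β * (M - s)) := by
      rw [← Real.exp_add]; ring_nf
    rw [h4, mul_assoc]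
    gcongr
    nlinarith

theorem expCap_antitone (hβ : 0 ≤ β) : Antitone (expCap β s) := fun t t' h => by
  have h1 := tangent_le_expCap hβ (le_max_right t' s) t
  refine le_trans ?_ h1
  unfold expCap
  gcongr

theorem expCap_pos (hβ : 0 ≤ β) (t : ℝ) : 0 < expCap β s t := by
  have : 0 ≤ β * (max t s - t) := mul_nonneg hβ (by simp)
  unfold expCap
  positivity

theorem expCap_lt (hβ : 0 < β) {t t' : ℝ} (ht : s ≤ t) (h : t < t') :
    expCap β s t' < expCap β s t := by
  rw [expCap_of_le ht, expCap_of_le (by linarith)]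
  apply Real.exp_lt_exp.2
  nlinarith

end expCap

/-- Ellipticity controls the weighted trace of the excess of `X` over a model Hessian. -/
theorem EllMat.sum_weight_le {n : ℕ} {lam Lam p a b δ η e F : ℝ} (hlam : 0 < lam)
    (hlL : lam ≤ Lam) (hp : 0 ≤ p) (ha : 0 < a) (hb : 0 ≤ b) (hδ : 0 < δ) (hη : 0 ≤ η)
    {A X : Matrix (Fin n) (Fin n) ℝ} (hA : EllMat lam Lam A) {s z : Fin n → ℝ}
    (hz : ∀ i, z i = -(a * s i))
    (hY : (X - modelHess a b (fun i => |s i| ^ p + δ) s).PosSemidef)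
    (hX : ∀ i, X i i ≤ e)
    (htr : (A * (Dp p z * (X - (2 * η) • (1 : Matrix (Fin n) (Fin n) ℝ)) * Dp p z)).trace ≤ F) :
    lam * a ^ p * ∑ i, (|s i| ^ p + δ) * (X - modelHess a b (fun i => |s i| ^ p + δ) s) i i ≤
      F + 2 * η * Lam * (a ^ p * ∑ i, |s i| ^ p) + Lam * (n * a ^ (p + 1))
        - lam * b * (a ^ p * ∑ i, |s i| ^ (p + 2)) + lam * a ^ p * (n * δ * e + n * a) := by
  set w : Fin n → ℝ := fun i => |s i| ^ p + δ with hw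
  have hw0 : ∀ i, 0 < w i := fun i => by positivity
  set Y := X - modelHess a b w s with hYdef
  set D := Dp p z with hD
  have hDt : D.conjTranspose = D := by simp [hD, Dp]
  have hDD : ∀ i, |z i| ^ (p / 2) * |z i| ^ (p / 2) = a ^ p * |s i| ^ p := fun i => by
    rw [← Real.rpow_add_of_nonneg (abs_nonneg _) (by positivity) (by positivity), add_halves, hz,
      abs_neg, abs_mul, abs_of_pos ha, Real.mul_rpow ha.le (abs_nonneg _)]
  have hdiag : ∀ M : Matrix (Fin n) (Fin n) ℝ, (D * M * D).trace
      = ∑ i, a ^ p * |s i| ^ p * M i i := fun M => by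
    rw [Matrix.trace]
    refine Finset.sum_congr rfl fun i _ => ?_
    rw [Matrix.diag_apply, hD, Dp, Matrix.mul_diagonal, Matrix.diagonal_mul, ← hDD i]
    ring
  have hpsd : ∀ {M : Matrix (Fin n) (Fin n) ℝ}, M.PosSemidef → (D * M * D).PosSemidef :=
    fun {M} hM => by
      have := hM.mul_mul_conjTranspose_same D
      rwa [hDt] at this
  have hsplit : D * Y * D = D * (X - (2 * η) • (1 : Matrix (Fin n) (Fin n) ℝ)) * D
      + (2 * η) • (D * 1 * D) + D * Matrix.diagonal (fun i => a / w i) * D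
      - b • (D * Matrix.vecMulVec s s * D) := by
    have : Y = (X - (2 * η) • (1 : Matrix (Fin n) (Fin n) ℝ)) + (2 * η) • 1
        + Matrix.diagonal (fun i => a / w i) - b • Matrix.vecMulVec s s := by
      rw [hYdef, modelHess, ← Matrix.diagonal_neg fun i => a / w i]
      abel
    rw [this]
    simp only [Matrix.mul_add, Matrix.add_mul, Matrix.mul_sub, Matrix.sub_mul, Matrix.mul_smul,
      Matrix.smul_mul]
  have h1 := hA.le_trace (hpsd hY)
  have h2 := hA.trace_le (hpsd Matrix.PosSemidef.one)
  have h3 := hA.trace_le (hpsd (Matrix.PosSemidef.diagonal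
    (d := fun i => a / w i) fun i => (div_pos ha (hw0 i)).le))
  have h4 := hA.le_trace (hpsd (Matrix.posSemidef_vecMulVec_self_star s))
  rw [show star s = s from rfl] at h4
  have h5 : (A * (D * Y * D)).trace = (A * (D * (X - (2 * η) • (1 : Matrix (Fin n) (Fin n) ℝ)) * D)).trace
      + (2 * η) * (A * (D * 1 * D)).trace + (A * (D * Matrix.diagonal (fun i => a / w i) * D)).trace
      - b * (A * (D * Matrix.vecMulVec s s * D)).trace := by
    rw [hsplit]
    simp only [Matrix.mul_add, Matrix.mul_sub, Matrix.mul_smul, Matrix.trace_add, Matrix.trace_sub,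
      Matrix.trace_smul, smul_eq_mul]
  rw [hdiag] at h1 h2 h3 h4
  have e2 : ∑ i, a ^ p * |s i| ^ p * (1 : Matrix (Fin n) (Fin n) ℝ) i i
      = a ^ p * ∑ i, |s i| ^ p := by simp [Finset.mul_sum]
  have e3 : ∑ i, a ^ p * |s i| ^ p * Matrix.diagonal (fun i => a / w i) i i
      ≤ n * a ^ (p + 1) := by
    calc _ ≤ ∑ _i : Fin n, a ^ (p + 1) := by
          refine Finset.sum_le_sum fun i _ => ?_
          rw [Matrix.diagonal_apply_eq, Real.rpow_add_one ha.ne']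
          have : |s i| ^ p * (a / w i) ≤ a := by
            rw [mul_div_assoc', div_le_iff₀ (hw0 i)]
            nlinarith [hδ]
          calc _ = a ^ p * (|s i| ^ p * (a / w i)) := by ring
            _ ≤ _ := by gcongr
      _ = _ := by simp
  have e4 : ∑ i, a ^ p * |s i| ^ p * Matrix.vecMulVec s s i i
      = a ^ p * ∑ i, |s i| ^ (p + 2) := by
    rw [Finset.mul_sum]
    refine Finset.sum_congr rfl fun i _ => ?_
    rw [Matrix.vecMulVec_apply, rpow_add_two_abs hp]
    ring
  have e5 : ∑ i, Y i i ≤ n * e + ∑ i, a / w i := by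
    calc _ ≤ ∑ i, (e + a / w i) := by
          refine Finset.sum_le_sum fun i _ => ?_
          rw [hYdef, Matrix.sub_apply, modelHess, Matrix.add_apply, Matrix.diagonal_apply_eq,
            Matrix.smul_apply, Matrix.vecMulVec_apply, smul_eq_mul]
          have := hX i
          have h0 : 0 ≤ b * (s i * s i) := mul_nonneg hb (mul_self_nonneg _)
          linarith
      _ = _ := by simp [Finset.sum_add_distrib]
  have e6 : δ * ∑ i, a / w i ≤ n * a := by
    rw [Finset.mul_sum]
    calc _ ≤ ∑ _i : Fin n, a := by
          refine Finset.sum_le_sum fun i _ => ?_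
          rw [mul_div_assoc', div_le_iff₀ (hw0 i)]
          have : 0 ≤ |s i| ^ p := by positivity
          nlinarith
      _ = _ := by simp
  have e7 : δ * ∑ i, Y i i ≤ n * δ * e + n * a := by nlinarith
  have e8 : ∑ i, w i * Y i i = ∑ i, |s i| ^ p * Y i i + δ * ∑ i, Y i i := by
    rw [Finset.mul_sum, ← Finset.sum_add_distrib]
    exact Finset.sum_congr rfl fun i _ => by rw [hw]; ring
  have e9 : ∑ i, a ^ p * |s i| ^ p * Y i i = a ^ p * ∑ i, |s i| ^ p * Y i i := by
    rw [Finset.mul_sum]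
    exact Finset.sum_congr rfl fun i _ => by ring
  rw [e9] at h1
  rw [e2] at h2
  rw [e4] at h4
  rw [e8]
  have hap : 0 < a ^ p := by positivity
  have g2 := mul_le_mul_of_nonneg_left h2 (by positivity : 0 ≤ 2 * η)
  have g3 := mul_le_mul_of_nonneg_left e3 (by linarith : 0 ≤ Lam)
  have g4 := mul_le_mul_of_nonneg_left h4 hb
  have g7 := mul_le_mul_of_nonneg_left e7 (by positivity : 0 ≤ lam * a ^ p)
  linarith

/-- Second order test for solutions of the extremal inequality
`M⁻(D_p(Du) D²u D_p(Du)) − Λ|Du|^{p+1} ≤ f`. -/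
def JetSuper {n : ℕ} (lam Lam p : ℝ) (Ω : Set (En n)) (u f : En n → ℝ) : Prop :=
  ∀ x ∈ Ω, ∀ (z : En n) (X : Matrix (Fin n) (Fin n) ℝ), X.IsHermitian →
    (∀ᶠ h in nhds (0 : En n), u x + inner ℝ z h
      + 1 / 2 * inner ℝ (Matrix.toEuclideanCLM (𝕜 := ℝ) X h) h ≤ u (x + h)) →
    ∃ A, EllMat lam Lam A ∧
      (A * (Dp p z.ofLp * X * Dp p z.ofLp)).trace ≤ f x + Lam * ‖z‖ ^ (p + 1)

theorem inner_fderiv_le_of_touching {n : ℕ} {P Φ : En n → ℝ} {K : En n → En n} {q : En n}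
    {T : En n →L[ℝ] En n} (hP : ∀ x, HasFDerivAt P (innerSL ℝ (K x)) x)
    (hK : DifferentiableAt ℝ K q) (hPq : P q = Φ q) (hle : ∀ᶠ x in nhds q, P x ≤ Φ x)
    (hΦ : ∀ η > 0, ∀ᶠ h in nhds (0 : En n), Φ (q + h) ≤ Φ q + inner ℝ (K q) h
      + 1 / 2 * inner ℝ (T h) h + η * ‖h‖ ^ 2) (h : En n) :
    inner ℝ (fderiv ℝ K q h) h ≤ inner ℝ (T h) h := by
  have key : ∀ η > 0, inner ℝ (fderiv ℝ K q h) h ≤ inner ℝ (T h) h + η * (4 * ‖h‖ ^ 2) := by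
    intro η hη
    have e1 : ∀ᶠ h in nhds (0 : En n), P (q + h) ≤ Φ (q + h) := by
      have : Filter.Tendsto (fun h : En n => q + h) (nhds 0) (nhds q) := by
        have : ContinuousAt (fun h : En n => q + h) 0 := by fun_prop
        simpa [ContinuousAt] using this
      exact this.eventually hle
    have e2 : ∀ᶠ h in nhds (0 : En n), inner ℝ (fderiv ℝ K q h) h
        ≤ inner ℝ (T h) h + η * (4 * ‖h‖ ^ 2) := by
      filter_upwards [e1, hΦ η hη, taylor_two_of_gradient hP hK hη] with h h1 h2 h3
      have := (abs_le.1 h3).1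
      linarith
    have e3 : Filter.Tendsto (fun t : ℝ => t • h) (nhdsWithin 0 (Ioi 0)) (nhds 0) := by
      have : ContinuousAt (fun t : ℝ => t • h) 0 := by fun_prop
      have h2 := this.tendsto
      rw [zero_smul] at h2
      exact h2.mono_left nhdsWithin_le_nhds
    obtain ⟨t, ht, ht0⟩ := ((e3.eventually e2).and self_mem_nhdsWithin).exists
    rw [map_smul, map_smul, inner_smul_left, inner_smul_left, inner_smul_right, inner_smul_right,
      norm_smul, Real.norm_of_nonneg ht0.le] at ht
    simp only [RCLike.conj_to_real] at ht
    have h2 : 0 < t * t := by positivity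
    refine le_of_mul_le_mul_left ?_ h2
    nlinarith
  refine le_of_forall_pos_le_add fun ε hε => ?_
  have := key (ε / (4 * ‖h‖ ^ 2 + 1)) (by positivity)
  refine this.trans ?_
  gcongr
  rw [div_mul_eq_mul_div, div_le_iff₀ (by positivity)]
  nlinarith [sq_nonneg ‖h‖]

theorem det_toEuclideanCLM {n : ℕ} (A : Matrix (Fin n) (Fin n) ℝ) :
    (Matrix.toEuclideanCLM (𝕜 := ℝ) A).det = A.det := by
  rw [ContinuousLinearMap.det, Matrix.coe_toEuclideanCLM_eq_toEuclideanLin,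
    Matrix.toEuclideanLin_eq_toLin_orthonormal, LinearMap.det_toLin]

theorem inner_toEuclideanCLM_left {n : ℕ} (A : Matrix (Fin n) (Fin n) ℝ) (h : Fin n → ℝ) :
    inner ℝ (Matrix.toEuclideanCLM (𝕜 := ℝ) A (WithLp.toLp 2 h)) (WithLp.toLp 2 h)
      = star h ⬝ᵥ A.mulVec h := by
  rw [real_inner_comm, Matrix.inner_toEuclideanCLM]
  rfl

theorem isHermitian_modelHess {n : ℕ} (a b : ℝ) (w s : Fin n → ℝ) :
    (modelHess a b w s).IsHermitian := by
  ext i j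
  simp only [modelHess, Matrix.conjTranspose_apply, Matrix.add_apply, Matrix.smul_apply,
    Matrix.vecMulVec_apply, star_trivial, smul_eq_mul]
  rw [mul_comm (s j)]
  congr 1
  exact congrFun (congrFun (Matrix.diagonal_transpose fun i => -(a / w i)) i) j

theorem isHermitian_of_inner_symm {n : ℕ} {X : Matrix (Fin n) (Fin n) ℝ}
    (h : ∀ h k : En n, inner ℝ (Matrix.toEuclideanCLM (𝕜 := ℝ) X h) k
      = inner ℝ (Matrix.toEuclideanCLM (𝕜 := ℝ) X k) h) : X.IsHermitian := by
  ext i j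
  have := h (EuclideanSpace.single i 1) (EuclideanSpace.single j 1)
  simpa [EuclideanSpace.inner_single_right, Matrix.ofLp_toEuclideanCLM] using this

theorem diag_le_of_inner_le {n : ℕ} {X : Matrix (Fin n) (Fin n) ℝ} {e : ℝ}
    (h : ∀ h : En n, inner ℝ (Matrix.toEuclideanCLM (𝕜 := ℝ) X h) h ≤ e * ‖h‖ ^ 2) (i : Fin n) :
    X i i ≤ e := by
  have := h (EuclideanSpace.single i 1)
  simpa [EuclideanSpace.inner_single_right, Matrix.ofLp_toEuclideanCLM] using this

/-- Determinant bound for the change of variables at a contact point. -/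
theorem JetSuper.abs_det_sub_le {n : ℕ} {lam Lam p a b δ e τ : ℝ} {Ω : Set (En n)}
    {u f : En n → ℝ} (hJ : JetSuper lam Lam p Ω u f) (hlam : 0 < lam)
    (hlL : lam ≤ Lam) (hp : 0 ≤ p) (ha : 0 < a) (hb : 0 ≤ b) (hδ : 0 < δ)
    {x s z : En n} (hx : x ∈ Ω) (hz : ∀ i, z i = -(a * s i)) {T : En n →L[ℝ] En n}
    (hTs : ∀ h k, inner ℝ (T h) k = inner ℝ (T k) h)
    (hTe : ∀ h, inner ℝ (T h) h ≤ e * ‖h‖ ^ 2)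
    (hHT : ∀ h, inner ℝ (Matrix.toEuclideanCLM (𝕜 := ℝ)
      (modelHess a b (fun i => |s i| ^ p + δ) s.ofLp) h) h ≤ inner ℝ (T h) h)
    (hjet : ∀ η > 0, ∀ᶠ h in nhds (0 : En n), u x + inner ℝ z h
            + 1 / 2 * inner ℝ (T h) h - η * ‖h‖ ^ 2 ≤ u (x + h))
    (hbs : b = 0 ∨ 2 * a ≤ b * ∑ i, (|s i| ^ p + δ) * s i ^ 2)
    (hτ : f x + Lam * ‖z‖ ^ (p + 1) + Lam * (n * a ^ (p + 1))
        - lam * b * (a ^ p * ∑ i, |s i| ^ (p + 2)) + lam * a ^ p * (n * δ * e + n * a)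
        ≤ lam * a ^ p * τ) :
    |(Matrix.toEuclideanCLM (𝕜 := ℝ) (modelHess a b (fun i => |s i| ^ p + δ) s.ofLp) - T).det|
      ≤ (τ / a) ^ n *
      |(Matrix.toEuclideanCLM (𝕜 := ℝ) (modelHess a b (fun i => |s i| ^ p + δ) s.ofLp)).det| := by
  obtain ⟨X, rfl⟩ : ∃ X, Matrix.toEuclideanCLM (𝕜 := ℝ) X = T :=
    (Matrix.toEuclideanCLM (n := Fin n) (𝕜 := ℝ)).surjective T
  rw [← map_sub, det_toEuclideanCLM, det_toEuclideanCLM]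
  have hXh := isHermitian_of_inner_symm hTs
  have hw0 : ∀ i, 0 < |s i| ^ p + δ := fun i => by positivity
  have hY : (X - modelHess a b (fun i => |s i| ^ p + δ) s.ofLp).PosSemidef := by
    refine .of_dotProduct_mulVec_nonneg (hXh.sub (isHermitian_modelHess _ _ _ _)) fun h => ?_
    rw [← inner_toEuclideanCLM_left, map_sub, _root_.sub_apply, inner_sub_left]
    have := hHT (WithLp.toLp 2 h)
    linarith
  refine _root_.abs_det_sub_le ha hw0 hbs hY ?_
  refine le_of_mul_le_mul_left (le_trans ?_ hτ) (by positivity : 0 < lam * a ^ p)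
  refine le_of_forall_pos_le_add fun η' hη' => ?_
  set C := 2 * Lam * (a ^ p * ∑ i, |s i| ^ p) with hC
  have hC0 : 0 ≤ C := by
    have : 0 ≤ Lam := by linarith
    positivity
  set η := η' / (C + 1) with hη
  have hη0 : 0 < η := by positivity
  have hηC : η * C ≤ η' := by
    rw [hη, div_mul_eq_mul_div, div_le_iff₀ (by positivity)]
    nlinarith
  obtain ⟨A, hA, hA'⟩ := hJ x hx z (X - (2 * η) • (1 : Matrix (Fin n) (Fin n) ℝ))
    (hXh.sub (by
      rw [Matrix.IsHermitian, Matrix.conjTranspose_smul, Matrix.conjTranspose_one]; simp)) (by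
    filter_upwards [hjet η hη0] with h hh
    rw [map_sub, map_smul, map_one, _root_.sub_apply, inner_sub_left]
    simp only [_root_.smul_apply, one_apply_eq_self, inner_smul_left,
      real_inner_self_eq_norm_sq, RCLike.conj_to_real]
    linarith)
  have := hA.sum_weight_le hlam hlL hp ha hb hδ hη0.le hz hY (diag_le_of_inner_le hTe) hA'
  refine this.trans ?_
  have e1 : 2 * η * Lam * (a ^ p * ∑ i, |s i| ^ p) = η * C := by rw [hC]; ring
  rw [e1]
  linarith

/-- The touching function: a capped exponential of the energy, normalized to vanish at level `ν`. -/
def barrier (p δ β s K ν : ℝ) {n : ℕ} (q : En n) : ℝ :=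
  K * (expCap β s (barEnergy p δ q) - expCap β s ν)

/-- The slope factor of `barrier` along `barGrad`. -/
def barSlope (p δ β s K : ℝ) {n : ℕ} (q : En n) : ℝ :=
  K * β * Real.exp (-β * max (barEnergy p δ q) s)

section barrierFacts
variable {p δ β s K ν : ℝ} {n : ℕ}

theorem continuous_barrier (hp : 0 ≤ p) (hδ : 0 < δ) :
    Continuous (barrier p δ β s K ν : En n → ℝ) :=
  continuous_const.mul ((continuous_expCap.comp (continuous_barEnergy hp hδ)).sub continuous_const)

theorem barrier_le (hp : 0 ≤ p) (hδ : 0 < δ) (hβ : 0 < β) (hK : 0 < K) (q : En n) :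
    barrier p δ β s K ν q ≤ K * expCap β s 0 := by
  unfold barrier
  have h1 := expCap_antitone (s := s) hβ.le (barEnergy_nonneg hp hδ q)
  have h2 := expCap_pos (s := s) hβ.le ν
  gcongr
  linarith

theorem barrier_nonpos (hβ : 0 < β) (hK : 0 < K) {q : En n} (h : ν ≤ barEnergy p δ q) :
    barrier p δ β s K ν q ≤ 0 := by
  have h1 := expCap_antitone (s := s) hβ.le h
  exact mul_nonpos_of_nonneg_of_nonpos hK.le (by linarith)

theorem le_barrier (hβ : 0 < β) (hK : 0 < K) {t : ℝ} {q : En n} (h : barEnergy p δ q ≤ t) :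
    K * (expCap β s t - expCap β s ν) ≤ barrier p δ β s K ν q := by
  have h1 := expCap_antitone (s := s) hβ.le h
  unfold barrier
  gcongr

theorem barrier_semiconvex (hp : 0 ≤ p) (hδ : 0 < δ) (hβ : 0 < β) (hK : 0 < K) (q h : En n) :
    barrier p δ β s K ν q + inner ℝ (-barSlope p δ β s K q • barGrad p δ q) h
      - K * β * Real.exp (-β * s) / δ / 2 * ‖h‖ ^ 2 ≤ barrier p δ β s K ν (q + h) := by
  set M := max (barEnergy p δ q) s with hM
  have h1 := tangent_le_expCap hβ.le (le_max_right (barEnergy p δ q) s) (barEnergy p δ (q + h))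
  have h2 := barEnergy_upper hp hδ q h
  rw [← hM] at h1
  set a := K * β * Real.exp (-β * M) with ha
  have ha0 : 0 < a := by positivity
  have haa : a ≤ K * β * Real.exp (-β * s) := by
    have : s ≤ M := le_max_right _ _
    rw [ha]
    gcongr K * β * Real.exp ?_
    nlinarith
  have h3 : a * barEnergy p δ (q + h) ≤ a * (barEnergy p δ q + inner ℝ (barGrad p δ q) h
      + ‖h‖ ^ 2 / (2 * δ)) := mul_le_mul_of_nonneg_left h2 ha0.le
  have h4 : a * (‖h‖ ^ 2 / (2 * δ)) ≤ K * β * Real.exp (-β * s) * (‖h‖ ^ 2 / (2 * δ)) := by gcongr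
  have h5 := mul_le_mul_of_nonneg_left h1 hK.le
  have e1 : expCap β s (barEnergy p δ q)
      = Real.exp (-β * M) * (1 + β * (M - barEnergy p δ q)) := rfl
  have e2 : K * β * Real.exp (-β * s) / δ / 2 * ‖h‖ ^ 2
      = K * β * Real.exp (-β * s) * (‖h‖ ^ 2 / (2 * δ)) := by
    field_simp
  rw [barrier, barrier, e1, inner_smul_left, e2]
  simp only [RCLike.conj_to_real, barSlope]
  rw [← hM, ← ha]
  have e3 : K * (Real.exp (-β * M) * (1 + β * (M - barEnergy p δ (q + h))))
      = K * Real.exp (-β * M) * (1 + β * M) - a * barEnergy p δ (q + h) := by rw [ha]; ring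
  have e4 : K * (Real.exp (-β * M) * (1 + β * (M - barEnergy p δ q)))
      = K * Real.exp (-β * M) * (1 + β * M) - a * barEnergy p δ q := by rw [ha]; ring
  rw [mul_sub K, mul_sub K, e4]
  rw [e3] at h5
  linarith

theorem hasFDerivAt_comp_barEnergy (hp : 0 ≤ p) (hδ : 0 < δ) {g φ : ℝ → ℝ} (c : ℝ)
    (hg : ∀ t, HasDerivAt g (φ t) t) (x : En n) :
    HasFDerivAt (fun x => g (barEnergy p δ x) - c)
      (innerSL ℝ (φ (barEnergy p δ x) • barGrad p δ x)) x := by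
  have := ((hg (barEnergy p δ x)).comp_hasFDerivAt x (hasFDerivAt_barEnergy hp hδ x)).sub_const c
  rw [map_smul]
  exact this

theorem injOn_exp_smul_barGrad (hp : 0 ≤ p) (hδ : 0 < δ) (hβ : 0 < β) (hK : 0 < K)
    (hβs : 1 ≤ β * s) :
    InjOn (fun q : En n => -(K * β * Real.exp (-β * barEnergy p δ q)) • barGrad p δ q)
      {q | s < barEnergy p δ q} := by
  have key : ∀ q q' : En n, s < barEnergy p δ q → s < barEnergy p δ q' →
      barEnergy p δ q ≤ barEnergy p δ q' →
      -(K * β * Real.exp (-β * barEnergy p δ q)) • barGrad p δ q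
        = -(K * β * Real.exp (-β * barEnergy p δ q')) • barGrad p δ q' → q = q' := by
    intro q q' hq hq' hle h
    set N := barEnergy p δ q with hN
    set N' := barEnergy p δ q' with hN'
    set r := Real.exp (β * (N' - N)) with hr
    have hr1 : 1 ≤ r := Real.one_le_exp (mul_nonneg hβ.le (by linarith))
    have h1 : barGrad p δ q' = r • barGrad p δ q := by
      have h2 : Real.exp (-β * N) = r * Real.exp (-β * N') := by
        rw [hr, ← Real.exp_add]; ring_nf
      have hc : -(K * β * Real.exp (-β * N')) ≠ 0 := by
        have : 0 < K * β * Real.exp (-β * N') := by positivity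
        linarith
      refine smul_right_injective _ hc ?_
      simp only
      rw [← h, h2, smul_smul]
      congr 1
      ring
    have h2 := sq_mul_barEnergy_le hp hr1 h1
    rw [← hN, ← hN'] at h2
    have h3 : 1 + 2 * (β * (N' - N)) ≤ r ^ 2 := by
      rw [hr, ← Real.exp_nat_mul]
      have := Real.add_one_le_exp (((2 : ℕ) : ℝ) * (β * (N' - N)))
      push_cast at this ⊢
      linarith
    have hs : 0 < s := by
      by_contra hs
      have := mul_nonpos_of_nonneg_of_nonpos hβ.le (not_lt.1 hs)
      linarith
    have hNN : N' = N := by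
      refine le_antisymm ?_ hle
      by_contra hlt
      rw [not_le] at hlt
      have h4 : (1 + 2 * (β * (N' - N))) * N ≤ N' :=
        (mul_le_mul_of_nonneg_right h3 (by linarith)).trans h2
      have h5 : 1 ≤ β * N := hβs.trans (by gcongr)
      nlinarith
    have hr' : r = 1 := by rw [hr, hNN]; simp
    rw [hr', one_smul] at h1
    exact (barGrad_injective hp hδ h1).symm
  intro q hq q' hq' h
  rcases le_total (barEnergy p δ q) (barEnergy p δ q') with hle | hle
  · exact key q q' hq hq' hle h
  · exact (key q' q hq' hq hle h.symm).symm

theorem hasDerivAt_exp_scaled (β K t : ℝ) :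
    HasDerivAt (fun t => K * Real.exp (-β * t)) (-(K * β * Real.exp (-β * t))) t := by
  have := (((hasDerivAt_id t).const_mul (-β)).exp).const_mul K
  refine this.congr_deriv ?_
  simp
  ring

theorem hasStrictDerivAt_exp_scaled (β K t : ℝ) :
    HasStrictDerivAt (fun t => -(K * β * Real.exp (-β * t)))
      (β * (K * β * Real.exp (-β * t))) t := by
  have := ((((hasStrictDerivAt_id t).const_mul (-β)).exp).const_mul (K * β)).neg
  refine this.congr_deriv ?_
  simp
  ring

theorem hasDerivAt_linear_cap (β s K t : ℝ) :
    HasDerivAt (fun t => K * (Real.exp (-β * s) * (1 + β * (s - t))))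
      (-(K * β * Real.exp (-β * s))) t := by
  have := (((((hasDerivAt_id t).const_sub s).const_mul β).const_add 1).const_mul
    (Real.exp (-β * s))).const_mul K
  refine this.congr_deriv ?_
  ring

end barrierFacts

theorem norm_le_sum_abs {n : ℕ} (x : En n) : ‖x‖ ≤ ∑ i, |x i| := by
  refine le_of_sq_le_sq ?_ (Finset.sum_nonneg fun _ _ => abs_nonneg _)
  rw [EuclideanSpace.real_norm_sq_eq]
  calc ∑ i, x i ^ 2 = ∑ i, |x i| ^ 2 := by simp
    _ ≤ _ := Finset.sum_sq_le_sq_sum_of_nonneg fun _ _ => abs_nonneg _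

theorem abs_apply_le_norm {n : ℕ} (x : En n) (i : Fin n) : |x i| ≤ ‖x‖ := by
  simpa using PiLp.norm_apply_le x i

theorem exists_norm_le_mul_abs {n : ℕ} (hn : 1 ≤ n) (x : En n) : ∃ i, ‖x‖ ≤ n * |x i| := by
  have : Nonempty (Fin n) := ⟨⟨0, hn⟩⟩
  obtain ⟨i, hi⟩ := Finite.exists_max fun i => |x i|
  refine ⟨i, (norm_le_sum_abs x).trans ?_⟩
  calc ∑ j, |x j| ≤ ∑ _j : Fin n, |x i| := Finset.sum_le_sum fun j _ => hi j
    _ = _ := by simp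

section barrierSize
variable {p δ : ℝ} {n : ℕ}

theorem barEnergy_le (hp : 0 ≤ p) (hδ : 0 < δ) {ρ : ℝ} {x : En n} (hx : ‖x‖ ≤ ρ) :
    barEnergy p δ x ≤ n * (ρ * (1 + (p + 1) * ρ)) := by
  have h0 : 0 ≤ ρ := (norm_nonneg _).trans hx
  calc barEnergy p δ x ≤ ∑ _i : Fin n, ρ * (1 + (p + 1) * ρ) := by
        refine Finset.sum_le_sum fun i _ => (regEnergy_regRoot_le hp hδ (x i)).trans ?_
        have := (abs_apply_le_norm x i).trans hx
        gcongr
    _ = _ := by simp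

theorem abs_barGrad_le (hp : 0 ≤ p) (hδ : 0 < δ) {ρ : ℝ} {x : En n} (hx : ‖x‖ ≤ ρ) (i : Fin n) :
    |barGrad p δ x i| ≤ 1 + (p + 1) * ρ := by
  refine (abs_regRoot_le hp hδ (x i)).trans ?_
  have := (abs_apply_le_norm x i).trans hx
  gcongr

theorem norm_barGrad_le (hp : 0 ≤ p) (hδ : 0 < δ) {ρ : ℝ} {x : En n} (hx : ‖x‖ ≤ ρ) :
    ‖barGrad p δ x‖ ≤ n * (1 + (p + 1) * ρ) := by
  refine (norm_le_sum_abs _).trans ?_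
  calc _ ≤ ∑ _i : Fin n, (1 + (p + 1) * ρ) :=
        Finset.sum_le_sum fun i _ => abs_barGrad_le hp hδ hx i
    _ = _ := by simp; ring

theorem le_barEnergy (hp : 0 ≤ p) (hδ : 0 < δ) (hδ1 : δ ≤ 1) {t : ℝ} (ht : 0 ≤ t) {x : En n}
    {i : Fin n} (hi : t ≤ |x i|) : t * min 1 (t / 2) ≤ (p + 2) * barEnergy p δ x := by
  have h1 := le_regEnergy_regRoot hp hδ hδ1 (x i)
  have h2 : regEnergy p δ (regRoot p δ (x i)) ≤ barEnergy p δ x :=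
    Finset.single_le_sum (f := fun i => regEnergy p δ (regRoot p δ (x i)))
      (fun j _ => regEnergy_nonneg hp hδ _) (Finset.mem_univ i)
  calc t * min 1 (t / 2) ≤ |x i| * min 1 (|x i| / 2) := by gcongr
    _ ≤ _ := h1
    _ ≤ _ := by gcongr

theorem norm_lt_half_of_barEnergy_le (hn : 1 ≤ n) (hp : 0 ≤ p) (hδ : 0 < δ) (hδ1 : δ ≤ 1)
    {x : En n} (hx : barEnergy p δ x ≤ (1 / (2 * n)) ^ 2 / (4 * (p + 2))) : ‖x‖ < 1 / 2 := by
  by_contra h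
  rw [not_lt] at h
  obtain ⟨i, hi⟩ := exists_norm_le_mul_abs hn x
  have hn' : (1 : ℝ) ≤ n := by exact_mod_cast hn
  set t : ℝ := 1 / (2 * n) with ht
  have ht0 : 0 < t := by positivity
  have ht1 : t ≤ 1 := by rw [ht, div_le_one (by positivity)]; linarith
  have h1 : t ≤ |x i| := by
    rw [ht, div_le_iff₀ (by positivity)]
    linarith
  have h2 := le_barEnergy hp hδ hδ1 ht0.le h1
  rw [min_eq_right (by linarith)] at h2
  have h3 : (p + 2) * barEnergy p δ x ≤ (p + 2) * (t ^ 2 / (4 * (p + 2))) := by gcongr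
  have h4 : (p + 2) * (t ^ 2 / (4 * (p + 2))) = t ^ 2 / 4 := by field_simp
  nlinarith

theorem le_barEnergy_of_le_norm (hn : 1 ≤ n) (hp : 0 ≤ p) (hδ : 0 < δ) (hδ1 : δ ≤ 1) {ν : ℝ}
    (hν : 1 ≤ ν) {x : En n} (hx : n * ((p + 2) * ν) ≤ ‖x‖) : ν ≤ barEnergy p δ x := by
  obtain ⟨i, hi⟩ := exists_norm_le_mul_abs hn x
  have hn' : (0 : ℝ) < n := by exact_mod_cast hn
  have h1 : (p + 2) * ν ≤ |x i| := le_of_mul_le_mul_left (hx.trans hi) hn'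
  have h2 := le_barEnergy hp hδ hδ1 (by positivity) h1
  rw [min_eq_left (by nlinarith), mul_one] at h2
  exact le_of_mul_le_mul_left h2 (by linarith)

end barrierSize

theorem det_modelHess_ne_zero {n : ℕ} {a b : ℝ} (ha : 0 < a) {w s : Fin n → ℝ}
    (hw : ∀ i, 0 < w i) (hb : b = 0 ∨ 2 * a ≤ b * ∑ i, w i * s i ^ 2) :
    (modelHess a b w s).det ≠ 0 := by
  intro h
  have h1 := det_modelHess (b := b) (s := s) ha hw
  rw [h, zero_mul, eq_comm, mul_eq_zero] at h1
  rcases h1 with h1 | h1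
  · exact pow_ne_zero _ (neg_ne_zero.2 ha.ne') h1
  · rcases hb with rfl | hb
    · simp at h1
    · rw [sub_eq_zero, div_mul_eq_mul_div, eq_div_iff ha.ne'] at h1
      linarith

open Classical in
set_option maxHeartbeats 2000000 in
/-- The measure of the vertices of touching translates is controlled by the contact set. -/
theorem JetSuper.volume_ball_half_le {n : ℕ} {lam Lam p s β K ν R S D am : ℝ}
    (hlam : 0 < lam) (hlL : lam ≤ Lam) (hp : 0 ≤ p) (hs : 0 < s) (hβ : 0 < β) (hK : 0 < K)
    (hβs : 1 ≤ β * s) (hR : 4 ≤ R) (hS : S = 1 + (p + 1) * (R + 1))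
    (hD : D = Lam * (n * S) ^ (p + 1) + Lam * n + lam * n + lam) (hDβ : D ≤ lam * β * s)
    (ham : am = K * β * Real.exp (-β * max (n * ((R + 1) * S)) s))
    (hfar : ∀ δ, 0 < δ → δ ≤ 1 → ∀ x : En n, R - 3 / 2 ≤ ‖x‖ → ν ≤ barEnergy p δ x)
    (hnear : ∀ δ, 0 < δ → δ ≤ 1 → ∀ x : En n, barEnergy p δ x ≤ s → ‖x‖ < 1 / 2)
    (htop : ∀ δ, 0 < δ → δ ≤ 1 → ∀ x : En n, ‖x‖ ≤ 3 / 2 → 2 ≤ barrier p δ β s K ν x)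
    {u f : En n → ℝ} (hu : ContinuousOn u (closedBall 0 R)) (hu0 : ∀ x ∈ closedBall 0 R, 0 ≤ u x)
    (hf : ContinuousOn f (closedBall 0 R)) (hJ : JetSuper lam Lam p (ball 0 R) u f)
    {x₀ : En n} (hx₀ : x₀ ∈ ball 0 1) (hux₀ : u x₀ ≤ 1) :
    volume (ball (0 : En n) (1 / 2)) ≤
      (∫⁻ x in ball 0 R, ENNReal.ofReal (((1 / (lam * am ^ (p + 1)) + D / lam) * |f x|) ^ n)) +
      ∫⁻ x in ball 0 1 ∩ {x | u x ≤ K * expCap β s 0 + 1},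
        ENNReal.ofReal (((1 / (lam * am ^ (p + 1)) + D / lam) * (|f x| + 1)) ^ n) := by
  have hLam : 0 < Lam := hlam.trans_le hlL
  have hS0 : 0 < S := by rw [hS]; positivity
  have ham0 : 0 < am := by rw [ham]; positivity
  have hD0 : 0 < D := by rw [hD]; positivity
  set M₀ := K * expCap β s 0 with hM₀
  have hM₀0 : 0 < M₀ := mul_pos hK (expCap_pos hβ.le 0)
  set B := 1 / (lam * am ^ (p + 1)) + D / lam with hB
  set η₁ := lam / 2 * am ^ (p + 1) with hη₁
  have hη₁0 : 0 < η₁ := by positivity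
  obtain ⟨ρ₁, hρ₁, hρu⟩ := Metric.uniformContinuousOn_iff.1
    ((isCompact_closedBall (0 : En n) R).uniformContinuousOn_of_continuous hu) 1 one_pos
  obtain ⟨ρ₂, hρ₂, hρf⟩ := Metric.uniformContinuousOn_iff.1
    ((isCompact_closedBall (0 : En n) R).uniformContinuousOn_of_continuous hf) η₁ hη₁0
  set ρ := min 1 (min ρ₁ ρ₂) with hρ
  have hρ0 : 0 < ρ := by positivity
  set ε := ρ ^ 2 / (4 * M₀) with hε
  have hε0 : 0 < ε := by positivity
  have hεM : 2 * ε * M₀ = ρ ^ 2 / 2 := by rw [hε]; field_simp; norm_num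
  have hρ1 : ρ ^ 2 ≤ 1 := pow_le_one₀ hρ0.le (min_le_left _ _)
  obtain ⟨δ, hδ, hδ1, hδS, hδε⟩ : ∃ δ : ℝ, 0 < δ ∧ δ ≤ 1 ∧ δ * (n * S ^ 2) ≤ s ∧
      n * δ * (1 / ε) ≤ am / 2 := by
    refine ⟨min 1 (min (s / (n * S ^ 2 + 1)) (am / 2 * ε / (n + 1))), by positivity,
      min_le_left _ _, ?_, ?_⟩
    · calc _ ≤ s / (n * S ^ 2 + 1) * (n * S ^ 2 + 1) := by
            gcongr
            · exact (min_le_right _ _).trans (min_le_left _ _)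
            · linarith
        _ = s := by field_simp
    · calc _ ≤ (n + 1) * (am / 2 * ε / (n + 1)) * (1 / ε) := by
            gcongr
            · linarith
            · exact (min_le_right _ _).trans (min_le_right _ _)
        _ = am / 2 := by field_simp
  set Φ : En n → ℝ := barrier p δ β s K ν with hΦ
  set a₁ := K * β * Real.exp (-β * s) with ha₁
  have ha₁0 : 0 < a₁ := by positivity
  obtain ⟨G, L, hGL, hG⟩ := exists_contact_regularization (u := u) (Φ := Φ)
    (Z := fun q => -barSlope p δ β s K q • barGrad p δ q) (R := R) (ε := ε) (κ := a₁ / δ)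
    (M₀ := M₀) (V := ball 0 (1 / 2)) (by linarith) hε0 (by linarith) (by positivity)
    hu hu0 (continuous_barrier hp hδ) (barrier_semiconvex hp hδ hβ hK)
    (barrier_le hp hδ hβ hK) (fun y hy x hx => barrier_nonpos hβ hK (hfar δ hδ hδ1 _ (by
      rw [mem_ball_zero_iff] at hy
      have := norm_sub_norm_le x y
      linarith))) (x₀ := x₀)
    (ball_subset_closedBall (ball_subset_ball (by linarith) hx₀)) hux₀
    (fun y hy => htop δ hδ hδ1 _ (by
      rw [mem_ball_zero_iff] at hy hx₀
      have := norm_sub_le x₀ y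
      linarith))
  set f' : En n → ℝ := (ball (0 : En n) R).piecewise f 0 with hf'
  have hf'm : Measurable f' := ContinuousOn.measurable_piecewise
    (hf.mono ball_subset_closedBall) continuousOn_const measurableSet_ball
  have hf'e : ∀ x ∈ ball (0 : En n) R, f' x = f x := fun x hx => piecewise_eq_of_mem _ _ _ hx
  set A₂ := ball (0 : En n) 1 ∩ {x | u x ≤ M₀ + 1} with hA₂
  have hA₂m : MeasurableSet A₂ := by
    have h1 : ContinuousOn u (ball (0 : En n) 1) :=
      hu.mono (ball_subset_closedBall.trans (closedBall_subset_closedBall (by linarith)))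
    have h2 := h1.isOpen_inter_preimage isOpen_ball (isOpen_Ioi (a := M₀ + 1))
    have h3 : A₂ = ball (0 : En n) 1 \ (ball (0 : En n) 1 ∩ u ⁻¹' Ioi (M₀ + 1)) := by
      ext x
      simp only [hA₂, mem_inter_iff, mem_ofPred_eq, mem_sdiff, mem_preimage, mem_Ioi, not_and, not_lt]
      tauto
    rw [h3]
    exact measurableSet_ball.diff h2.measurableSet
  -- the slope-independent part of the error terms
  have common : ∀ a, am ≤ a → ∀ σ z x x' : En n, ‖σ‖ ≤ n * S → z = -a • σ →
      |f x - f x'| ≤ η₁ → f x' + Lam * ‖z‖ ^ (p + 1) + Lam * (n * a ^ (p + 1))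
        + lam * a ^ p * (n * δ * (1 / ε) + n * a) ≤ |f x| + D * a ^ (p + 1) := by
    intro a ha σ z x x' hσ hz hfx
    have ha0 : 0 < a := ham0.trans_le ha
    have e1 : ‖z‖ ^ (p + 1) ≤ a ^ (p + 1) * (n * S) ^ (p + 1) := by
      rw [← Real.mul_rpow ha0.le (by positivity), hz, neg_smul, norm_neg, norm_smul,
        Real.norm_of_nonneg ha0.le]
      gcongr
    have e2 : η₁ ≤ lam / 2 * a ^ (p + 1) := by rw [hη₁]; gcongr
    have e3 : a ^ p * (n * δ * (1 / ε)) ≤ a ^ (p + 1) / 2 := by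
      rw [Real.rpow_add_one ha0.ne', mul_div_assoc]
      gcongr
      linarith
    have e4 : a ^ p * (n * a) = n * a ^ (p + 1) := by rw [Real.rpow_add_one ha0.ne']; ring
    have e5 := (abs_le.1 hfx).1
    have e6 := le_abs_self (f x)
    have e7 := mul_le_mul_of_nonneg_left e1 hLam.le
    have e8 := mul_le_mul_of_nonneg_left e3 hlam.le
    rw [hD, mul_assoc lam, mul_add (a ^ p), e4]
    linarith
  have hBa : ∀ a, am ≤ a → ∀ t, 0 ≤ t → t / (lam * a ^ p) / a ≤ t * (1 / (lam * am ^ (p + 1))) := by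
    intro a ha t ht
    have ha0 : 0 < a := ham0.trans_le ha
    rw [div_div, mul_assoc, ← Real.rpow_add_one ha0.ne', div_eq_mul_one_div]
    gcongr
  set N : En n → ℝ := barEnergy p δ with hN
  set K₁' : En n → En n →L[ℝ] En n := fun q => Matrix.toEuclideanCLM (𝕜 := ℝ)
    (modelHess (K * β * Real.exp (-β * N q)) (β * (K * β * Real.exp (-β * N q)))
      (barWeight p δ q) (barGrad p δ q).ofLp) with hK₁'
  set K₁ : En n → En n := fun q => -(K * β * Real.exp (-β * N q)) • barGrad p δ q with hK₁
  have hK₁d : ∀ q, HasStrictFDerivAt K₁ (K₁' q) q := fun q => by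
    have := hasStrictFDerivAt_smul_barGrad hp hδ (hasStrictDerivAt_exp_scaled β K (N q))
    rwa [neg_neg] at this
  set K₂' : En n → En n →L[ℝ] En n := fun q => Matrix.toEuclideanCLM (𝕜 := ℝ)
    (modelHess a₁ 0 (barWeight p δ q) (barGrad p δ q).ofLp) with hK₂'
  set K₂ : En n → En n := fun q => -a₁ • barGrad p δ q with hK₂
  have hK₂d : ∀ q, HasStrictFDerivAt K₂ (K₂' q) q := fun q => by
    have := hasStrictFDerivAt_smul_barGrad hp hδ (hasStrictDerivAt_const (N q) (-a₁))
    rwa [neg_neg] at this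
  have hdet₁ : ∀ q, s < N q → 2 * (K * β * Real.exp (-β * N q)) ≤
      β * (K * β * Real.exp (-β * N q)) * ∑ i, barWeight p δ q i * barGrad p δ q i ^ 2 := by
    intro q hq
    have h1 := two_mul_barEnergy_le (δ := δ) hp q
    have h2 : 1 ≤ β * N q := hβs.trans (by gcongr)
    have h3 : 2 ≤ β * ∑ i, barWeight p δ q i * barGrad p δ q i ^ 2 := by
      have := mul_le_mul_of_nonneg_left h1 hβ.le
      linarith
    have h4 : 0 ≤ K * β * Real.exp (-β * N q) := by positivity
    nlinarith
  set V₁ := {y | ∃ x ∈ ball (0 : En n) R, x - y ∈ {q | s < N q} ∧ G x = K₁ (x - y) ∧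
    (DifferentiableAt ℝ G x → |(K₁' (x - y) - fderiv ℝ G x).det|
      ≤ (B * |f' x|) ^ n * |(K₁' (x - y)).det|)} with hV₁
  set V₂ := {y | ∃ x ∈ A₂, x - y ∈ (univ : Set (En n)) ∧ G x = K₂ (x - y) ∧
    (DifferentiableAt ℝ G x → |(K₂' (x - y) - fderiv ℝ G x).det|
      ≤ (B * (|f' x| + 1)) ^ n * |(K₂' (x - y)).det|)} with hV₂
  have hv₁ : volume V₁ ≤ ∫⁻ x in ball 0 R, ENNReal.ofReal ((B * |f x|) ^ n) := by
    refine (volume_le_lintegral_of_gradient_contact hGL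
      (isOpen_lt continuous_const (continuous_barEnergy hp hδ))
      (injOn_exp_smul_barGrad hp hδ hβ hK hβs) (fun q _ => hK₁d q) (fun q hq => ?_)
      measurableSet_ball (by fun_prop) fun y hy => hy).trans_eq ?_
    · rw [hK₁', det_toEuclideanCLM]
      exact det_modelHess_ne_zero (by positivity) (barWeight_pos hδ q) (Or.inr (hdet₁ q hq))
    · refine setLIntegral_congr_fun measurableSet_ball fun x hx => ?_
      simp only [hf'e x hx]
  have hv₂ : volume V₂ ≤ ∫⁻ x in A₂, ENNReal.ofReal ((B * (|f x| + 1)) ^ n) := by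
    refine (volume_le_lintegral_of_gradient_contact hGL isOpen_univ ?_
      (fun q _ => hK₂d q) (fun q _ => ?_) hA₂m (by fun_prop) fun y hy => hy).trans_eq ?_
    · intro q _ q' _ h
      exact barGrad_injective hp hδ (smul_right_injective _ (neg_ne_zero.2 ha₁0.ne') h)
    · rw [hK₂', det_toEuclideanCLM]
      exact det_modelHess_ne_zero ha₁0 (barWeight_pos hδ q) (Or.inl rfl)
    · refine setLIntegral_congr_fun hA₂m fun x hx => ?_
      simp only [hf'e x (ball_subset_ball (by linarith) hx.1)]
  refine (measure_mono (t := V₁ ∪ V₂) fun y hy => ?_).trans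
    ((measure_union_le _ _).trans (add_le_add hv₁ hv₂))
  obtain ⟨x, z, hxR, hzR, hxz, huz, hGx, hdiff⟩ := hG y hy
  have hx : x ∈ ball (0 : En n) R := by rw [mem_ball_zero_iff]; linarith
  have hz : z ∈ ball (0 : En n) R := by rwa [mem_ball_zero_iff]
  have hxz' : dist x z < ρ := by
    rw [dist_eq_norm]
    refine lt_of_pow_lt_pow_left₀ 2 hρ0.le ?_
    have : 0 < ρ ^ 2 := by positivity
    linarith
  have hux : u x ≤ M₀ + 1 := by
    have := hρu x (ball_subset_closedBall hx) z (ball_subset_closedBall hz)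
      (hxz'.trans_le ((min_le_right _ _).trans (min_le_left _ _)))
    rw [Real.dist_eq] at this
    have := (abs_lt.1 this).2
    linarith
  have hfx : |f x - f z| ≤ η₁ := by
    have := hρf x (ball_subset_closedBall hx) z (ball_subset_closedBall hz)
      (hxz'.trans_le ((min_le_right _ _).trans (min_le_right _ _)))
    rw [Real.dist_eq] at this
    exact this.le
  set q := x - y with hq
  have hqR : ‖q‖ ≤ R + 1 := by
    rw [mem_ball_zero_iff] at hy
    have := norm_sub_le x y
    linarith
  have hσ : ‖barGrad p δ q‖ ≤ n * S := by rw [hS]; exact norm_barGrad_le hp hδ hqR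
  have hσi : ∀ i, |barGrad p δ q i| ≤ S := fun i => by rw [hS]; exact abs_barGrad_le hp hδ hqR i
  have hNq : N q ≤ n * ((R + 1) * S) := by rw [hS]; exact barEnergy_le hp hδ hqR
  have hama : am ≤ barSlope p δ β s K q := by
    rw [ham, barSlope]
    have h1 : max (N q) s ≤ max (n * ((R + 1) * S)) s := max_le_max_right _ hNq
    gcongr K * β * Real.exp ?_
    nlinarith
  rcases lt_or_ge s (N q) with hsq | hsq
  · left
    have hslope : barSlope p δ β s K q = K * β * Real.exp (-β * N q) := by
      rw [barSlope, max_eq_left hsq.le]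
    rw [hslope] at hama hGx
    refine ⟨x, hx, hsq, hGx, fun hd => ?_⟩
    obtain ⟨hTs, hTe, hη⟩ := hdiff hd
    set a := K * β * Real.exp (-β * N q) with ha
    have ha0 : 0 < a := by positivity
    have hsum : s ≤ ∑ i, |barGrad p δ q i| ^ (p + 2) := by
      have h1 := two_mul_barEnergy_le_rpow (δ := δ) hp q
      have h2 : ∑ i, barGrad p δ q i ^ 2 ≤ n * S ^ 2 := by
        calc _ ≤ ∑ _i : Fin n, S ^ 2 :=
              Finset.sum_le_sum fun i _ => sq_le_sq' (abs_le.1 (hσi i)).1 (abs_le.1 (hσi i)).2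
          _ = _ := by simp
      have h3 := mul_le_mul_of_nonneg_left h2 hδ.le
      linarith
    have hmain := hJ.abs_det_sub_le (a := a) (b := β * a) (δ := δ) (e := 1 / ε)
      (τ := |f x| / (lam * a ^ p)) hlam hlL hp ha0 (by positivity) hδ (s := barGrad p δ q) hz
      (z := -a • barGrad p δ q) (fun i => by simp) hTs hTe (fun h => ?_)
      (fun η hη0 => by
        have := (hη η hη0).2
        simpa only [hslope] using this) (Or.inr (hdet₁ q hsq)) ?_
    · refine hmain.trans ?_
      rw [hf'e x hx]
      refine mul_le_mul_of_nonneg_right (pow_le_pow_left₀ (by positivity) ?_ n) (abs_nonneg _)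
      refine (hBa a hama _ (abs_nonneg _)).trans ?_
      rw [mul_comm, hB]
      gcongr
      have : 0 ≤ D / lam := by positivity
      linarith
    · have h1 := inner_fderiv_le_of_touching (Φ := Φ) (q := q) (T := fderiv ℝ G x)
        (hasFDerivAt_comp_barEnergy hp hδ (K * expCap β s ν) (hasDerivAt_exp_scaled β K))
        (hK₁d q).hasFDerivAt.differentiableAt (by
          rw [hΦ, barrier, expCap_of_le hsq.le, mul_sub]) (by
          have h2 : ∀ᶠ x in nhds q, s < N x :=
            (isOpen_lt continuous_const (continuous_barEnergy hp hδ)).mem_nhds hsq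
          filter_upwards [h2] with x hx
          rw [hΦ, barrier, expCap_of_le (le_of_lt hx), mul_sub]) (fun η hη0 => by
          have := (hη η hη0).1
          simpa only [hslope] using this) h
      rw [(hK₁d q).hasFDerivAt.fderiv] at h1
      exact h1
    · have h1 := common a hama (barGrad p δ q) _ x z hσ rfl hfx
      have h2 : D * a ^ (p + 1)
          ≤ lam * (β * a) * (a ^ p * ∑ i, |barGrad p δ q i| ^ (p + 2)) := by
        calc D * a ^ (p + 1) ≤ lam * β * (∑ i, |barGrad p δ q i| ^ (p + 2)) * a ^ (p + 1) := by
              gcongr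
              exact hDβ.trans (by gcongr)
          _ = _ := by rw [Real.rpow_add_one ha0.ne']; ring
      have h3 : lam * a ^ p * (|f x| / (lam * a ^ p)) = |f x| := by field_simp
      rw [h3]
      linarith
  · right
    have hslope : barSlope p δ β s K q = a₁ := by
      rw [barSlope, max_eq_right hsq]
    rw [hslope] at hama hGx
    have hx1 : x ∈ ball (0 : En n) 1 := by
      have h1 := hnear δ hδ hδ1 q hsq
      rw [mem_ball_zero_iff] at hy ⊢
      have := norm_add_le (x - y) y
      rw [sub_add_cancel] at this
      linarith
    refine ⟨x, ⟨hx1, hux⟩, mem_univ _, hGx, fun hd => ?_⟩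
    obtain ⟨hTs, hTe, hη⟩ := hdiff hd
    have hmain := hJ.abs_det_sub_le (a := a₁) (b := 0) (δ := δ) (e := 1 / ε)
      (τ := |f x| / (lam * a₁ ^ p) + D / lam * a₁) hlam hlL hp ha₁0 le_rfl hδ
      (s := barGrad p δ q) hz
      (z := -a₁ • barGrad p δ q) (fun i => by simp) hTs hTe (fun h => ?_)
      (fun η hη0 => by
        have := (hη η hη0).2
        simpa only [hslope] using this) (Or.inl rfl) ?_
    · refine hmain.trans ?_
      rw [hf'e x hx]
      refine mul_le_mul_of_nonneg_right (pow_le_pow_left₀ (by positivity) ?_ n) (abs_nonneg _)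
      rw [add_div, mul_div_cancel_right₀ _ ha₁0.ne']
      have h1 := hBa a₁ hama _ (abs_nonneg (f x))
      have h2 : 0 ≤ 1 / (lam * am ^ (p + 1)) := by positivity
      have h3 : 0 ≤ D / lam * |f x| := by positivity
      rw [hB]
      nlinarith
    · have h1 := inner_fderiv_le_of_touching (Φ := Φ) (q := q) (T := fderiv ℝ G x)
        (hasFDerivAt_comp_barEnergy hp hδ (K * expCap β s ν) (hasDerivAt_linear_cap β s K))
        (hK₂d q).hasFDerivAt.differentiableAt (by
          rw [hΦ, barrier, expCap_of_ge hsq]; ring) (Filter.Eventually.of_forall fun x => by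
          have := tangent_le_expCap (s := s) hβ.le le_rfl (N x)
          have := mul_le_mul_of_nonneg_left this hK.le
          rw [hΦ, barrier, mul_sub K]
          linarith) (fun η hη0 => by
          have := (hη η hη0).1
          simpa only [hslope] using this) h
      rw [(hK₂d q).hasFDerivAt.fderiv] at h1
      exact h1
    · have h1 := common a₁ hama (barGrad p δ q) _ x z hσ rfl hfx
      have h3 : lam * a₁ ^ p * (|f x| / (lam * a₁ ^ p) + D / lam * a₁)
          = |f x| + D * a₁ ^ (p + 1) := by
        rw [Real.rpow_add_one ha₁0.ne']; field_simp
      rw [h3, mul_zero, zero_mul, sub_zero]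
      linarith

theorem exists_barrier_parameters {n : ℕ} (hn : 1 ≤ n) {lam Lam p : ℝ}
    (hlam : 0 < lam) (hlL : lam ≤ Lam) (hp : 0 ≤ p) :
    ∃ R M c : ℝ, 4 ≤ R ∧ 1 < M ∧ 0 < c ∧ ∀ u f : En n → ℝ,
      ContinuousOn u (closedBall 0 R) → (∀ x ∈ closedBall 0 R, 0 ≤ u x) →
      ContinuousOn f (closedBall 0 R) → JetSuper lam Lam p (ball 0 R) u f →
      (∃ x₀ ∈ ball 0 1, u x₀ ≤ 1) →
      volume (ball (0 : En n) (1 / 2)) ≤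
        (∫⁻ x in ball 0 R, ENNReal.ofReal ((c * |f x|) ^ n)) +
        ∫⁻ x in ball 0 1 ∩ {x | u x ≤ M}, ENNReal.ofReal ((c * (|f x| + 1)) ^ n) := by
  have hn0 : (1 : ℝ) ≤ n := by exact_mod_cast hn
  have hLam : 0 < Lam := hlam.trans_le hlL
  set s : ℝ := (1 / (2 * n)) ^ 2 / (4 * (p + 2)) with hs
  have hs0 : 0 < s := by positivity
  have hs1 : s ≤ 1 := by
    rw [hs, div_le_one (by positivity)]
    have : (1 / (2 * n) : ℝ) ^ 2 ≤ 1 := by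
      refine pow_le_one₀ (by positivity) ?_
      rw [div_le_one (by positivity)]
      linarith
    linarith
  set ν₁ : ℝ := n * (2 * (1 + (p + 1) * 2)) with hν₁
  have hν₁1 : 6 ≤ ν₁ := by rw [hν₁]; nlinarith
  set ν := ν₁ + 1 with hν
  set R : ℝ := 3 / 2 + n * ((p + 2) * ν) with hR
  have hR4 : 4 ≤ R := by
    have h1 : 14 ≤ (p + 2) * ν := by nlinarith
    rw [hR]
    nlinarith
  set S := 1 + (p + 1) * (R + 1) with hS
  have hS0 : 0 < S := by positivity
  set D := Lam * (n * S) ^ (p + 1) + Lam * n + lam * n + lam with hD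
  set β := max (1 / s) (D / (lam * s)) with hβ
  have hβ0 : 0 < β := by positivity
  have hβs : 1 ≤ β * s := by
    rw [← div_le_iff₀ hs0]; exact le_max_left _ _
  have hDβ : D ≤ lam * β * s := by
    rw [mul_right_comm, mul_comm, ← div_le_iff₀ (by positivity)]; exact le_max_right _ _
  have hcap : 0 < expCap β s ν₁ - expCap β s ν := sub_pos.2
    (expCap_lt hβ0 (by linarith) (by linarith))
  set K := 2 / (expCap β s ν₁ - expCap β s ν) with hK
  have hK0 : 0 < K := by positivity
  have hc0 := expCap_pos (s := s) hβ0.le 0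
  refine ⟨R, K * expCap β s 0 + 1, _, hR4, ?_, ?_, fun u f hu hu0 hf hJ ⟨x₀, hx₀, hux₀⟩ =>
    hJ.volume_ball_half_le hlam hlL hp hs0 hβ0 hK0 hβs hR4 hS hD hDβ rfl (ν := ν)
      (fun δ hδ hδ1 x hx => ?_) (fun δ hδ hδ1 x hx => ?_) (fun δ hδ hδ1 x hx => ?_)
      hu hu0 hf hx₀ hux₀⟩
  · have : 0 < K * expCap β s 0 := by positivity
    linarith
  · positivity
  · exact le_barEnergy_of_le_norm hn hp hδ hδ1 (by linarith) (by linarith)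
  · exact norm_lt_half_of_barEnergy_le hn hp hδ hδ1 hx
  · have h1 := barEnergy_le hp hδ (x := x) (ρ := 2) (by linarith)
    refine le_trans ?_ (le_barrier hβ0 hK0 h1)
    rw [hK, div_mul_cancel₀ _ hcap.ne']

/-- **Growth lemma**: a nonnegative supersolution that is at most `1` somewhere in the unit ball
is bounded on a fixed portion of it. -/
theorem exists_growth {n : ℕ} (hn : 1 ≤ n) {lam Lam p : ℝ}
    (hlam : 0 < lam) (hlL : lam ≤ Lam) (hp : 0 ≤ p) :
    ∃ R M μ ε₀ : ℝ, 4 ≤ R ∧ 1 < M ∧ 0 < μ ∧ μ < 1 ∧ 0 < ε₀ ∧ ∀ u f : En n → ℝ,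
      ContinuousOn u (closedBall 0 R) → (∀ x ∈ closedBall 0 R, 0 ≤ u x) →
      ContinuousOn f (closedBall 0 R) → JetSuper lam Lam p (ball 0 R) u f →
      ∫⁻ x in ball 0 R, ENNReal.ofReal (|f x| ^ n) ≤ ENNReal.ofReal ε₀ →
      (∃ x₀ ∈ ball 0 1, u x₀ ≤ 1) →
      ENNReal.ofReal μ * volume (ball (0 : En n) 1) ≤
        volume (ball (0 : En n) 1 ∩ {x | u x ≤ M}) := by
  obtain ⟨R, M, c, hR, hM, hc, H⟩ := exists_barrier_parameters hn hlam hlL hp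
  set v := (volume (ball (0 : En n) 1)).toReal with hv
  have hvt : volume (ball (0 : En n) 1) ≠ ⊤ := measure_ball_lt_top.ne
  have hv0 : 0 < v := ENNReal.toReal_pos (measure_ball_pos volume _ one_pos).ne' hvt
  set C := 2 ^ (n - 1) * c ^ n with hC
  have hC0 : 0 < C := by positivity
  have hcC : c ^ n ≤ C := by
    rw [hC]
    exact le_mul_of_one_le_left (by positivity) (one_le_pow₀ (by norm_num))
  refine ⟨R, M, min (1 / 2) (1 / (2 * 2 ^ n * C)), v / (4 * 2 ^ n * C), hR, hM, by positivity,
    (min_le_left _ _).trans_lt (by norm_num), by positivity,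
    fun u f hu hu0 hf hJ hI hx => ?_⟩
  have h1 := H u f hu hu0 hf hJ hx
  set A := ball (0 : En n) 1 ∩ {x | u x ≤ M} with hA
  have hA1 : A ⊆ ball (0 : En n) R := inter_subset_left.trans (ball_subset_ball (by linarith))
  have hAt : volume A ≠ ⊤ := measure_ne_top_of_subset inter_subset_left hvt
  have e1 : (∫⁻ x in ball (0 : En n) R, ENNReal.ofReal ((c * |f x|) ^ n)) ≤
      ENNReal.ofReal C * ∫⁻ x in ball 0 R, ENNReal.ofReal (|f x| ^ n) := by
    rw [← lintegral_const_mul' _ _ ENNReal.ofReal_ne_top]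
    refine lintegral_mono fun x => ?_
    simp only
    rw [← ENNReal.ofReal_mul hC0.le, mul_pow]
    gcongr
  have e2 : (∫⁻ x in A, ENNReal.ofReal ((c * (|f x| + 1)) ^ n)) ≤
      ENNReal.ofReal C * ((∫⁻ x in ball 0 R, ENNReal.ofReal (|f x| ^ n)) + volume A) := by
    calc _ ≤ ∫⁻ x in A, ENNReal.ofReal C * (ENNReal.ofReal (|f x| ^ n) + 1) := by
          refine lintegral_mono fun x => ?_
          simp only
          rw [← ENNReal.ofReal_one, ← ENNReal.ofReal_add (by positivity) zero_le_one,
            ← ENNReal.ofReal_mul hC0.le, mul_pow]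
          refine ENNReal.ofReal_le_ofReal ?_
          have := add_pow_le (abs_nonneg (f x)) zero_le_one n
          rw [one_pow] at this
          rw [hC, mul_assoc, mul_left_comm]
          gcongr
      _ = ENNReal.ofReal C * ((∫⁻ x in A, ENNReal.ofReal (|f x| ^ n)) + volume A) := by
          rw [lintegral_const_mul' _ _ ENNReal.ofReal_ne_top, lintegral_add_right _ measurable_const,
            setLIntegral_const, one_mul]
      _ ≤ _ := by
          gcongr
  have e3 : volume (ball (0 : En n) (1 / 2)) = ENNReal.ofReal (v / 2 ^ n) := by
    rw [Measure.addHaar_ball_of_pos _ _ (by norm_num), finrank_euclideanSpace_fin, hv,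
      div_eq_mul_inv _ ((2 : ℝ) ^ n), mul_comm _ ((2 : ℝ) ^ n)⁻¹,
      ENNReal.ofReal_mul (by positivity), ENNReal.ofReal_toReal hvt]
    simp
  set a := (volume A).toReal with ha
  have ha' : volume A = ENNReal.ofReal a := (ENNReal.ofReal_toReal hAt).symm
  have hv' : volume (ball (0 : En n) 1) = ENNReal.ofReal v := (ENNReal.ofReal_toReal hvt).symm
  have ha0 : 0 ≤ a := ENNReal.toReal_nonneg
  have h2 : ENNReal.ofReal (v / 2 ^ n) ≤
      ENNReal.ofReal (C * (v / (4 * 2 ^ n * C)) + C * (v / (4 * 2 ^ n * C) + a)) := by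
    rw [← e3]
    refine h1.trans ((add_le_add e1 e2).trans ?_)
    rw [ENNReal.ofReal_add (by positivity) (by positivity), ENNReal.ofReal_mul hC0.le,
      ENNReal.ofReal_mul hC0.le, ENNReal.ofReal_add (by positivity) ha0, ← ha']
    gcongr
  rw [ENNReal.ofReal_le_ofReal_iff (by positivity)] at h2
  rw [ha', hv', ← ENNReal.ofReal_mul (by positivity)]
  refine ENNReal.ofReal_le_ofReal ?_
  have h3 : C * (v / (4 * 2 ^ n * C)) = v / 2 ^ n / 4 := by field_simp
  have h4 : v / 2 ^ n / 2 ≤ C * a := by rw [mul_add, h3] at h2; linarith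
  calc _ ≤ 1 / (2 * 2 ^ n * C) * v := by gcongr; exact min_le_right _ _
    _ = v / 2 ^ n / 2 / C := by field_simp
    _ ≤ a := by rw [div_le_iff₀ hC0, mul_comm]; exact h4

/-- A covering estimate: if every point of `E` lies in a ball contained in `F` that meets the
complement of `E` in a fixed proportion, then `F \ E` is comparable to `E`. -/
theorem volume_le_of_balls {n : ℕ} {E F : Set (En n)} {γ : ENNReal} (hE : MeasurableSet E)
    (h : ∀ x ∈ E, ∃ y t, 0 < t ∧ t ≤ 1 ∧ x ∈ ball y t ∧ ball y t ⊆ F ∧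
      γ * volume (ball y t) ≤ volume (ball y t \ E)) :
    γ * volume E ≤ 5 ^ n * volume (F \ E) := by
  choose! y t ht ht1 hx hF hγ using h
  obtain ⟨S, hSE, hdisj, hcov⟩ := Vitali.exists_disjoint_subfamily_covering_enlargement_closedBall
    E y t 1 ht1 5 (by norm_num)
  have hcount : S.Countable := hdisj.countable_of_nonempty_interior fun a ha =>
    ⟨y a, ball_subset_interior_closedBall (mem_ball_self (ht a (hSE ha)))⟩
  have := hcount.to_subtype
  have hdisj' : Pairwise (Function.onFun Disjoint fun a : S => ball (y a) (t a) \ E) := by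
    intro a b hab
    exact (hdisj a.2 b.2 (fun h => hab (Subtype.ext h))).mono
      (sdiff_subset.trans ball_subset_closedBall) (sdiff_subset.trans ball_subset_closedBall)
  calc γ * volume E ≤ γ * volume (⋃ a : S, closedBall (y a) (5 * t a)) := by
        gcongr
        intro x hxE
        obtain ⟨b, hb, hsub⟩ := hcov x hxE
        exact mem_iUnion.2 ⟨⟨b, hb⟩, hsub (ball_subset_closedBall (hx x hxE))⟩
    _ ≤ γ * ∑' a : S, volume (closedBall (y a) (5 * t a)) := by
        gcongr
        exact measure_iUnion_le _
    _ = 5 ^ n * ∑' a : S, γ * volume (ball (y a) (t a)) := by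
        rw [← ENNReal.tsum_mul_left, ← ENNReal.tsum_mul_left]
        refine tsum_congr fun a => ?_
        have h0 := ht a (hSE a.2)
        rw [Measure.addHaar_closedBall _ _ (by positivity), Measure.addHaar_ball_of_pos _ _ h0,
          finrank_euclideanSpace_fin, mul_pow, ENNReal.ofReal_mul (by positivity),
          ENNReal.ofReal_pow (by norm_num)]
        simp only [ENNReal.ofReal_ofNat]
        ring
    _ ≤ 5 ^ n * ∑' a : S, volume (ball (y a) (t a) \ E) := by
        gcongr with a
        exact hγ a (hSE a.2)
    _ = 5 ^ n * volume (⋃ a : S, ball (y a) (t a) \ E) := by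
        rw [measure_iUnion hdisj' fun a => measurableSet_ball.diff hE]
    _ ≤ 5 ^ n * volume (F \ E) := by
        gcongr
        exact iUnion_subset fun a => sdiff_subset_sdiff_left (hF a (hSE a.2))

theorem exists_one_lt_pow_eq {n : ℕ} (hn : 1 ≤ n) {b : ℝ} (hb : 1 < b) :
    ∃ c : ℝ, 1 < c ∧ c ^ n = b :=
  ⟨b ^ ((n : ℝ)⁻¹), Real.one_lt_rpow hb (by positivity),
    Real.rpow_inv_natCast_pow (by positivity) (by omega)⟩

/-- Growing balls around a point of an open set until its density drops. -/
theorem exists_ball_critical_density {n : ℕ} (hn : 1 ≤ n) {E : Set (En n)} {μ : ℝ} (hμ : 0 < μ)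
    (hE : IsOpen E) (hE1 : ENNReal.ofReal μ * volume (ball (0 : En n) 1) ≤
      volume (ball (0 : En n) 1 \ E)) {x : En n} (hx : x ∈ E) (hx1 : x ∈ ball (0 : En n) 1) :
    ∃ t, 0 < t ∧ t ≤ 1 ∧
      volume (ball ((1 - t) • x) t \ E) < ENNReal.ofReal μ * volume (ball ((1 - t) • x) t) ∧
      ENNReal.ofReal (μ / 2) * volume (ball ((1 - t) • x) t) ≤
        volume (ball ((1 - t) • x) t \ E) := by
  obtain ⟨c, hc1, hc⟩ := exists_one_lt_pow_eq hn (b := 1 + μ / 2) (by linarith)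
  have hc0 : 0 < c := by linarith
  obtain ⟨r, hr, hrE⟩ := Metric.isOpen_iff.1 hE x hx
  rw [mem_ball_zero_iff] at hx1
  set P : ℕ → Prop := fun j => volume (ball ((1 - (c⁻¹) ^ j) • x) ((c⁻¹) ^ j) \ E) <
    ENNReal.ofReal μ * volume (ball ((1 - (c⁻¹) ^ j) • x) ((c⁻¹) ^ j)) with hP
  have hex : ∃ j, P j := by
    obtain ⟨j, hj⟩ := exists_pow_lt_of_lt_one (half_pos hr) (inv_lt_one_of_one_lt₀ hc1)
    refine ⟨j, ?_⟩
    have h0 : 0 < (c⁻¹) ^ j := by positivity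
    rw [hP]
    have h1 : ball ((1 - (c⁻¹) ^ j) • x) ((c⁻¹) ^ j) \ E = ∅ := by
      rw [sdiff_eq_empty]
      refine (ball_subset_ball' ?_).trans hrE
      rw [dist_eq_norm, sub_smul, one_smul, sub_sub_cancel_left, norm_neg, norm_smul,
        Real.norm_of_nonneg h0.le]
      nlinarith
    simp only [h1, measure_empty]
    exact ENNReal.mul_pos (by simpa using hμ) (measure_ball_pos volume _ h0).ne'
  classical
  obtain ⟨j, hj, hmin⟩ : ∃ j, P j ∧ ∀ i < j, ¬ P i :=
    ⟨Nat.find hex, Nat.find_spec hex, fun i hi => Nat.find_min hex hi⟩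
  have hj0 : j ≠ 0 := by
    rintro rfl
    refine not_lt_of_ge hE1 ?_
    simpa [hP] using hj
  obtain ⟨i, rfl⟩ := Nat.exists_eq_succ_of_ne_zero hj0
  set t := (c⁻¹) ^ (i + 1) with ht
  have ht0 : 0 < t := by positivity
  have hct : (c⁻¹) ^ i = c * t := by rw [ht, pow_succ]; field_simp
  refine ⟨t, ht0, pow_le_one₀ (by positivity) (inv_le_one_of_one_le₀ hc1.le), hj, ?_⟩
  have hi := hmin i (Nat.lt_succ_self i)
  simp only [hP, not_lt, hct] at hi
  set B := ball ((1 - t) • x) t with hB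
  set B' := ball ((1 - c * t) • x) (c * t) with hB'
  have hBB' : B ⊆ B' := by
    refine ball_subset_ball' ?_
    rw [dist_eq_norm, ← sub_smul, norm_smul]
    have h1 : (1 - t - (1 - c * t)) = (c - 1) * t := by ring
    rw [h1, Real.norm_of_nonneg (mul_nonneg (by linarith) ht0.le)]
    have : 0 < (c - 1) * t := mul_pos (by linarith) ht0
    nlinarith
  have hvol : volume B' = ENNReal.ofReal (1 + μ / 2) * volume B := by
    rw [hB, hB', Measure.addHaar_ball_of_pos _ _ ht0, Measure.addHaar_ball_of_pos _ _ (by positivity),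
      finrank_euclideanSpace_fin, mul_pow, hc, ENNReal.ofReal_mul (by positivity), mul_assoc]
  have hBt : volume B ≠ ⊤ := measure_ball_lt_top.ne
  have h3 : volume (B' \ B) = ENNReal.ofReal (μ / 2) * volume B := by
    rw [measure_sdiff hBB' measurableSet_ball.nullMeasurableSet hBt, hvol,
      ENNReal.ofReal_add zero_le_one (by positivity), add_mul, ENNReal.ofReal_one, one_mul,
      ENNReal.add_sub_cancel_left hBt]
  have h4 : volume (B' \ E) ≤ volume (B \ E) + ENNReal.ofReal (μ / 2) * volume B := by
    rw [← h3]
    refine (measure_mono fun z hz => ?_).trans (measure_union_le _ _)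
    by_cases hzB : z ∈ B
    · exact Or.inl ⟨hzB, hz.2⟩
    · exact Or.inr ⟨hz.1, hzB⟩
  have h5 : ENNReal.ofReal (μ / 2) * volume B + ENNReal.ofReal (μ / 2) * volume B ≤
      volume (B \ E) + ENNReal.ofReal (μ / 2) * volume B := by
    rw [← add_mul, ← ENNReal.ofReal_add (by positivity) (by positivity), add_halves]
    exact (mul_le_mul_right (measure_mono hBB') _).trans (hi.trans h4)
  exact (ENNReal.add_le_add_iff_right (ENNReal.mul_ne_top ENNReal.ofReal_ne_top hBt)).1 h5

theorem Dp_smul {n : ℕ} {p c : ℝ} (hc : 0 ≤ c) (z : Fin n → ℝ) :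
    Dp p (c • z) = c ^ (p / 2) • Dp p z := by
  unfold Dp
  rw [← Matrix.diagonal_smul]
  congr 1
  ext i
  simp only [Pi.smul_apply, smul_eq_mul]
  rw [abs_mul, abs_of_nonneg hc, Real.mul_rpow hc (abs_nonneg _)]

/-- Scaling of supersolutions to a smaller ball and a larger threshold. -/
theorem JetSuper.rescale {n : ℕ} {lam Lam p : ℝ} (hLam : 0 ≤ Lam)
    {Ω Ω' : Set (En n)} {u f : En n → ℝ} (hJ : JetSuper lam Lam p Ω u f) {x₀ : En n} {r m c : ℝ}
    (hr : 0 < r) (hr1 : r ≤ 1) (hm : 0 < m) (hΩ : ∀ x ∈ Ω', x₀ + r • x ∈ Ω) :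
    JetSuper lam Lam p Ω' (fun x => (u (x₀ + r • x) - c) / m)
      (fun x => r ^ (p + 2) / m ^ (p + 1) * f (x₀ + r • x)) := by
  intro x hx z X hX hjet
  have hev : ∀ᶠ h in nhds (0 : En n), u (x₀ + r • x) + inner ℝ ((m / r) • z) h +
      1 / 2 * inner ℝ (Matrix.toEuclideanCLM (𝕜 := ℝ) ((m / r ^ 2) • X) h) h
        ≤ u (x₀ + r • x + h) := by
    have ht : Filter.Tendsto (fun h : En n => r⁻¹ • h) (nhds 0) (nhds 0) := by
      have : ContinuousAt (fun h : En n => r⁻¹ • h) 0 := by fun_prop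
      simpa [ContinuousAt] using this
    filter_upwards [ht.eventually hjet] with h hh
    have e1 : x₀ + r • (x + r⁻¹ • h) = x₀ + r • x + h := by
      rw [smul_add, smul_inv_smul₀ hr.ne', add_assoc]
    rw [e1, le_div_iff₀ hm] at hh
    rw [map_smul, inner_smul_right, inner_smul_left, inner_smul_right] at hh
    rw [map_smul, _root_.smul_apply, inner_smul_left, inner_smul_left]
    simp only [conj_trivial] at hh ⊢
    have e2 : ((u (x₀ + r • x) - c) / m + r⁻¹ * inner ℝ z h + 1 / 2 * (r⁻¹ * (r⁻¹ *
        inner ℝ (Matrix.toEuclideanCLM (𝕜 := ℝ) X h) h))) * m =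
        u (x₀ + r • x) - c + m / r * inner ℝ z h +
        1 / 2 * (m / r ^ 2 * inner ℝ (Matrix.toEuclideanCLM (𝕜 := ℝ) X h) h) := by
      field_simp
    rw [e2] at hh
    linarith
  obtain ⟨A, hA, htr⟩ := hJ _ (hΩ x hx) ((m / r) • z) ((m / r ^ 2) • X) (by
    rw [Matrix.IsHermitian, Matrix.conjTranspose_smul, hX.eq, star_trivial]) hev
  refine ⟨A, hA, ?_⟩
  have hmr : 0 < m / r := by positivity
  have e0 : (m / r) ^ p * (m / r ^ 2) = m ^ (p + 1) / r ^ (p + 2) := by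
    rw [Real.div_rpow hm.le hr.le, Real.rpow_add_one hm.ne', Real.rpow_add hr, Real.rpow_two]
    field_simp
  have e1 : A * (Dp p ((m / r) • z).ofLp * ((m / r ^ 2) • X) * Dp p ((m / r) • z).ofLp) =
      (m ^ (p + 1) / r ^ (p + 2)) • (A * (Dp p z.ofLp * X * Dp p z.ofLp)) := by
    rw [WithLp.ofLp_smul, Dp_smul hmr.le, ← e0]
    simp only [Matrix.smul_mul, Matrix.mul_smul, smul_smul]
    congr 1
    have : (m / r) ^ p = (m / r) ^ (p / 2) * (m / r) ^ (p / 2) := by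
      rw [← Real.rpow_add hmr, add_halves]
    rw [this]
    ring
  rw [e1, Matrix.trace_smul, smul_eq_mul, norm_smul, Real.norm_of_nonneg hmr.le,
    Real.mul_rpow hmr.le (norm_nonneg _), div_mul_eq_mul_div, div_le_iff₀ (by positivity)] at htr
  have e2 : (m / r) ^ (p + 1) * r ^ (p + 2) = m ^ (p + 1) * r := by
    rw [Real.div_rpow hm.le hr.le, show p + 2 = p + 1 + 1 by ring, Real.rpow_add_one hr.ne' (p + 1)]
    field_simp
  have e3 : 0 < m ^ (p + 1) := by positivity
  have e4 : Lam * ((m / r) ^ (p + 1) * ‖z‖ ^ (p + 1)) * r ^ (p + 2)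
      ≤ m ^ (p + 1) * (Lam * ‖z‖ ^ (p + 1)) := by
    calc _ = m ^ (p + 1) * (Lam * ‖z‖ ^ (p + 1)) * r := by linear_combination (Lam * ‖z‖ ^ (p + 1)) * e2
      _ ≤ _ := mul_le_of_le_one_right (by positivity) hr1
  simp only
  rw [div_mul_eq_mul_div, ← sub_le_iff_le_add, le_div_iff₀ e3]
  rw [add_mul] at htr
  linarith

theorem preimage_add_smul_ball {n : ℕ} (x₀ : En n) {r : ℝ} (hr : 0 < r) (ρ : ℝ) :
    (fun x : En n => x₀ + r • x) ⁻¹' ball x₀ (r * ρ) = ball 0 ρ := by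
  ext x
  simp only [mem_preimage, mem_ball, dist_eq_norm, add_sub_cancel_left, sub_zero, norm_smul,
    Real.norm_of_nonneg hr.le]
  exact mul_lt_mul_iff_right₀ hr

theorem lintegral_comp_add_smul {n : ℕ} (g : En n → ENNReal) (x₀ : En n) {r : ℝ} (hr : 0 < r)
    (ρ : ℝ) : ENNReal.ofReal (r ^ n) * ∫⁻ x in ball (0 : En n) ρ, g (x₀ + r • x) =
      ∫⁻ x in ball x₀ (r * ρ), g x := by
  have h1 : (fun x : En n => x₀ + r • x) '' ball 0 ρ = ball x₀ (r * ρ) := by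
    rw [← preimage_add_smul_ball x₀ hr ρ]
    refine image_preimage_eq _ fun y => ⟨r⁻¹ • (y - x₀), ?_⟩
    simp only [smul_inv_smul₀ hr.ne', add_sub_cancel]
  have h2 : ∀ x ∈ ball (0 : En n) ρ, HasFDerivWithinAt (fun x => x₀ + r • x)
      (r • ContinuousLinearMap.id ℝ (En n)) (ball 0 ρ) x := fun x _ =>
    (((hasFDerivAt_id x).const_smul r).const_add x₀).hasFDerivWithinAt
  rw [← h1, lintegral_image_eq_lintegral_abs_det_fderiv_mul volume measurableSet_ball h2
    (fun x _ y _ h => smul_right_injective _ hr.ne' (add_left_cancel h)),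
    ← lintegral_const_mul' _ _ ENNReal.ofReal_ne_top]
  refine lintegral_congr fun x => ?_
  rw [ContinuousLinearMap.det, ContinuousLinearMap.toLinearMap_smul, LinearMap.det_smul,
    ContinuousLinearMap.coe_id, LinearMap.det_id, mul_one, finrank_euclideanSpace_fin,
    abs_of_pos (by positivity)]

/-- Scaling of the `Lⁿ` norm of the right-hand side. -/
theorem lintegral_rescale {n : ℕ} (p : ℝ) (f : En n → ℝ) (x₀ : En n) {r m : ℝ}
    (hr : 0 < r) (hm : 0 < m) (ρ : ℝ) :
    ENNReal.ofReal (((m / r) ^ (p + 1)) ^ n) * ∫⁻ x in ball (0 : En n) ρ,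
      ENNReal.ofReal (|r ^ (p + 2) / m ^ (p + 1) * f (x₀ + r • x)| ^ n) =
      ∫⁻ x in ball x₀ (r * ρ), ENNReal.ofReal (|f x| ^ n) := by
  rw [← lintegral_comp_add_smul _ _ hr, ← lintegral_const_mul' _ _ ENNReal.ofReal_ne_top,
    ← lintegral_const_mul' _ _ ENNReal.ofReal_ne_top]
  refine lintegral_congr fun x => ?_
  have h1 : 0 < m ^ (p + 1) := by positivity
  have h2 : 0 < r ^ (p + 1) := by positivity
  have h3 : r ^ (p + 2) = r ^ (p + 1) * r := by
    rw [← Real.rpow_add_one hr.ne']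
    ring_nf
  rw [← ENNReal.ofReal_mul (by positivity), ← ENNReal.ofReal_mul (by positivity), ← mul_pow,
    ← mul_pow, abs_mul, abs_of_nonneg (a := r ^ (p + 2) / m ^ (p + 1)) (by positivity),
    Real.div_rpow hm.le hr.le, h3]
  congr 2
  field_simp

open scoped Pointwise in
theorem volume_image_add_smul {n : ℕ} (x₀ : En n) {r : ℝ} (hr : 0 < r) (s : Set (En n)) :
    volume ((fun x => x₀ + r • x) '' s) = ENNReal.ofReal (r ^ n) * volume s := by
  have h : (fun x => x₀ + r • x) '' s = (fun y => -x₀ + y) ⁻¹' (r • s) := by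
    ext y
    simp only [mem_image, mem_preimage, Set.mem_smul_set]
    refine exists_congr fun x => and_congr_right fun _ => ?_
    rw [eq_neg_add_iff_add_eq]
  rw [h, measure_preimage_add, Measure.addHaar_smul, finrank_euclideanSpace_fin,
    abs_of_pos (by positivity)]

theorem add_smul_mem_ball {n : ℕ} {x₀ x : En n} {r ρ : ℝ} (hr : 0 < r) (hx : x ∈ ball 0 ρ) :
    x₀ + r • x ∈ ball x₀ (r * ρ) := by
  rw [mem_ball_zero_iff] at hx
  rw [mem_ball_iff_norm, add_sub_cancel_left, norm_smul, Real.norm_of_nonneg hr.le]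
  gcongr

theorem add_smul_mem_closedBall {n : ℕ} {x₀ x : En n} {r ρ : ℝ} (hr : 0 < r)
    (hx : x ∈ closedBall 0 ρ) : x₀ + r • x ∈ closedBall x₀ (r * ρ) := by
  rw [mem_closedBall_zero_iff] at hx
  rw [mem_closedBall_iff_norm, add_sub_cancel_left, norm_smul, Real.norm_of_nonneg hr.le]
  gcongr

/-- The growth lemma on a ball of radius at most `1`. -/
theorem exists_growth_ball {n : ℕ} (hn : 1 ≤ n) {lam Lam p : ℝ}
    (hlam : 0 < lam) (hlL : lam ≤ Lam) (hp : 0 ≤ p) :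
    ∃ R M μ ε₀ : ℝ, 4 ≤ R ∧ 1 < M ∧ 0 < μ ∧ μ < 1 ∧ 0 < ε₀ ∧
      ∀ (u f : En n → ℝ) (x₀ : En n) (r m : ℝ), 0 < r → r ≤ 1 → 1 ≤ m →
      ContinuousOn u (closedBall x₀ (r * R)) → (∀ x ∈ closedBall x₀ (r * R), 0 ≤ u x) →
      ContinuousOn f (closedBall x₀ (r * R)) → JetSuper lam Lam p (ball x₀ (r * R)) u f →
      ∫⁻ x in ball x₀ (r * R), ENNReal.ofReal (|f x| ^ n) ≤ ENNReal.ofReal ε₀ →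
      (∃ x₁ ∈ ball x₀ r, u x₁ ≤ m) →
      ENNReal.ofReal μ * volume (ball x₀ r) ≤ volume (ball x₀ r ∩ {x | u x ≤ M * m}) := by
  obtain ⟨R, M, μ, ε₀, hR, hM, hμ, hμ1, hε, H⟩ := exists_growth hn hlam hlL hp
  refine ⟨R, M, μ, ε₀, hR, hM, hμ, hμ1, hε, fun u f x₀ r m hr hr1 hm hu hu0 hf hJ hI hx => ?_⟩
  have hm0 : 0 < m := by linarith
  obtain ⟨x₁, hx₁, hux₁⟩ := hx
  have hmaps : MapsTo (fun x : En n => x₀ + r • x) (closedBall 0 R) (closedBall x₀ (r * R)) :=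
    fun x hx => add_smul_mem_closedBall hr hx
  have hcont : Continuous fun x : En n => x₀ + r • x := by fun_prop
  have key := H (fun x => (u (x₀ + r • x) - 0) / m)
    (fun x => r ^ (p + 2) / m ^ (p + 1) * f (x₀ + r • x))
    (((hu.comp hcont.continuousOn hmaps).sub continuousOn_const).div_const m)
    (fun x hx => div_nonneg (by rw [sub_zero]; exact hu0 _ (hmaps hx)) hm0.le)
    (continuousOn_const.mul (hf.comp hcont.continuousOn hmaps))
    (hJ.rescale (hlam.trans_le hlL).le hr hr1 hm0 fun x hx => add_smul_mem_ball hr hx)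
    (by
      refine le_trans ?_ ((lintegral_rescale p f x₀ hr hm0 R).le.trans hI)
      refine le_mul_of_one_le_left zero_le (ENNReal.one_le_ofReal.2 ?_)
      refine one_le_pow₀ (Real.one_le_rpow ?_ (by linarith))
      rw [one_le_div hr]
      exact hr1.trans hm)
    ⟨r⁻¹ • (x₁ - x₀), by
      rw [mem_ball_iff_norm] at hx₁
      rw [mem_ball_zero_iff, norm_smul, norm_inv, Real.norm_of_nonneg hr.le, inv_mul_lt_iff₀ hr,
        mul_one]
      exact hx₁, by
      rw [smul_inv_smul₀ hr.ne', add_sub_cancel, sub_zero, div_le_one hm0]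
      exact hux₁⟩
  have hrn : 0 < r ^ n := by positivity
  calc _ = ENNReal.ofReal (r ^ n) * (ENNReal.ofReal μ * volume (ball (0 : En n) 1)) := by
        rw [Measure.addHaar_ball_of_pos _ _ hr, finrank_euclideanSpace_fin]
        ring
    _ ≤ _ := by
        refine (mul_le_mul_right key _).trans ?_
        rw [← volume_image_add_smul x₀ hr]
        refine measure_mono ?_
        rintro _ ⟨x, ⟨hx, hxM⟩, rfl⟩
        refine ⟨by simpa using add_smul_mem_ball (x₀ := x₀) hr hx, ?_⟩
        simp only [mem_ofPred_eq, sub_zero] at hxM ⊢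
        rwa [div_le_iff₀ hm0] at hxM

/-- Geometric decay of the superlevel sets of a supersolution. -/
theorem exists_superlevel_decay {n : ℕ} (hn : 1 ≤ n) {lam Lam p : ℝ}
    (hlam : 0 < lam) (hlL : lam ≤ Lam) (hp : 0 ≤ p) :
    ∃ R M ρ ε₀ : ℝ, 4 ≤ R ∧ 1 < M ∧ 0 < ρ ∧ ρ < 1 ∧ 0 < ε₀ ∧ ∀ u f : En n → ℝ,
      ContinuousOn u (closedBall 0 R) → (∀ x ∈ closedBall 0 R, 0 ≤ u x) →
      ContinuousOn f (closedBall 0 R) → JetSuper lam Lam p (ball 0 R) u f →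
      ∫⁻ x in ball 0 R, ENNReal.ofReal (|f x| ^ n) ≤ ENNReal.ofReal ε₀ →
      (∃ x₀ ∈ ball 0 1, u x₀ ≤ 1) → ∀ k : ℕ,
      volume (ball (0 : En n) 1 ∩ {x | M ^ k < u x}) ≤
        ENNReal.ofReal (ρ ^ k) * volume (ball (0 : En n) 1) := by
  obtain ⟨R, M, μ, ε₀, hR, hM, hμ, hμ1, hε, H⟩ := exists_growth_ball hn hlam hlL hp
  refine ⟨R, M, 5 ^ n / (μ / 2 + 5 ^ n), ε₀, hR, hM, by positivity, ?_, hε,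
    fun u f hu hu0 hf hJ hI hx k => ?_⟩
  · rw [div_lt_one (by positivity)]
    linarith
  have hsub : ∀ (y : En n) (t : ℝ), ‖y‖ + t * R ≤ R → closedBall y (t * R) ⊆ closedBall 0 R :=
    fun y t h => closedBall_subset_closedBall' (by rw [dist_zero_right]; linarith)
  have hsub' : ∀ (y : En n) (t : ℝ), ‖y‖ + t * R ≤ R → ball y (t * R) ⊆ ball 0 R :=
    fun y t h => ball_subset_ball' (by rw [dist_zero_right]; linarith)
  have grow : ∀ (y : En n) (t : ℝ), 0 < t → t ≤ 1 → ‖y‖ + t * R ≤ R → ∀ k : ℕ,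
      (∃ x ∈ ball y t, u x ≤ M ^ k) →
      ENNReal.ofReal μ * volume (ball y t) ≤ volume (ball y t \ {x | M ^ (k + 1) < u x}) := by
    intro y t ht ht1 hy k hk
    refine (H u f y t (M ^ k) ht ht1 (one_le_pow₀ hM.le) (hu.mono (hsub y t hy))
      (fun x hx => hu0 x (hsub y t hy hx)) (hf.mono (hsub y t hy))
      (fun x hx => hJ x (hsub' y t hy hx))
      ((lintegral_mono_set (hsub' y t hy)).trans hI) hk).trans (measure_mono fun x hx => ?_)
    refine ⟨hx.1, ?_⟩
    have := hx.2
    simp only [mem_ofPred_eq, not_lt] at this ⊢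
    rwa [pow_succ']
  have hopen : ∀ k : ℕ, IsOpen (ball (0 : En n) 1 ∩ {x | M ^ k < u x}) := fun k =>
    (hu.mono (ball_subset_closedBall.trans (closedBall_subset_closedBall
      (by linarith)))).isOpen_inter_preimage isOpen_ball (isOpen_Ioi (a := M ^ k))
  have hone : ∃ x ∈ ball (0 : En n) 1, u x ≤ M ^ 0 := by simpa using hx
  induction k with
  | zero => simpa using measure_mono inter_subset_left
  | succ k ih =>
    set E := ball (0 : En n) 1 ∩ {x | M ^ (k + 1) < u x} with hE
    set F := ball (0 : En n) 1 ∩ {x | M ^ k < u x} with hF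
    have hEF : E ⊆ F := inter_subset_inter_right _ fun x (hx : _ < _) =>
      (pow_le_pow_right₀ hM.le (Nat.le_succ k)).trans_lt hx
    have hE1 : ENNReal.ofReal μ * volume (ball (0 : En n) 1) ≤
        volume (ball (0 : En n) 1 \ E) := by
      refine (grow 0 1 one_pos le_rfl (by simp) 0 hone).trans (measure_mono ?_)
      refine sdiff_subset_sdiff_right fun x hx => ?_
      have : M ^ (k + 1) < u x := hx.2
      exact (pow_le_pow_right₀ hM.le (by omega)).trans_lt this
    have hcov := volume_le_of_balls (F := F) (γ := ENNReal.ofReal (μ / 2))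
      (hopen (k + 1)).measurableSet fun x hxE => by
        obtain ⟨t, ht, ht1, hlt, hle⟩ := exists_ball_critical_density hn hμ (hopen (k + 1)) hE1
          hxE hxE.1
        have hx1 : ‖x‖ < 1 := mem_ball_zero_iff.1 hxE.1
        have hyn : ‖(1 - t) • x‖ ≤ 1 - t := by
          rw [norm_smul, Real.norm_of_nonneg (by linarith)]
          exact mul_le_of_le_one_right (by linarith) hx1.le
        have hB1 : ball ((1 - t) • x) t ⊆ ball 0 1 :=
          ball_subset_ball' (by rw [dist_zero_right]; linarith)
        refine ⟨(1 - t) • x, t, ht, ht1, ?_, fun y hy => ?_, hle⟩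
        · rw [mem_ball_iff_norm, sub_smul, one_smul, sub_sub_cancel, norm_smul,
            Real.norm_of_nonneg ht.le]
          exact mul_lt_of_lt_one_right ht hx1
        · refine ⟨hB1 hy, ?_⟩
          by_contra hcon
          simp only [mem_ofPred_eq, not_lt] at hcon
          refine not_lt_of_ge (grow _ t ht ht1 (by nlinarith) k ⟨y, hy, hcon⟩) ?_
          refine lt_of_le_of_lt (measure_mono ?_) hlt
          exact sdiff_subset_sdiff_right inter_subset_right
    have hEt : volume E ≠ ⊤ :=
      measure_ne_top_of_subset inter_subset_left measure_ball_lt_top.ne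
    have hFE : volume E + volume (F \ E) = volume F := by
      have := measure_inter_add_sdiff (μ := volume) F (hopen (k + 1)).measurableSet
      rwa [← hE, inter_eq_right.2 hEF] at this
    have h1 : (ENNReal.ofReal (μ / 2) + 5 ^ n) * volume E ≤ 5 ^ n * volume F := by
      rw [← hFE, add_mul, mul_add, add_comm]
      gcongr
    have h2 : ENNReal.ofReal (μ / 2) + 5 ^ n = ENNReal.ofReal (μ / 2 + 5 ^ n) := by
      rw [ENNReal.ofReal_add (by positivity) (by positivity), ENNReal.ofReal_pow (by norm_num)]
      simp
    have h3 : (5 : ENNReal) ^ n = ENNReal.ofReal (μ / 2 + 5 ^ n) *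
        ENNReal.ofReal (5 ^ n / (μ / 2 + 5 ^ n)) := by
      rw [← ENNReal.ofReal_mul (by positivity), mul_div_cancel₀ _ (by positivity),
        ENNReal.ofReal_pow (by norm_num)]
      simp
    rw [h2, h3, mul_assoc] at h1
    have h4 := (ENNReal.mul_le_mul_iff_right (by simp; positivity) ENNReal.ofReal_ne_top).1 h1
    refine h4.trans ?_
    rw [pow_succ', ENNReal.ofReal_mul (by positivity), mul_assoc]
    gcongr

/-- **Measure-to-pointwise estimate**. -/
theorem exists_lower_bound {n : ℕ} (hn : 1 ≤ n) {lam Lam p : ℝ}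
    (hlam : 0 < lam) (hlL : lam ≤ Lam) (hp : 0 ≤ p) :
    ∃ R θ ε₁ : ℝ, 4 ≤ R ∧ 0 < θ ∧ θ < 1 ∧ 0 < ε₁ ∧ ∀ u f : En n → ℝ,
      ContinuousOn u (closedBall 0 R) → (∀ x ∈ closedBall 0 R, 0 ≤ u x) →
      ContinuousOn f (closedBall 0 R) → JetSuper lam Lam p (ball 0 R) u f →
      ∫⁻ x in ball 0 R, ENNReal.ofReal (|f x| ^ n) ≤ ENNReal.ofReal ε₁ →
      ENNReal.ofReal (1 / 2) * volume (ball (0 : En n) 1) ≤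
        volume (ball (0 : En n) 1 ∩ {x | 1 ≤ u x}) → ∀ x ∈ ball 0 1, θ ≤ u x := by
  obtain ⟨R, M, ρ, ε₀, hR, hM, hρ, hρ1, hε, H⟩ := exists_superlevel_decay hn hlam hlL hp
  obtain ⟨k, hk⟩ := exists_pow_lt_of_lt_one (by norm_num : (0 : ℝ) < 1 / 2) hρ1
  have hMk : 1 ≤ M ^ k := one_le_pow₀ hM.le
  set θ := 1 / (2 * M ^ k) with hθ
  have hθ0 : 0 < θ := by positivity
  refine ⟨R, θ, (θ ^ (p + 1)) ^ n * ε₀, hR, hθ0, ?_, by positivity,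
    fun u f hu hu0 hf hJ hI hvol x hx => ?_⟩
  · rw [hθ, div_lt_one (by positivity)]
    linarith
  by_contra! hlt
  have hcont : Continuous fun x : En n => (0 : En n) + (1 : ℝ) • x := by fun_prop
  have hmaps : MapsTo (fun x : En n => 0 + (1 : ℝ) • x) (closedBall 0 R) (closedBall 0 R) :=
    fun x hx => by simpa using hx
  have key := H (fun x => (u (0 + (1 : ℝ) • x) - 0) / θ)
    (fun x => 1 ^ (p + 2) / θ ^ (p + 1) * f (0 + (1 : ℝ) • x))
    (((hu.comp hcont.continuousOn hmaps).sub continuousOn_const).div_const θ)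
    (fun x hx => div_nonneg (by rw [sub_zero]; exact hu0 _ (hmaps hx)) hθ0.le)
    (continuousOn_const.mul (hf.comp hcont.continuousOn hmaps))
    (hJ.rescale (hlam.trans_le hlL).le one_pos le_rfl hθ0 fun x hx => by simpa using hx)
    (by
      have h1 := lintegral_rescale p f 0 one_pos hθ0 R
      rw [one_mul, div_one] at h1
      have h2 := h1.le.trans hI
      rw [ENNReal.ofReal_mul (by positivity)] at h2
      exact (ENNReal.mul_le_mul_iff_right (by simp; positivity) ENNReal.ofReal_ne_top).1 h2)
    ⟨x, hx, by
      simp only [one_smul, zero_add, sub_zero]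
      rw [div_le_one hθ0]
      exact hlt.le⟩ k
  have hsub : ball (0 : En n) 1 ∩ {x | 1 ≤ u x} ⊆
      ball (0 : En n) 1 ∩ {x | M ^ k < (u (0 + (1 : ℝ) • x) - 0) / θ} := by
    refine inter_subset_inter_right _ fun y hy => ?_
    simp only [mem_ofPred_eq, one_smul, zero_add, sub_zero] at hy ⊢
    rw [lt_div_iff₀ hθ0, hθ]
    have : M ^ k * (1 / (2 * M ^ k)) = 1 / 2 := by field_simp
    linarith
  have h3 := hvol.trans ((measure_mono hsub).trans key)
  rw [ENNReal.mul_le_mul_iff_left (measure_ball_pos volume _ one_pos).ne'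
    measure_ball_lt_top.ne, ENNReal.ofReal_le_ofReal_iff (by positivity)] at h3
  linarith

/-- The quadratic function with gradient `z` and Hessian `X` at `x`. -/
def quadAt {n : ℕ} (x z : En n) (X : Matrix (Fin n) (Fin n) ℝ) (y : En n) : ℝ :=
  inner ℝ z (y - x) + 1 / 2 * inner ℝ (Matrix.toEuclideanCLM (𝕜 := ℝ) X (y - x)) (y - x)

theorem inner_toEuclideanCLM_symm {n : ℕ} {X : Matrix (Fin n) (Fin n) ℝ} (hX : X.IsHermitian)
    (h k : En n) : inner ℝ (Matrix.toEuclideanCLM (𝕜 := ℝ) X h) k =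
      inner ℝ h (Matrix.toEuclideanCLM (𝕜 := ℝ) X k) := by
  rw [← ContinuousLinearMap.adjoint_inner_right, ← ContinuousLinearMap.star_eq_adjoint, ← map_star,
    Matrix.star_eq_conjTranspose, hX.eq]

theorem hasFDerivAt_quadAt {n : ℕ} (x z : En n) {X : Matrix (Fin n) (Fin n) ℝ}
    (hX : X.IsHermitian) (y : En n) :
    HasFDerivAt (quadAt x z X)
      (innerSL ℝ (z + Matrix.toEuclideanCLM (𝕜 := ℝ) X (y - x))) y := by
  have h0 : HasFDerivAt (fun y : En n => y - x) (ContinuousLinearMap.id ℝ (En n)) y :=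
    (hasFDerivAt_id y).sub_const x
  have h1 := (Matrix.toEuclideanCLM (𝕜 := ℝ) X).hasFDerivAt.comp y h0
  refine (((innerSL ℝ z).hasFDerivAt.comp y h0).add
    ((h1.inner ℝ h0).const_mul (1 / 2))).congr_fderiv ?_
  ext k
  have h2 := inner_toEuclideanCLM_symm hX (y - x) k
  have h3 := real_inner_comm (y - x) (Matrix.toEuclideanCLM (𝕜 := ℝ) X k)
  have h4 : (innerSL ℝ (z + Matrix.toEuclideanCLM (𝕜 := ℝ) X (y - x))) k =
      inner ℝ z k + inner ℝ (Matrix.toEuclideanCLM (𝕜 := ℝ) X (y - x)) k :=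
    (innerSL_apply_apply ..).trans (inner_add_left ..)
  have h5 : (fderivInnerCLM ℝ (Matrix.toEuclideanCLM (𝕜 := ℝ) X (y - x), y - x))
      (Matrix.toEuclideanCLM (𝕜 := ℝ) X k, k) =
      inner ℝ (Matrix.toEuclideanCLM (𝕜 := ℝ) X (y - x)) k +
        inner ℝ (Matrix.toEuclideanCLM (𝕜 := ℝ) X k) (y - x) := fderivInnerCLM_apply ..
  rw [h4]
  change inner ℝ z k + 1 / 2 * (fderivInnerCLM ℝ (Matrix.toEuclideanCLM (𝕜 := ℝ) X (y - x), y - x))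
      (Matrix.toEuclideanCLM (𝕜 := ℝ) X k, k) = _
  rw [h5]
  linarith

theorem contDiff_quadAt {n : ℕ} (x z : En n) (X : Matrix (Fin n) (Fin n) ℝ) :
    ContDiff ℝ 2 (quadAt x z X) := by
  unfold quadAt
  have h0 : ContDiff ℝ 2 fun y : En n => y - x := contDiff_id.sub contDiff_const
  exact (contDiff_const.inner ℝ h0).add
    (contDiff_const.mul (((Matrix.toEuclideanCLM (𝕜 := ℝ) X).contDiff.comp h0).inner ℝ h0))

theorem gradVec_quadAt {n : ℕ} (x z : En n) {X : Matrix (Fin n) (Fin n) ℝ}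
    (hX : X.IsHermitian) : gradVec (quadAt x z X) x = z.ofLp := by
  ext i
  rw [gradVec, (hasFDerivAt_quadAt x z hX x).fderiv]
  simp [EuclideanSpace.inner_single_right]

theorem hessMat_quadAt {n : ℕ} (x z : En n) {X : Matrix (Fin n) (Fin n) ℝ}
    (hX : X.IsHermitian) : hessMat (quadAt x z X) x = X := by
  ext i j
  rw [hessMat, Matrix.of_apply]
  have h1 : (fun y => fderiv ℝ (quadAt x z X) y (EuclideanSpace.single j 1)) = fun y =>
      inner ℝ (z + Matrix.toEuclideanCLM (𝕜 := ℝ) X (y - x)) (EuclideanSpace.single j 1) := by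
    ext y
    rw [(hasFDerivAt_quadAt x z hX y).fderiv]
    rfl
  have h0 : HasFDerivAt (fun y : En n => y - x) (ContinuousLinearMap.id ℝ (En n)) x :=
    (hasFDerivAt_id x).sub_const x
  have h2 : HasFDerivAt (fun y : En n => (inner ℝ (z + Matrix.toEuclideanCLM (𝕜 := ℝ) X (y - x))
      (EuclideanSpace.single j 1) : ℝ)) _ x :=
    (((Matrix.toEuclideanCLM (𝕜 := ℝ) X).hasFDerivAt.comp x h0).const_add z).inner ℝ
      (hasFDerivAt_const (EuclideanSpace.single j (1 : ℝ)) x)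
  have h3 := hX.apply i j
  rw [h1, h2.fderiv, ← h3]
  simp [EuclideanSpace.inner_single_right]

theorem vnorm_ofLp {n : ℕ} (z : En n) : vnorm z.ofLp = ‖z‖ := by
  rw [vnorm, EuclideanSpace.norm_eq]
  simp

theorem isHermitian_Dp_mul_mul {n : ℕ} (p : ℝ) (z : Fin n → ℝ) {X : Matrix (Fin n) (Fin n) ℝ}
    (hX : X.IsHermitian) : (Dp p z * X * Dp p z).IsHermitian := by
  have h1 : (Dp p z).conjTranspose = Dp p z := by
    rw [Dp, Matrix.diagonal_conjTranspose]
    rfl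
  rw [Matrix.IsHermitian, Matrix.conjTranspose_mul, Matrix.conjTranspose_mul, h1, hX.eq, mul_assoc]

theorem tendsto_sub_nhds_zero {n : ℕ} (x : En n) (s : Set (En n)) :
    Filter.Tendsto (fun y => y - x) (nhdsWithin x s) (nhds 0) := by
  have : ContinuousAt (fun y : En n => y - x) x := by fun_prop
  rw [ContinuousAt, sub_self] at this
  exact this.mono_left nhdsWithin_le_nhds

theorem IsViscSuper.jetSuper {n : ℕ} {lam Lam p : ℝ} (hl : lam ≤ Lam) {Ω : Set (En n)}
    {u f : En n → ℝ} (h : IsViscSuper lam Lam p Ω u f) : JetSuper lam Lam p Ω u f := by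
  intro x hx z X hX hjet
  have h1 := h x hx (quadAt x z X) (contDiff_quadAt x z X).contDiffOn (by
    filter_upwards [(tendsto_sub_nhds_zero x Ω).eventually hjet] with y hy
    rw [add_sub_cancel] at hy
    simp only [quadAt, sub_self, inner_zero_right, mul_zero, add_zero]
    linarith)
  rw [gradVec_quadAt x z hX, hessMat_quadAt x z hX, vnorm_ofLp] at h1
  obtain ⟨A, hA, hAe⟩ := exists_ellMat_pucciInf hl (isHermitian_Dp_mul_mul p z.ofLp hX)
  exact ⟨A, hA, by linarith⟩

theorem IsViscSub.jetSuper_neg {n : ℕ} {lam Lam p : ℝ} (hl : lam ≤ Lam) {Ω : Set (En n)}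
    {u f : En n → ℝ} (h : IsViscSub lam Lam p Ω u f) :
    JetSuper lam Lam p Ω (fun x => -u x) (fun x => -f x) := by
  intro x hx z X hX hjet
  have h1 := h x hx (quadAt x (-z) (-X)) (contDiff_quadAt x (-z) (-X)).contDiffOn (by
    filter_upwards [(tendsto_sub_nhds_zero x Ω).eventually hjet] with y hy
    rw [add_sub_cancel] at hy
    simp only [quadAt, sub_self, inner_zero_right, mul_zero, add_zero, map_neg,
      _root_.neg_apply, inner_neg_left]
    linarith)
  rw [gradVec_quadAt x (-z) hX.neg, hessMat_quadAt x (-z) hX.neg, vnorm_ofLp, norm_neg] at h1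
  have h2 : Dp p (-z).ofLp = Dp p z.ofLp := by
    unfold Dp
    simp
  obtain ⟨A, hA, hAe⟩ := exists_ellMat_pucciSup hl (isHermitian_Dp_mul_mul p z.ofLp hX.neg)
  rw [h2, ← hAe] at h1
  refine ⟨A, hA, ?_⟩
  simp only [mul_neg, neg_mul, Matrix.trace_neg] at h1
  linarith

theorem half_volume_ball_le {n : ℕ} {w : En n → ℝ} :
    ENNReal.ofReal (1 / 2) * volume (ball (0 : En n) 1) ≤
        volume (ball (0 : En n) 1 ∩ {x | 1 ≤ w x}) ∨
      ENNReal.ofReal (1 / 2) * volume (ball (0 : En n) 1) ≤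
        volume (ball (0 : En n) 1 ∩ {x | w x ≤ 1}) := by
  by_contra! h
  have h1 : volume (ball (0 : En n) 1) ≤ volume (ball (0 : En n) 1 ∩ {x | 1 ≤ w x}) +
      volume (ball (0 : En n) 1 ∩ {x | w x ≤ 1}) := by
    refine (measure_mono fun x hx => ?_).trans (measure_union_le _ _)
    rcases le_total 1 (w x) with h | h
    · exact Or.inl ⟨hx, h⟩
    · exact Or.inr ⟨hx, h⟩
  have h2 := ENNReal.add_lt_add h.1 h.2
  rw [← add_mul, ← ENNReal.ofReal_add (by norm_num) (by norm_num), add_halves,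
    ENNReal.ofReal_one, one_mul] at h2
  exact h1.not_gt h2

theorem exists_oscillation_decay {n : ℕ} (hn : 1 ≤ n) {lam Lam p : ℝ}
    (hlam : 0 < lam) (hlL : lam ≤ Lam) (hp : 0 ≤ p) :
    ∃ R θ ε : ℝ, 4 ≤ R ∧ 0 < θ ∧ θ < 1 ∧ 0 < ε ∧
      ∀ (u f : En n → ℝ) (x₀ : En n) (r a ω : ℝ), 0 < r → r ≤ 1 → 0 < ω →
      ContinuousOn u (closedBall x₀ (r * R)) → ContinuousOn f (closedBall x₀ (r * R)) →
      JetSuper lam Lam p (ball x₀ (r * R)) u f →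
      JetSuper lam Lam p (ball x₀ (r * R)) (fun x => -u x) (fun x => -f x) →
      (∀ x ∈ closedBall x₀ (r * R), a ≤ u x ∧ u x ≤ a + ω) →
      ∫⁻ x in ball x₀ (r * R), ENNReal.ofReal (|f x| ^ n) ≤
        ENNReal.ofReal ((((ω / 2) / r) ^ (p + 1)) ^ n * ε) →
      ∃ b, ∀ x ∈ ball x₀ r, b ≤ u x ∧ u x ≤ b + (1 - θ / 2) * ω := by
  obtain ⟨R, θ, ε, hR, hθ, hθ1, hε, H⟩ := exists_lower_bound (n := n) hn hlam hlL hp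
  refine ⟨R, θ, ε, hR, hθ, hθ1, hε,
    fun u f x₀ r a ω hr hr1 hω hu hf hJ hJ' hb hI => ?_⟩
  have hω2 : 0 < ω / 2 := by linarith
  have hmaps : MapsTo (fun x : En n => x₀ + r • x) (closedBall 0 R) (closedBall x₀ (r * R)) :=
    fun x hx => add_smul_mem_closedBall hr hx
  have hcont : Continuous fun x : En n => x₀ + r • x := by fun_prop
  have lower : ∀ (v g : En n → ℝ) (c : ℝ), ContinuousOn v (closedBall x₀ (r * R)) →
      ContinuousOn g (closedBall x₀ (r * R)) → JetSuper lam Lam p (ball x₀ (r * R)) v g →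
      (∀ x ∈ closedBall x₀ (r * R), c ≤ v x) → (∀ x, |g x| = |f x|) →
      ENNReal.ofReal (1 / 2) * volume (ball (0 : En n) 1) ≤
        volume (ball (0 : En n) 1 ∩ {x | 1 ≤ (v (x₀ + r • x) - c) / (ω / 2)}) →
      ∀ x ∈ ball x₀ r, c + θ * (ω / 2) ≤ v x := by
    intro v g c hv hg hvJ hc hgf hvol x hx
    have key := H (fun x => (v (x₀ + r • x) - c) / (ω / 2))
      (fun x => r ^ (p + 2) / (ω / 2) ^ (p + 1) * g (x₀ + r • x))
      (((hv.comp hcont.continuousOn hmaps).sub continuousOn_const).div_const _)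
      (fun x hx => div_nonneg (sub_nonneg.2 (hc _ (hmaps hx))) hω2.le)
      (continuousOn_const.mul (hg.comp hcont.continuousOn hmaps))
      (hvJ.rescale (hlam.trans_le hlL).le hr hr1 hω2 fun x hx => add_smul_mem_ball hr hx)
      (by
        have h1 := lintegral_rescale p g x₀ hr hω2 R
        simp only [hgf] at h1
        have h2 := h1.le.trans hI
        rw [ENNReal.ofReal_mul (by positivity)] at h2
        exact (ENNReal.mul_le_mul_iff_right (by simp; positivity) ENNReal.ofReal_ne_top).1 h2)
      hvol (r⁻¹ • (x - x₀)) (by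
        rw [mem_ball_iff_norm] at hx
        rwa [mem_ball_zero_iff, norm_smul, norm_inv, Real.norm_of_nonneg hr.le,
          inv_mul_lt_iff₀ hr, mul_one])
    rw [smul_inv_smul₀ hr.ne', add_sub_cancel, le_div_iff₀ hω2] at key
    linarith
  have hmem : ∀ x ∈ ball x₀ r, x ∈ closedBall x₀ (r * R) := fun x hx =>
    closedBall_subset_closedBall (by nlinarith) (ball_subset_closedBall hx)
  rcases half_volume_ball_le (w := fun x => (u (x₀ + r • x) - a) / (ω / 2)) with h | h
  · have := lower u f a hu hf hJ (fun x hx => (hb x hx).1) (fun x => rfl) h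
    refine ⟨a + θ * (ω / 2), fun x hx => ⟨this x hx, ?_⟩⟩
    have := (hb x (hmem x hx)).2
    linarith
  · have := lower (fun x => -u x) (fun x => -f x) (-(a + ω)) hu.neg hf.neg hJ'
      (fun x hx => neg_le_neg (hb x hx).2) (fun x => abs_neg _) (h.trans (measure_mono fun x hx => by
        refine ⟨hx.1, ?_⟩
        have h1 := hx.2
        simp only [mem_ofPred_eq] at h1 ⊢
        rw [div_le_iff₀ hω2] at h1
        rw [le_div_iff₀ hω2]
        linarith))
    refine ⟨a, fun x hx => ⟨(hb x (hmem x hx)).1, ?_⟩⟩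
    have := this x hx
    linarith

theorem oscillation_iterate {E : Type*} [PseudoMetricSpace E] {u : E → ℝ} {x : E} {S τ ω : ℝ}
    (h0 : ∃ a, ∀ y ∈ closedBall x (1 / 2), a ≤ u y ∧ u y ≤ a + ω)
    (hstep : ∀ (k : ℕ) (a : ℝ), (∀ y ∈ closedBall x (S⁻¹ ^ k / 2), a ≤ u y ∧ u y ≤ a + τ ^ k * ω) →
      ∃ b, ∀ y ∈ closedBall x (S⁻¹ ^ (k + 1) / 2), b ≤ u y ∧ u y ≤ b + τ ^ (k + 1) * ω) (k : ℕ) :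
    ∃ a, ∀ y ∈ closedBall x (S⁻¹ ^ k / 2), a ≤ u y ∧ u y ≤ a + τ ^ k * ω := by
  induction k with
  | zero => simpa using h0
  | succ k ih => exact ih.elim (hstep k)

/-- Geometric decay of the oscillation implies a Hölder estimate. -/
theorem abs_sub_le_of_oscillation {E : Type*} [PseudoMetricSpace E] {u : E → ℝ} {x y : E}
    {S τ α ω : ℝ} (hS : 1 < S) (hα0 : 0 ≤ α) (hα : α ≤ 1) (hτ : τ = S⁻¹ ^ α) (hτ2 : 1 / 2 ≤ τ)
    (hω : 0 ≤ ω)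
    (h : ∀ k : ℕ, ∃ a, ∀ y ∈ closedBall x (S⁻¹ ^ k / 2), a ≤ u y ∧ u y ≤ a + τ ^ k * ω)
    (hxy : 0 < dist x y) (hxy' : dist x y ≤ 1 / 2) :
    |u x - u y| ≤ 4 * ω * dist x y ^ α := by
  have hS0 : 0 < S⁻¹ := by positivity
  obtain ⟨k, hk1, hk2⟩ := exists_nat_pow_near_of_lt_one (x := 2 * dist x y) (by linarith)
    (by linarith) hS0 (inv_lt_one_of_one_lt₀ hS)
  obtain ⟨a, ha⟩ := h k
  have hx := ha x (mem_closedBall_self (by positivity))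
  have hy := ha y (by rw [mem_closedBall, dist_comm]; linarith)
  have h1 : |u x - u y| ≤ τ ^ k * ω := by
    rw [abs_le]
    constructor <;> linarith
  have h2 : τ ^ (k + 1) ≤ 2 * dist x y ^ α := by
    calc τ ^ (k + 1) = (S⁻¹ ^ (k + 1)) ^ α := by
          rw [hτ, ← Real.rpow_natCast, ← Real.rpow_natCast, ← Real.rpow_mul hS0.le,
            ← Real.rpow_mul hS0.le, mul_comm]
      _ ≤ (2 * dist x y) ^ α := Real.rpow_le_rpow (by positivity) hk1.le hα0
      _ = 2 ^ α * dist x y ^ α := Real.mul_rpow (by norm_num) hxy.le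
      _ ≤ 2 * dist x y ^ α := by
          gcongr
          exact (Real.rpow_le_rpow_of_exponent_le (by norm_num) hα).trans_eq (Real.rpow_one 2)
  have h3 : τ ^ k ≤ 4 * dist x y ^ α := by
    rw [pow_succ] at h2
    have : 0 ≤ τ ^ k := pow_nonneg (by linarith) k
    nlinarith
  calc _ ≤ _ := h1
    _ ≤ 4 * dist x y ^ α * ω := by gcongr
    _ = _ := by ring

theorem lintegral_eq_LnNorm_pow {n : ℕ} (hn : 1 ≤ n) {f : En n → ℝ} {Ω : Set (En n)}
    (hf : IntegrableOn (fun x => |f x| ^ (n : ℝ)) Ω) :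
    ∫⁻ x in Ω, ENNReal.ofReal (|f x| ^ n) = ENNReal.ofReal (LnNorm f Ω ^ n) := by
  have h1 : LnNorm f Ω ^ n = ∫ x in Ω, |f x| ^ (n : ℝ) :=
    Real.rpow_inv_natCast_pow (integral_nonneg fun x => by positivity) (by omega)
  rw [h1, ofReal_integral_eq_lintegral_ofReal hf (ae_of_all _ fun x => by positivity)]
  simp only [Real.rpow_natCast]

theorem LnNorm_nonneg {n : ℕ} (f : En n → ℝ) (Ω : Set (En n)) : 0 ≤ LnNorm f Ω :=
  Real.rpow_nonneg (integral_nonneg fun x => by positivity) _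

theorem exists_rpow_eq_of_one_div_lt {S τ : ℝ} (hS : 1 < S) (hτ : S⁻¹ < τ) (hτ1 : τ < 1) :
    ∃ α ∈ Ioo (0 : ℝ) 1, τ = S⁻¹ ^ α := by
  have hS0 : 0 < S⁻¹ := by positivity
  have hlS : Real.log S⁻¹ < 0 := Real.log_neg hS0 (inv_lt_one_of_one_lt₀ hS)
  have hτ0 := hS0.trans hτ
  refine ⟨Real.log τ / Real.log S⁻¹, ⟨div_pos_of_neg_of_neg (Real.log_neg hτ0 hτ1) hlS, ?_⟩, ?_⟩
  · rw [div_lt_one_of_neg hlS]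
    exact Real.log_lt_log hS0 hτ
  · rw [Real.rpow_def_of_pos hS0, mul_div_cancel₀ _ hlS.ne, Real.exp_log hτ0]

theorem exists_holder_estimate {n : ℕ} (hn : 1 ≤ n) {lam Lam p : ℝ}
    (hlam : 0 < lam) (hlL : lam ≤ Lam) (hp : 0 ≤ p) :
    ∃ α K : ℝ, α ∈ Ioo (0 : ℝ) 1 ∧ 1 ≤ K ∧
      ∀ (u f : En n → ℝ) (N G : ℝ), ContinuousOn u (ball 0 1) → ContinuousOn f (ball 0 1) →
      JetSuper lam Lam p (ball 0 1) u f →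
      JetSuper lam Lam p (ball 0 1) (fun x => -u x) (fun x => -f x) →
      (∀ x ∈ ball 0 1, |u x| ≤ N) → 0 ≤ G →
      ∫⁻ x in ball 0 1, ENNReal.ofReal (|f x| ^ n) ≤ ENNReal.ofReal ((G ^ (p + 1)) ^ n) →
      ∀ ω, 2 * N + K * G ≤ ω → 0 < ω → ∀ x ∈ ball (0 : En n) (1 / 2),
      ∀ y ∈ ball (0 : En n) (1 / 2), |u x - u y| ≤ 4 * ω * dist x y ^ α := by
  obtain ⟨R, θ, ε, hR, hθ, hθ1, hε, H⟩ := exists_oscillation_decay (n := n) hn hlam hlL hp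
  have hS : 1 < 2 * R := by linarith
  have hSτ : (2 * R)⁻¹ < 1 - θ / 2 := by
    have : (2 * R)⁻¹ ≤ (8 : ℝ)⁻¹ := inv_anti₀ (by norm_num) (by linarith)
    linarith
  obtain ⟨α, hα, hτ⟩ := exists_rpow_eq_of_one_div_lt hS hSτ (by linarith)
  refine ⟨α, 1 + ε⁻¹, hα, by linarith [inv_pos.2 hε], ?_⟩
  intro u f N G hu hf hJ hJ' huN hG hfG ω hω hω0 x hx y hy
  have hx1 : ‖x‖ < 1 / 2 := mem_ball_zero_iff.1 hx
  have hy1 : ‖y‖ < 1 / 2 := mem_ball_zero_iff.1 hy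
  have hN : 0 ≤ N := (abs_nonneg _).trans (huN 0 (mem_ball_self one_pos))
  have hball : ∀ t : ℝ, t ≤ 1 / 2 → closedBall x t ⊆ ball 0 1 := fun t ht z hz => by
    rw [mem_closedBall, dist_eq_norm] at hz
    rw [mem_ball_zero_iff]
    have := norm_le_norm_sub_add z x
    linarith
  have hKG : 2 * N ≤ ω ∧ (1 + ε⁻¹) * G ≤ ω := by
    have : 0 ≤ (1 + ε⁻¹) * G := by positivity
    constructor <;> linarith
  rcases eq_or_ne x y with rfl | hne
  · simp [Real.zero_rpow hα.1.ne']
  rcases le_or_gt (dist x y) (1 / 2) with hd | hd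
  · refine abs_sub_le_of_oscillation hS hα.1.le hα.2.le hτ (by linarith) hω0.le
      (oscillation_iterate ⟨-N, fun z hz => ?_⟩ fun k a ha => ?_) (dist_pos.2 hne) hd
    · have := abs_le.1 (huN z (hball _ le_rfl hz))
      exact ⟨this.1, by linarith⟩
    · have hR0 : 0 < R := by linarith
      set S := 2 * R with hSdef
      have hS0 : 0 < S := by linarith
      set r := S⁻¹ ^ (k + 1) with hr
      have hr0 : 0 < r := by positivity
      have hrk : r * R = S⁻¹ ^ k / 2 := by
        rw [hr, pow_succ, hSdef]
        field_simp
      have hk1 : S⁻¹ ^ k ≤ 1 := pow_le_one₀ (by positivity) (inv_lt_one_of_one_lt₀ hS).le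
      have hsub : closedBall x (r * R) ⊆ ball 0 1 := hball _ (by linarith)
      have hsub' : ball x (r * R) ⊆ ball 0 1 := ball_subset_closedBall.trans hsub
      have hτ0 : 0 < 1 - θ / 2 := by linarith
      have hτk : 0 < (1 - θ / 2) ^ k := by positivity
      have hωr : ω ≤ (1 - θ / 2) ^ k * ω / 2 / r := by
        have h1 : S⁻¹ ^ k ≤ (1 - θ / 2) ^ k := pow_le_pow_left₀ (by positivity) hSτ.le k
        have h2 : r * 2 ≤ S⁻¹ ^ k := by nlinarith
        rw [le_div_iff₀ hr0]
        nlinarith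
      obtain ⟨b, hb⟩ := H u f x r a ((1 - θ / 2) ^ k * ω) hr0
        (pow_le_one₀ (by positivity) (inv_lt_one_of_one_lt₀ hS).le) (by positivity)
        (hu.mono hsub) (hf.mono hsub) (fun z hz => hJ z (hsub' hz))
        (fun z hz => hJ' z (hsub' hz)) (by rwa [hrk])
        (by
          refine (lintegral_mono_set hsub').trans (hfG.trans (ENNReal.ofReal_le_ofReal ?_))
          have hK : 1 ≤ ((1 + ε⁻¹) ^ (p + 1)) ^ n * ε := by
            have h1 : (1 : ℝ) ≤ 1 + ε⁻¹ := by linarith [inv_pos.2 hε]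
            have h2 : 1 + ε⁻¹ ≤ (1 + ε⁻¹) ^ (p + 1) :=
              Real.self_le_rpow_of_one_le h1 (by linarith)
            have h3 : 1 + ε⁻¹ ≤ ((1 + ε⁻¹) ^ (p + 1)) ^ n :=
              h2.trans (le_self_pow₀ (h1.trans h2) (by omega))
            calc (1 : ℝ) ≤ (1 + ε⁻¹) * ε := by
                  rw [add_mul, inv_mul_cancel₀ hε.ne']
                  linarith
              _ ≤ _ := by gcongr
          calc (G ^ (p + 1)) ^ n ≤ (G ^ (p + 1)) ^ n * (((1 + ε⁻¹) ^ (p + 1)) ^ n * ε) :=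
                le_mul_of_one_le_right (by positivity) hK
            _ = (((1 + ε⁻¹) * G) ^ (p + 1)) ^ n * ε := by
                rw [Real.mul_rpow (by positivity) hG, mul_pow]
                ring
            _ ≤ _ := by
                have := hKG.2.trans hωr
                gcongr)
      refine ⟨b, fun z hz => ?_⟩
      have := hb z (closedBall_subset_ball (by linarith) hz)
      rwa [← mul_assoc, ← pow_succ'] at this
  · have h1 := abs_le.1 (huN x (ball_subset_ball (by norm_num) hx))
    have h2 := abs_le.1 (huN y (ball_subset_ball (by norm_num) hy))
    have h3 : |u x - u y| ≤ ω := by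
      rw [abs_le]
      constructor <;> linarith
    have h4 : dist x y ≤ dist x y ^ α := by
      have hd1 : dist x y ≤ 1 := by
        rw [dist_eq_norm]
        exact (norm_sub_le _ _).trans (by linarith)
      simpa using Real.rpow_le_rpow_of_exponent_ge (dist_pos.2 hne) hd1 hα.2.le
    nlinarith

/-- **Interior Hölder regularity** (Theorem 1.1): there are `α ∈ (0,1)` and `C > 0`, depending
only on `n, λ, Λ, p`, such that any bounded continuous viscosity solution `u` of the degenerate
fully nonlinear pseudo-p-Laplacian inequalities in `B₁` with `f ∈ C ∩ Lⁿ(B₁)` satisfies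
`|u(x) − u(y)| ≤ C (sup_{B₁}|u| + ‖f‖_{Lⁿ(B₁)}^{1/(1+p)}) |x−y|^α` for `x, y ∈ B_{1/2}`. -/
theorem holder_regularity (n : ℕ) (hn : 1 ≤ n) (lam Lam p : ℝ)
    (hlam : 0 < lam) (hlL : lam ≤ Lam) (hp : 0 ≤ p) :
    ∃ α C : ℝ, α ∈ Set.Ioo (0:ℝ) 1 ∧ 0 < C ∧
      ∀ u f : En n → ℝ,
        ContinuousOn u (ball (0 : En n) 1) →
        BddAbove ((fun x => |u x|) '' ball (0 : En n) 1) →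
        ContinuousOn f (ball (0 : En n) 1) →
        IntegrableOn (fun x => |f x| ^ (n : ℝ)) (ball (0 : En n) 1) →
        IsViscSuper lam Lam p (ball (0 : En n) 1) u f →
        IsViscSub lam Lam p (ball (0 : En n) 1) u f →
        ∀ x ∈ ball (0 : En n) (1/2), ∀ y ∈ ball (0 : En n) (1/2),
          |u x - u y| ≤
            C * (sSup ((fun z => |u z|) '' ball (0 : En n) 1)
              + LnNorm f (ball (0 : En n) 1) ^ (1 / (1 + p))) * ‖x - y‖ ^ α := by
  obtain ⟨α, K, hα, hK, H⟩ := exists_holder_estimate (n := n) hn hlam hlL hp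
  refine ⟨α, 4 * (2 + K), hα, by linarith, ?_⟩
  intro u f hu hub hf hfi hsuper hsub x hx y hy
  set N := sSup ((fun z => |u z|) '' ball (0 : En n) 1) with hNdef
  set F := LnNorm f (ball (0 : En n) 1) with hF
  have hF0 : 0 ≤ F := LnNorm_nonneg _ _
  have huN : ∀ x ∈ ball (0 : En n) 1, |u x| ≤ N := fun x hx =>
    le_csSup hub (mem_image_of_mem _ hx)
  have hN : 0 ≤ N := (abs_nonneg _).trans (huN 0 (mem_ball_self one_pos))
  have hG : 0 ≤ F ^ (1 / (1 + p)) := by positivity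
  have hGF : (F ^ (1 / (1 + p))) ^ (p + 1) = F := by
    rw [← Real.rpow_mul hF0, add_comm p, one_div_mul_cancel (by linarith), Real.rpow_one]
  have key := H u f N (F ^ (1 / (1 + p))) hu hf (hsuper.jetSuper hlL) (hsub.jetSuper_neg hlL) huN hG
    (by rw [hGF, lintegral_eq_LnNorm_pow hn hfi])
  generalize F ^ (1 / (1 + p)) = G at hG key ⊢
  have hlim : |u x - u y| ≤ 4 * (2 * N + K * G) * dist x y ^ α := by
    refine ge_of_tendsto (x := nhdsWithin (2 * N + K * G) (Ioi (2 * N + K * G)))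
      (f := fun ω => 4 * ω * dist x y ^ α)
      (((Continuous.tendsto (by fun_prop) _)).mono_left nhdsWithin_le_nhds) ?_
    filter_upwards [self_mem_nhdsWithin] with ω hω
    exact key ω (le_of_lt hω) (lt_of_le_of_lt (by positivity) hω) x hx y hy
  rw [← dist_eq_norm]
  refine hlim.trans ?_
  have h1 : 2 * N + K * G ≤ (2 + K) * (N + G) := by nlinarith
  calc 4 * (2 * N + K * G) * dist x y ^ α ≤ 4 * ((2 + K) * (N + G)) * dist x y ^ α := by gcongr
    _ = _ := by ring
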